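/- Let u and v be coprime integers with u > v ≥ 2, and let k ≥ 0 be an integer. Then as N → ∞, ((k+1)!/(2πi)^{k+1}) · Σ_{1 ≤ |n| ≤ N} ζ(−k + 2πin/log(u/v)) / n^{k+1} = −(1/(log(u/v))^k) · Σ_{0 < h < (log N)/(log(u/v)), h ∈ ℤ} ψ_{k+1}((u/v)^h) + o(log N), where the o-term may depend on k, u, v. Consequently, the sequence ((u/v)^h)_{h=1}^∞ is uniformly distributed modulo 1 if and only if for every integer k ≥ 0, lim_{N→∞} (1/log N) · Σ_{1 ≤ |n| ≤ N} ζ(−k + 2πin/log(u/v)) / n^{k+1} = 0. -/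

import Mathlib

/-- The `k`-th periodic Bernoulli polynomial: `ψ_k(x) = B_k({x})` for `k ≠ 1`,
and `ψ_1(x) = {x} - 1/2` for non-integer `x`, `ψ_1(x) = 0` for integer `x`. -/
noncomputable def psiB (k : ℕ) (x : ℝ) : ℝ :=
  if k = 1 then (if Int.fract x = 0 then 0 else Int.fract x - 1 / 2)
  else Polynomial.aeval (Int.fract x) (Polynomial.bernoulli k)

/-- A sequence `(x_h)_{h≥1}` of reals is uniformly distributed modulo 1: for every
real continuous `f` on `[0,1]`, `(1/H) Σ_{h=1}^H f({x_h}) → ∫_0^1 f`. -/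
def UnifDistModOne (x : ℕ → ℝ) : Prop :=
  ∀ f : ℝ → ℝ, ContinuousOn f (Set.Icc 0 1) →
    Filter.Tendsto
      (fun H : ℕ => (1 / (H : ℝ)) * ∑ h ∈ Finset.Icc 1 H, f (Int.fract (x h)))
      Filter.atTop (nhds (∫ t in (0 : ℝ)..1, f t))


alias zaa := mul_le_mul_of_nonneg_left
alias zab := mul_le_mul_of_nonneg_right
alias zac := Real.norm_eq_abs
alias zad := intervalIntegral.integral_const_mul
alias zae := div_le_iff₀
alias zaf := Continuous.intervalIntegrable
alias zag := intervalIntegral.norm_integral_le_of_norm_le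
alias zah := Finset.sum_congr
alias zba := Finset.sum_le_sum
alias zbb := Finset.mem_range
alias zbc := abs_of_nonneg
alias zbd := Complex.norm_real
alias zbe := Finset.mul_sum
alias zbf := Real.norm_of_nonneg
alias zbg := Finset.abs_sum_le_sum_abs
alias zbh := intervalIntegral.norm_integral_le_of_norm_le_const
alias zca := Real.exp_nat_mul
alias zcb := intervalIntegral.integral_add_adjacent_intervals
alias zcc := Finset.prod_pow_eq_pow_sum
alias zcd := Finset.sum_le_card_nsmul
alias zce := div_le_div_iff₀
alias zcf := intervalIntegral.integral_congr
alias zcg := continuous_iff_continuousAt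
alias zch := Finset.sum_le_sum_of_subset_of_nonneg
alias zda := intervalIntegral.integral_add
alias zdb := intervalIntegral.integral_eq_sub_of_hasDerivAt
alias zdc := intervalIntegral.integral_ofReal
alias zdd := intervalIntegral.integral_finsetSum
alias zde := Finset.sum_add_distrib
alias zdf := Finset.prod_mul_distrib
alias zdg := Finset.ne_of_mem_erase
alias zdh := intervalIntegral.integral_sub
alias zea := abs_of_pos
alias zeb := norm_add_le
alias zec := add_le_add
alias zed := hasDerivAt_id
alias zee := smul_eq_mul
set_option hygiene false
local notation "ZZ" => ℤ
local notation "QQ" => ℚ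
local notation "NN" => ℕ
local notation "CC" => ℂ
local notation "RR" => ℝ
local notation "Ya" f:60 => ∫ y in (0:RR)..(1/2), f
local notation "Yb" f:60 => ∫ y in (-(1/2):RR)..(1/2), f
local notation "Yc" f:60 => ∫ t in (0:RR)..1, f
local notation "Yd" => (X * exp (L * y))
local notation "Ye" => (by positivity)
local notation "Yf" => (1/2)
local notation "Yg" => (L * (i+1))
local notation "Yh" => (0:RR)
local notation "Yi" => (L * y)
local notation "Yj" => (by fun_prop)
local notation "Yk" => ((⌊X⌋ - i : ZZ) : RR)
local notation "Yl" => (k+1)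
local notation "Ym" => (j + 1)
local notation "Yn" => (by norm_num)
local notation "Yo" => (i+1)
local notation "Yp" => ((⌊X⌋ + 1 + i : ZZ) : RR)
local notation "Yq" => (L * Yf)
local notation "Yr" => (1:RR)
local notation "Ys" => (∑ i, d i)
local notation "Yt" => (eW (2 * Real.pi * m * X) L y + eW (2 * Real.pi * m * X) (-L) y)
local notation "Yu" => (M + 1/2)
local notation "Yv" => (n:CC)
local notation "Yw" => (-(k:CC) + (τ * Complex.I) * n)
local notation "Yx" => (F1 y ^ 2 + μ ^ 2)
local notation "Yy" => (t * ((j : RR) / d - 1/2))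
local notation "Yz" => (bz j (exp Yi) : CC)
local notation "Wa" => ((X * exp (-L * y) : RR) : UnitAddCircle)
local notation "Wb" => ((v : QQ) ^ b i * w i)
local notation "Wc" => ((u:RR)/v)
local notation "Wd" => (2 * N + 1)
local notation "We" => (η + ‖∑ n ∈ t, β n * en n y‖^2 / η)
local notation "Wf" => (X * exp (-L * y))
local notation "Wg" => (by omega)
local notation "Wh" => (0 : RR)
local notation "Wi" => (Λ * y)
local notation "Wj" => ((X * exp Yi : RR) : UnitAddCircle)
local notation "Wk" => (by linarith)
local notation "Wl" => (Real.pi * y)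
local notation "Wm" => (wt d (toF f) - m / 2)
local notation "Wn" => ((i:RR)+1)
local notation "Wo" => (eW A L y + eW A (-L) y)
local notation "Wp" => (k + 2)
local notation "Wq" => (-(ρ * (D0 * κ)))
local notation "Wr" => ((2 * cos (A * L * y) : RR) : CC)
local notation "Ws" => (n:RR)
local notation "Wt" => (k + 1)
local notation "Wu" => (Nat.factorial Yl : CC)
local notation "Wv" => (-(s + (k + 2 : NN)))
local notation "Ww" => (fun t => p.eval t)
local notation "Wx" => (Int.castRingHom QQ)
local notation "Wy" => (L * ((H + 1 : NN) : RR))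
local notation "Wz" => (‖Q.eval 0‖ + Cb)
local notation "Va" => ((u : RR) / v)
local notation "Vb" => (s + j)
local notation "Vc" => (k + 1 : NN)
local notation "Vd" => (L:CC)
local notation "Ve" => (L * t)
local notation "Vf" => ((G - Ψ : RR) : CC)
local notation "Vg" => (-Yf:RR)
local notation "Vh" => (∀ w : ZZ, δ ≤ |X - w|)
local notation "Vi" => (m + 3)
local notation "Vj" => (X / (N * δ))
local notation "Vk" => (0 ≤ y i ∧ y i ≤ 1/2)
local notation "Vl" => (-(N:ZZ))
set_option hygiene true

section PartM
open MvPolynomial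
/-- generic Taylor expansion -/
noncomputable def tayl (σ : Type) (R : Type) [CommRing R] :
    MvPolynomial σ R →ₐ[R] MvPolynomial σ (MvPolynomial σ R) :=
  aeval (fun i => C (X i) + X i)
/-- Hasse derivative -/
noncomputable def hs {σ R : Type} [CommRing R] (J : σ →₀ NN) (P : MvPolynomial σ R) :
    MvPolynomial σ R := coeff J (tayl σ R P)
lemma hs_add {σ R : Type} [CommRing R] (J : σ →₀ NN) (P Q : MvPolynomial σ R) :
    hs J (P + Q) = hs J P + hs J Q := by simp [hs]
lemma hs_smul {σ R : Type} [CommRing R] (J : σ →₀ NN) (c : R) (P : MvPolynomial σ R) :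
    hs J (c • P) = c • hs J P := by
  simp only [hs, map_smul, coeff_smul]
noncomputable def hsL {σ R : Type} [CommRing R] (J : σ →₀ NN) :
    MvPolynomial σ R →ₗ[R] MvPolynomial σ R where
  toFun := hs J
  map_add' := hs_add J
  map_smul' := fun c P => hs_smul J c P
lemma hs_sum {σ R ι : Type} [CommRing R] (J : σ →₀ NN) (s : Finset ι) (f : ι -> MvPolynomial σ R) :
    hs J (∑ i ∈ s, f i) = ∑ i ∈ s, hs J (f i) := map_sum (hsL J) f s
lemma hs_mul {σ R : Type} [CommRing R] [DecidableEq σ] (J : σ →₀ NN) (P Q : MvPolynomial σ R) :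
    hs J (P * Q) = ∑ x ∈ Finset.HasAntidiagonal.antidiagonal J, hs x.1 P * hs x.2 Q := by
  simp only [hs, map_mul, coeff_mul]
lemma hs_mul_X {σ R : Type} [CommRing R] [DecidableEq σ] (J : σ →₀ NN) (P : MvPolynomial σ R) (n : σ) :
    hs J (P * X n) = hs J P * X n + if n ∈ J.support then hs (J - Finsupp.single n 1) P else 0 := by
  simp only [hs, map_mul]
  rw [show tayl σ R (X n) = C (X n) + X n from by simp [tayl], mul_add, coeff_add, mul_comm _ (C (X n)),
    coeff_C_mul, coeff_mul_X', mul_comm (X n)]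
lemma hs_C {σ R : Type} [CommRing R] [DecidableEq σ] (J : σ →₀ NN) (c : R) :
    hs J (C c : MvPolynomial σ R) = if J = 0 then C c else 0 := by
  simp only [hs]
  rw [show tayl σ R (C c) = C (C c) from by simp [tayl, MvPolynomial.algebraMap_eq,
    IsScalarTower.algebraMap_apply R (MvPolynomial σ R) (MvPolynomial σ (MvPolynomial σ R))], coeff_C]
  simp [eq_comm]
lemma hs_monomial {σ R : Type} [CommRing R] [Fintype σ] [DecidableEq σ] (I J : σ →₀ NN) (c : R) :
    hs J (monomial I c) = monomial (I - J) (((∏ i, (I i).choose (J i) : NN) : R) * c) := by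
  induction hn : I.degree generalizing I J with
  | zero =>
    have hI : I = 0 := (Finsupp.degree_eq_zero_iff I).1 hn
    subst hI
    rw [show (monomial 0 c : MvPolynomial σ R) = C c from rfl, hs_C]
    split_ifs with h
    · subst h; simp
    · have : ∏ i, ((0 : σ →₀ NN) i).choose (J i) = 0 := by
        obtain ⟨i, hi⟩ := Finsupp.ne_iff.1 h
        refine Finset.prod_eq_zero (Finset.mem_univ i) ?_
        exact Nat.choose_eq_zero_of_lt (Nat.pos_of_ne_zero hi)
      rw [this]; simp
  | succ N ih =>
    have hI : I ≠ 0 := by rintro rfl; simp at hn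
    obtain ⟨n, hn0⟩ := Finsupp.ne_iff.1 hI
    simp only [Finsupp.coe_zero, Pi.zero_apply] at hn0
    obtain ⟨I', rfl⟩ : ∃ I', I = I' + Finsupp.single n 1 :=
      ⟨I - Finsupp.single n 1, by
        ext j; by_cases hj : n = j
        · subst hj; simp; omega
        · simp [Finsupp.single_apply, hj]⟩
    have hd : I'.degree = N := by simpa using hn
    have key : monomial (I' + Finsupp.single n 1) c = monomial I' c * X n := by
      rw [X, monomial_mul, mul_one]
    rw [key, hs_mul_X, ih I' _ hd, ih I' _ hd]
    have e1 : ∀ (A : σ →₀ NN) (a : R), monomial A a * X n = monomial (A + Finsupp.single n 1) a := by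
      intro A a; rw [X, monomial_mul, mul_one]
    rw [e1]
    have pr : ∀ (A B : σ →₀ NN), (∏ i, (A i).choose (B i) : NN) =
        (A n).choose (B n) * ∏ i ∈ Finset.univ.erase n, (A i).choose (B i) := fun A B =>
      (Finset.mul_prod_erase _ _ (Finset.mem_univ n)).symm
    have er : ∏ i ∈ Finset.univ.erase n, ((I' + Finsupp.single n 1 : σ →₀ NN) i).choose (J i)
        = ∏ i ∈ Finset.univ.erase n, (I' i).choose (J i) := by
      refine Finset.prod_congr rfl fun i hi => ?_
      have : n ≠ i := (zdg hi).symm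
      simp [Finsupp.single_apply, this]
    have er2 : ∏ i ∈ Finset.univ.erase n, (I' i).choose ((J - Finsupp.single n 1 : σ →₀ NN) i)
        = ∏ i ∈ Finset.univ.erase n, (I' i).choose (J i) := by
      refine Finset.prod_congr rfl fun i hi => ?_
      have : n ≠ i := (zdg hi).symm
      simp [Finsupp.single_apply, this]
    by_cases hJ : J n = 0
    · have hJ' : n ∉ J.support := by simpa using hJ
      rw [if_neg hJ', add_zero, pr, pr (I' + _), er]
      congr 2
      · ext j; by_cases hj : n = j
        · subst hj; simp [hJ]
        · simp [Finsupp.single_apply, hj]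
      · simp [hJ]
    · have hJ' : n ∈ J.support := by simpa using hJ
      obtain ⟨t, ht⟩ := Nat.exists_eq_succ_of_ne_zero hJ
      have e2 : I' - (J - Finsupp.single n 1) = I' + Finsupp.single n 1 - J := by
        ext j; by_cases hj : n = j
        · subst hj; simp; omega
        · simp [Finsupp.single_apply, hj]
      rw [if_pos hJ', pr I' J, pr (I' + _), pr I' (J - _), er, er2, e2]
      by_cases hlt : I' n < J n
      · rw [Nat.choose_eq_zero_of_lt hlt]
        simp only [zero_mul, Nat.cast_zero, monomial_zero, zero_add]
        congr 3
        have : (I' n).choose (t+1) = 0 := Nat.choose_eq_zero_of_lt Wg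
        simp [ht, Nat.choose_succ_succ, this]
      · have e3 : I' - J + Finsupp.single n 1 = I' + Finsupp.single n 1 - J := by
          ext j; by_cases hj : n = j
          · subst hj; simp; omega
          · simp [Finsupp.single_apply, hj]
        rw [e3, <- map_add]
        congr 1
        simp only [Finsupp.coe_add, Pi.add_apply, Finsupp.single_eq_same, Finsupp.coe_tsub,
          Pi.sub_apply, ht, Nat.add_sub_cancel, Nat.succ_eq_add_one, Nat.choose_succ_succ]
        push_cast; ring
end PartM
section PartM2
open MvPolynomial
lemma coeff_hs {σ R : Type} [CommRing R] [Fintype σ] [DecidableEq σ] (I J : σ →₀ NN)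
    (P : MvPolynomial σ R) :
    coeff I (hs J P) = ((∏ i, (I i + J i).choose (J i) : NN) : R) * coeff (I + J) P := by
  induction P using MvPolynomial.induction_on' with
  | monomial A c =>
    rw [hs_monomial, coeff_monomial, coeff_monomial]
    by_cases h : A = I + J
    · subst h; simp
    · rw [if_neg h, mul_zero]
      split_ifs with h2
      · have : ¬ J <= A := by
          intro hJ; apply h; rw [<- h2, tsub_add_cancel_of_le hJ]
        obtain ⟨i, hi⟩ : ∃ i, A i < J i := by
          by_contra hc; push Not at hc; exact this hc
        have : ∏ i, (A i).choose (J i) = 0 :=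
          Finset.prod_eq_zero (Finset.mem_univ i) (Nat.choose_eq_zero_of_lt hi)
        rw [this]; simp
      · rfl
  | add p q hp hq => rw [hs_add, coeff_add, coeff_add, hp, hq]; ring
lemma pderiv_hs {σ : Type} [Fintype σ] [DecidableEq σ] (J : σ →₀ NN) (i : σ)
    (P : MvPolynomial σ QQ) :
    pderiv i (hs J P) = ((J i + 1 : NN) : QQ) • hs (J + Finsupp.single i 1) P := by
  induction P using MvPolynomial.induction_on' with
  | monomial A c =>
    rw [hs_monomial, pderiv_monomial, hs_monomial, smul_monomial, tsub_tsub]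
    congr 1
    rw [<- Finset.mul_prod_erase _ _ (Finset.mem_univ i), <- Finset.mul_prod_erase _ _ (Finset.mem_univ i)]
    have er : ∏ x ∈ Finset.univ.erase i, (A x).choose ((J + Finsupp.single i 1 : σ →₀ NN) x)
        = ∏ x ∈ Finset.univ.erase i, (A x).choose (J x) := by
      refine Finset.prod_congr rfl fun x hx => ?_
      have : i ≠ x := (zdg hx).symm
      simp [Finsupp.single_apply, this]
    rw [er]
    have h := Nat.choose_succ_right_eq (A i) (J i)
    have h' : ((A i).choose (J i + 1) : QQ) * (J i + 1 : NN) = (A i).choose (J i) * ((A i - J i : NN) : QQ) := by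
      exact_mod_cast h
    simp only [Finsupp.coe_tsub, Pi.sub_apply, Finsupp.coe_add, Pi.add_apply, Finsupp.single_eq_same,
      zee, Nat.cast_mul]
    linear_combination (-(c * ((∏ x ∈ Finset.univ.erase i, (A x).choose (J x) : NN) : QQ))) * h'
  | add p q hp hq => rw [hs_add, map_add, hp, hq, hs_add, smul_add]
lemma hs_hs {σ R : Type} [CommRing R] [Fintype σ] [DecidableEq σ] (J K : σ →₀ NN)
    (P : MvPolynomial σ R) :
    hs K (hs J P) = ((∏ i, (J i + K i).choose (J i) : NN) : R) • hs (J + K) P := by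
  ext I
  rw [coeff_hs, coeff_hs, coeff_smul, coeff_hs, zee, <- mul_assoc, <- mul_assoc,
    show I + K + J = I + (J + K) by abel, <- Nat.cast_mul, <- Nat.cast_mul, <- zdf,
    <- zdf]
  congr 2
  refine Finset.prod_congr rfl fun i _ => ?_
  have := Nat.choose_mul (n := I i + (J i + K i)) (k := J i + K i) (s := J i) Wg
  simp only [Finsupp.coe_add, Pi.add_apply]
  rw [show I i + (J i + K i) - J i = I i + K i by omega, show J i + K i - J i = K i by omega] at this
  rw [show I i + K i + J i = I i + (J i + K i) by omega]
  linarith [mul_comm ((J i + K i).choose (J i)) ((I i + (J i + K i)).choose (J i + K i)), mul_comm ((I i + K i).choose (K i)) ((I i + (J i + K i)).choose (J i))]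
lemma mem_support_hs {σ R : Type} [CommRing R] [Fintype σ] [DecidableEq σ] {I J : σ →₀ NN}
    {P : MvPolynomial σ R} (h : I ∈ (hs J P).support) : I + J ∈ P.support := by
  rw [mem_support_iff] at h ⊢
  rw [coeff_hs] at h
  exact right_ne_zero_of_mul h
lemma hs_map {σ R S : Type} [CommRing R] [CommRing S] [Fintype σ] [DecidableEq σ] (f : R →+* S)
    (J : σ →₀ NN) (P : MvPolynomial σ R) : hs J (map f P) = map f (hs J P) := by
  ext I; simp [coeff_hs, coeff_map]
lemma degreeOf_hs {σ R : Type} [CommRing R] [Fintype σ] [DecidableEq σ] (J : σ →₀ NN)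
    (P : MvPolynomial σ R) (i : σ) : degreeOf i (hs J P) <= degreeOf i P := by
  rw [degreeOf_le_iff]
  intro I hI
  have := monomial_le_degreeOf i (mem_support_hs hI)
  simp only [Finsupp.coe_add, Pi.add_apply] at this; omega
/-- sum of absolute values of coefficients -/
noncomputable def n1 {σ : Type} (P : MvPolynomial σ QQ) : RR := ∑ I ∈ P.support, |((coeff I P : QQ) : RR)|
lemma n1_eq {σ : Type} (P : MvPolynomial σ QQ) {S : Finset (σ →₀ NN)} (h : P.support ⊆ S) :
    n1 P = ∑ I ∈ S, |((coeff I P : QQ) : RR)| := by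
  refine Finset.sum_subset h fun I _ hI => ?_
  rw [notMem_support_iff.1 hI]; simp
lemma n1_nonneg {σ : Type} (P : MvPolynomial σ QQ) : 0 <= n1 P := Finset.sum_nonneg fun _ _ => abs_nonneg _
lemma n1_add_le {σ : Type} [DecidableEq σ] (P Q : MvPolynomial σ QQ) : n1 (P + Q) <= n1 P + n1 Q := by
  rw [n1_eq (P + Q) support_add, n1_eq P (Finset.subset_union_left (s₂ := Q.support)),
    n1_eq Q (Finset.subset_union_right (s₁ := P.support)), <- zde]
  refine zba fun I _ => ?_
  rw [coeff_add]; push_cast; exact abs_add_le _ _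
lemma n1_sum_le {σ ι : Type} [DecidableEq σ] (s : Finset ι) (f : ι -> MvPolynomial σ QQ) :
    n1 (∑ i ∈ s, f i) <= ∑ i ∈ s, n1 (f i) := by
  classical
  induction s using Finset.induction_on with
  | empty => simp [n1]
  | insert a s ha ih =>
    rw [Finset.sum_insert ha, Finset.sum_insert ha]
    exact (n1_add_le _ _).trans Wk
lemma n1_monomial {σ : Type} (I : σ →₀ NN) (c : QQ) : n1 (monomial I c) = |(c : RR)| := by
  classical
  rw [n1_eq _ (support_monomial_subset)]; simp
lemma n1_mul_le {σ : Type} [DecidableEq σ] (P Q : MvPolynomial σ QQ) : n1 (P * Q) <= n1 P * n1 Q := by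
  conv_lhs => rw [P.as_sum, Q.as_sum, Finset.sum_mul_sum]
  refine (n1_sum_le _ _).trans ?_
  rw [n1, n1, Finset.sum_mul_sum]
  refine zba fun I _ => (n1_sum_le _ _).trans ?_
  refine zba fun J _ => ?_
  rw [monomial_mul, n1_monomial]; push_cast; rw [abs_mul]
lemma n1_prod_le {σ ι : Type} [DecidableEq σ] (s : Finset ι) (f : ι -> MvPolynomial σ QQ) :
    n1 (∏ i ∈ s, f i) <= ∏ i ∈ s, n1 (f i) := by
  classical
  induction s using Finset.induction_on with
  | empty =>
    rw [Finset.prod_empty, Finset.prod_empty, show (1 : MvPolynomial σ QQ) = monomial 0 1 from rfl, n1_monomial]; norm_num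
  | insert a s ha ih =>
    rw [Finset.prod_insert ha, Finset.prod_insert ha]
    exact (n1_mul_le _ _).trans (zaa ih (n1_nonneg _))
lemma n1_smul_sign {σ : Type} (e : ZZ ˣ) (P : MvPolynomial σ QQ) : n1 (e • P) = n1 P := by
  rcases Int.units_eq_one_or e with rfl | rfl
  · rw [one_smul]
  · rw [Units.neg_smul, one_smul, n1, n1, support_neg]
    refine zah rfl fun I _ => ?_
    rw [coeff_neg]; push_cast; exact abs_neg _
lemma n1_det_le {σ : Type} [DecidableEq σ] {l : NN} (M : Matrix (Fin l) (Fin l) (MvPolynomial σ QQ)) (B : RR)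
    (h : ∀ a b, n1 (M a b) <= B) : n1 M.det <= l.factorial * B ^ l := by
  rw [Matrix.det_apply]
  refine (n1_sum_le _ _).trans ?_
  have : ∀ s ∈ (Finset.univ : Finset (Equiv.Perm (Fin l))),
      n1 (Equiv.Perm.sign s • ∏ i, M (s i) i) <= B ^ l := by
    intro s _
    rw [n1_smul_sign]
    refine (n1_prod_le _ _).trans ?_
    refine (Finset.prod_le_prod (fun i _ => n1_nonneg _) (fun i _ => h _ _)).trans ?_
    simp
  refine (zcd _ _ _ this).trans ?_
  simp [Fintype.card_perm]
lemma n1_hs_le {σ : Type} [Fintype σ] [DecidableEq σ] (J : σ →₀ NN) (P : MvPolynomial σ QQ) (d : σ -> NN)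
    (hd : ∀ i, degreeOf i P <= d i) : n1 (hs J P) <= 2 ^ Ys * n1 P := by
  conv_lhs => rw [P.as_sum, hs_sum]
  refine (n1_sum_le _ _).trans ?_
  rw [n1, zbe]
  refine zba fun I hI => ?_
  rw [hs_monomial, n1_monomial]; push_cast; rw [abs_mul]
  refine zab ?_ (abs_nonneg _)
  rw [zbc Ye, <- zcc]
  refine Finset.prod_le_prod (fun i _ => by positivity) fun i _ => ?_
  have h1 : (I i).choose (J i) <= 2 ^ d i :=
    (Nat.choose_le_two_pow _ _).trans (Nat.pow_le_pow_right Yn ((monomial_le_degreeOf i hI).trans (hd i)))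
  exact_mod_cast h1
end PartM2
section PartM3
open MvPolynomial MonomialOrder
lemma coeff_X_mul_pderiv {m : NN} (i : Fin m) (P : MvPolynomial (Fin m) QQ) (I : Fin m →₀ NN) :
    coeff I (X i * pderiv i P) = (I i : QQ) * coeff I P := by
  induction P using MvPolynomial.induction_on' with
  | monomial A c =>
    rw [pderiv_monomial, X, monomial_mul, one_mul, coeff_monomial, coeff_monomial]
    by_cases h : A = I
    · subst h
      rw [if_pos rfl]
      by_cases h0 : A i = 0
      · rw [h0]; simp
      · rw [if_pos]
        · ring
        · ext j; by_cases hj : i = j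
          · subst hj; simp; omega
          · simp [Finsupp.single_apply, hj]
    · rw [if_neg h, mul_zero]
      split_ifs with h2
      · by_cases h0 : A i = 0
        · rw [h0]; simp
        · exfalso; apply h; rw [<- h2]
          ext j; by_cases hj : i = j
          · subst hj; simp; omega
          · simp [Finsupp.single_apply, hj]
      · rfl
  | add p q hp hq => rw [map_add, mul_add, coeff_add, hp, hq, coeff_add]; ring
lemma const_of_pderiv {m : NN} (D n : MvPolynomial (Fin m) QQ) (hD : D ≠ 0)
    (h : ∀ i, D * pderiv i n = n * pderiv i D) : ∃ c : QQ, n = C c * D := by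
  classical
  let mo : MonomialOrder (Fin m) := MonomialOrder.lex
  set I0 := mo.degree D with hI0
  have hl : coeff I0 D ≠ 0 := by
    have := MonomialOrder.leadingCoeff_ne_zero_iff (m := mo) |>.2 hD
    exact this
  refine ⟨coeff I0 n / coeff I0 D, ?_⟩
  set c := coeff I0 n / coeff I0 D
  by_contra hne
  set n' := n - C c * D with hn'
  have hn0 : n' ≠ 0 := sub_ne_zero.2 hne
  set I1 := mo.degree n' with hI1
  have hl1 : coeff I1 n' ≠ 0 := by
    have := MonomialOrder.leadingCoeff_ne_zero_iff (m := mo) |>.2 hn0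
    exact this
  have h0 : coeff I0 n' = 0 := by
    rw [hn', coeff_sub, coeff_C_mul, div_mul_cancel₀ _ hl, sub_self]
  have hdeg : ∀ (i : Fin m) (P : MvPolynomial (Fin m) QQ), mo.degree (X i * pderiv i P) ≼[mo] mo.degree P := by
    intro i P
    rw [MonomialOrder.degree_le_iff]
    intro I hI
    apply MonomialOrder.le_degree
    rw [mem_support_iff] at hI ⊢
    rw [coeff_X_mul_pderiv] at hI
    exact right_ne_zero_of_mul hI
  have key : ∀ i, I1 i = I0 i := by
    intro i
    have e : D * (X i * pderiv i n') = (X i * pderiv i D) * n' := by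
      rw [hn', map_sub, Derivation.leibniz, pderiv_C]
      simp only [zee, mul_zero, add_zero]
      linear_combination X i * h i
    have e2 := congrArg (coeff (I0 + I1)) e
    rw [MonomialOrder.coeff_mul_of_add_of_degree_le (m := mo) le_rfl (hdeg i n'),
      MonomialOrder.coeff_mul_of_add_of_degree_le (m := mo) (hdeg i D) le_rfl,
      coeff_X_mul_pderiv, coeff_X_mul_pderiv] at e2
    have : (I1 i : QQ) = I0 i := by
      have hh : coeff I0 D * coeff I1 n' ≠ 0 := mul_ne_zero hl hl1
      apply mul_left_cancel₀ hh
      linear_combination e2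
    exact_mod_cast this
  have : I1 = I0 := Finsupp.ext key
  rw [this] at hl1
  exact hl1 h0
lemma wronskian {m : NN} (l : NN) : ∀ f : Fin l -> MvPolynomial (Fin m) QQ, LinearIndependent QQ f →
    ∃ Δ : Fin l -> (Fin m →₀ NN), (∀ a, (Δ a).degree <= a) ∧
      (Matrix.of fun a b => hs (Δ a) (f b)).det ≠ 0 := by
  classical
  induction l with
  | zero => intro f _; exact ⟨fun a => a.elim0, fun a => a.elim0, by simp⟩
  | succ l ih =>
    intro f hf
    obtain ⟨Δ, hΔ, hdet⟩ := ih (fun b => f b.castSucc) (hf.comp _ (Fin.castSucc_injective l))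
    by_contra hcon
    push Not at hcon
    set M : Matrix (Fin l) (Fin l) (MvPolynomial (Fin m) QQ) :=
      Matrix.of fun a b => hs (Δ a) (f b.castSucc) with hM
    set Nn : Fin (l+1) -> MvPolynomial (Fin m) QQ := fun b =>
      (-1) ^ (l + (b : NN)) * (Matrix.of fun (a c : Fin l) => hs (Δ a) (f (b.succAbove c))).det with hNn
    have hlast : Nn (Fin.last l) = M.det := by
      simp only [hNn, hM, Fin.val_last, <- two_mul, pow_mul]
      simp
    have hsum : ∀ Δ' : Fin m →₀ NN, Δ'.degree <= l -> ∑ b, Nn b * hs Δ' (f b) = 0 := by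
      intro Δ' hd
      have h1 := hcon (Fin.snoc Δ Δ') (by
        intro a
        induction a using Fin.lastCases with
        | last => simpa using hd
        | cast a => simpa using hΔ a)
      rw [Matrix.det_succ_row _ (Fin.last l)] at h1
      rw [<- h1]
      refine zah rfl fun b _ => ?_
      simp only [hNn, Fin.val_last, Matrix.of_apply, Fin.snoc_last]
      rw [mul_assoc, mul_assoc, mul_comm (Matrix.det _)]
      congr 3
      ext1 a c
      simp [Matrix.submatrix_apply, Fin.succAbove_last]
    have hder : ∀ i, ∀ Δ' : Fin m →₀ NN, Δ'.degree + 1 <= l -> ∑ b, pderiv i (Nn b) * hs Δ' (f b) = 0 := by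
      intro i Δ' hd
      have h1 := congrArg (pderiv i) (hsum Δ' Wg)
      rw [map_sum, map_zero] at h1
      have h2 := hsum (Δ' + Finsupp.single i 1) (by simpa using hd)
      have : ∀ b, pderiv i (Nn b * hs Δ' (f b)) = pderiv i (Nn b) * hs Δ' (f b) +
          ((Δ' i + 1 : NN) : QQ) • (Nn b * hs (Δ' + Finsupp.single i 1) (f b)) := by
        intro b
        rw [Derivation.leibniz, pderiv_hs]
        simp only [zee, mul_smul_comm]
        ring
      simp only [this, zde, <- Finset.smul_sum, h2, smul_zero, add_zero] at h1
      exact h1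
    have hconst : ∀ b, ∃ c : QQ, Nn b = C c * M.det := by
      intro b
      induction b using Fin.lastCases with
      | last => exact ⟨1, by rw [hlast]; simp⟩
      | cast b =>
        apply const_of_pderiv _ _ hdet
        intro i
        have hz : M.mulVec (fun b => M.det * pderiv i (Nn b.castSucc) - Nn b.castSucc * pderiv i M.det) = 0 := by
          ext1 a
          have e1 := hder i (Δ a) (by have := hΔ a; have := a.2; omega)
          have e2 := hsum (Δ a) (by have := hΔ a; have := a.2; omega)
          rw [Fin.sum_univ_castSucc, hlast] at e1 e2
          simp only [Matrix.mulVec, dotProduct, hM, Matrix.of_apply, Pi.zero_apply, mul_sub,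
            Finset.sum_sub_distrib]
          simp only [<- hM]
          have r1 : ∑ x : Fin l, hs (Δ a) (f x.castSucc) * (M.det * pderiv i (Nn x.castSucc))
            = M.det * ∑ x : Fin l, pderiv i (Nn x.castSucc) * hs (Δ a) (f x.castSucc) := by
            rw [zbe]; refine zah rfl fun x _ => ?_; ring
          have r2 : ∑ x : Fin l, hs (Δ a) (f x.castSucc) * (Nn x.castSucc * pderiv i M.det)
            = pderiv i M.det * ∑ x : Fin l, Nn x.castSucc * hs (Δ a) (f x.castSucc) := by
            rw [zbe]; refine zah rfl fun x _ => ?_; ring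
          rw [r1, r2]
          linear_combination M.det * e1 - pderiv i M.det * e2
        have := congrFun (Matrix.eq_zero_of_mulVec_eq_zero hdet hz) b
        simpa [sub_eq_zero] using this
    choose c hc using hconst
    have hcl : c (Fin.last l) = 1 := by
      have h1 := hc (Fin.last l)
      rw [hlast] at h1
      have h2 : (C (c (Fin.last l)) - 1) * M.det = 0 := by linear_combination -h1
      rcases mul_eq_zero.1 h2 with h3 | h3
      · exact C_injective (Fin m) QQ (by rw [C_1]; exact sub_eq_zero.1 h3)
      · exact absurd h3 hdet
    have h0 := hsum 0 (by simp)
    have hs0 : ∀ P : MvPolynomial (Fin m) QQ, hs 0 P = P := by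
      intro P; ext I; rw [coeff_hs]; simp
    simp only [hc, hs0] at h0
    have h1 : M.det * ∑ b, c b • f b = 0 := by
      rw [zbe, <- h0]
      refine zah rfl fun b _ => ?_
      rw [smul_eq_C_mul]; ring
    have h2 := (mul_eq_zero.1 h1).resolve_left hdet
    have := Fintype.linearIndependent_iff.1 hf c h2 (Fin.last l)
    rw [hcl] at this
    exact one_ne_zero this
end PartM3
section PartM4
open MvPolynomial
noncomputable def wt {m : NN} (d : Fin m -> NN) (J : Fin m →₀ NN) : RR := ∑ i, (J i : RR) / d i
lemma wt_add {m : NN} (d : Fin m -> NN) (J K : Fin m →₀ NN) : wt d (J + K) = wt d J + wt d K := by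
  simp [wt, add_div, zde]
lemma wt_nonneg {m : NN} (d : Fin m -> NN) (J : Fin m →₀ NN) : 0 <= wt d J :=
  Finset.sum_nonneg fun _ _ => by positivity
def IndGe {m : NN} (d : Fin m -> NN) (z : Fin m -> QQ) (P : MvPolynomial (Fin m) QQ) (θ : RR) : Prop :=
  ∀ J, wt d J < θ -> eval z (hs J P) = 0
lemma IndGe.mono {m : NN} {d : Fin m -> NN} {z : Fin m -> QQ} {P : MvPolynomial (Fin m) QQ} {θ θ' : RR}
    (h : IndGe d z P θ) (hl : θ' <= θ) : IndGe d z P θ' := fun J hJ => h J (hJ.trans_le hl)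
lemma IndGe.zero {m : NN} {d : Fin m -> NN} {z : Fin m -> QQ} (P : MvPolynomial (Fin m) QQ) :
    IndGe d z P 0 := fun J hJ => absurd hJ (not_lt.2 (wt_nonneg d J))
lemma IndGe.mul {m : NN} {d : Fin m -> NN} {z : Fin m -> QQ} {P Q : MvPolynomial (Fin m) QQ} {θ θ' : RR}
    (h : IndGe d z P θ) (h' : IndGe d z Q θ') : IndGe d z (P * Q) (θ + θ') := by
  intro J hJ
  rw [hs_mul, map_sum]
  refine Finset.sum_eq_zero fun x hx => ?_
  have hx' := Finset.HasAntidiagonal.mem_antidiagonal.1 hx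
  rw [<- hx', wt_add] at hJ
  rw [map_mul]
  rcases lt_or_ge (wt d x.1) θ with h1 | h1
  · rw [h _ h1, zero_mul]
  · rw [h' _ Wk, mul_zero]
lemma IndGe.prod {m : NN} {ι : Type} {d : Fin m -> NN} {z : Fin m -> QQ} (s : Finset ι)
    (P : ι -> MvPolynomial (Fin m) QQ) (θ : ι -> RR)
    (h : ∀ i ∈ s, IndGe d z (P i) (θ i)) : IndGe d z (∏ i ∈ s, P i) (∑ i ∈ s, θ i) := by
  classical
  induction s using Finset.induction_on with
  | empty => simpa using IndGe.zero 1
  | insert a s ha ih =>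
    rw [Finset.prod_insert ha, Finset.sum_insert ha]
    exact (h a (Finset.mem_insert_self _ _)).mul (ih fun i hi => h i (Finset.mem_insert_of_mem hi))
lemma IndGe.sum {m : NN} {ι : Type} {d : Fin m -> NN} {z : Fin m -> QQ} (s : Finset ι)
    (P : ι -> MvPolynomial (Fin m) QQ) (θ : RR)
    (h : ∀ i ∈ s, IndGe d z (P i) θ) : IndGe d z (∑ i ∈ s, P i) θ := by
  intro J hJ
  rw [hs_sum, map_sum]
  exact Finset.sum_eq_zero fun i hi => h i hi J hJ
lemma IndGe.usmul {m : NN} {d : Fin m -> NN} {z : Fin m -> QQ} (e : ZZ ˣ)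
    {P : MvPolynomial (Fin m) QQ} {θ : RR} (h : IndGe d z P θ) : IndGe d z (e • P) θ := by
  intro J hJ
  rcases Int.units_eq_one_or e with rfl | rfl
  · rw [one_smul]; exact h J hJ
  · rw [Units.neg_smul, one_smul, show hs J (-P) = - hs J P from map_neg (hsL J) P, map_neg, h J hJ,
      neg_zero]
lemma IndGe.hs {m : NN} {d : Fin m -> NN} {z : Fin m -> QQ}
    {P : MvPolynomial (Fin m) QQ} {θ : RR} (h : IndGe d z P θ) (K : Fin m →₀ NN) :
    IndGe d z (_root_.hs K P) (θ - wt d K) := by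
  intro J hJ
  rw [hs_hs, smul_eval, h _ (by rw [wt_add]; linarith), mul_zero]
lemma IndGe.det {m l : NN} {d : Fin m -> NN} {z : Fin m -> QQ}
    (M : Matrix (Fin l) (Fin l) (MvPolynomial (Fin m) QQ)) (θ : Fin l -> RR)
    (h : ∀ a b, IndGe d z (M a b) (θ b)) : IndGe d z M.det (∑ b, θ b) := by
  rw [Matrix.det_apply]
  refine IndGe.sum _ _ _ fun s _ => IndGe.usmul _ ?_
  exact IndGe.prod _ _ _ fun i _ => h _ _
/-- integer coefficients -/
def IsI {σ : Type} (P : MvPolynomial σ QQ) : Prop := ∀ I, ∃ a : ZZ, coeff I P = a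
lemma isI_map {σ : Type} (P : MvPolynomial σ ZZ) : IsI (map Wx P) := by
  intro I; exact ⟨coeff I P, by rw [coeff_map]; rfl⟩
lemma IsI.lift {σ : Type} {P : MvPolynomial σ QQ} (h : IsI P) : ∃ Q : MvPolynomial σ ZZ,
    map Wx Q = P := by
  choose a ha using h
  refine ⟨∑ I ∈ P.support, monomial I (a I), ?_⟩
  rw [map_sum]
  conv_rhs => rw [P.as_sum]
  refine zah rfl fun I _ => ?_
  rw [map_monomial, ha]; rfl
lemma IsI.hs {σ : Type} [Fintype σ] [DecidableEq σ] {P : MvPolynomial σ QQ} (h : IsI P) (J : σ →₀ NN) :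
    IsI (_root_.hs J P) := by
  obtain ⟨Q, rfl⟩ := h.lift
  rw [hs_map]; exact isI_map _
lemma IsI.det {σ : Type} {l : NN} (M : Matrix (Fin l) (Fin l) (MvPolynomial σ QQ))
    (h : ∀ a b, IsI (M a b)) : IsI M.det := by
  choose N hN using fun a b => (h a b).lift
  have : M = (map Wx).mapMatrix (Matrix.of N) := by
    ext1 a b; simp [hN]
  rw [this, <- RingHom.map_det]
  exact isI_map _
/-- one variable: Gauss -/
lemma gauss_one (f : Polynomial ZZ) (hf : f ≠ 0) (z : QQ) :
    ∃ j : NN, ((z.den : RR) ^ j <= |(f.leadingCoeff : RR)|) ∧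
      (Polynomial.hasseDeriv j (f.map Wx)).eval z ≠ 0 := by
  set g := f.map Wx with hg
  have hinj : Function.Injective Wx := Int.cast_injective
  have hg0 : g ≠ 0 := (Polynomial.map_ne_zero_iff hinj).2 hf
  set j := g.rootMultiplicity z
  refine ⟨j, ?_, ?_⟩
  · set q : Polynomial ZZ := Polynomial.C (z.den : ZZ) * Polynomial.X + Polynomial.C (-z.num) with hq
    have hden : (z.den : ZZ) ≠ 0 := by exact_mod_cast z.den_nz
    have hprim : q.IsPrimitive := by
      rw [Polynomial.isPrimitive_iff_isUnit_of_C_dvd]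
      intro r hr
      rw [Polynomial.C_dvd_iff_dvd_coeff] at hr
      have h0 := hr 0
      have h1 := hr 1
      rw [hq] at h0 h1
      simp only [Polynomial.coeff_add, Polynomial.coeff_C_mul, Polynomial.coeff_X_zero, mul_zero, zero_add,
        Polynomial.coeff_C_zero, dvd_neg, Polynomial.coeff_X_one, mul_one, Polynomial.coeff_C_succ,
        add_zero, Polynomial.coeff_C_ne_zero one_ne_zero] at h0 h1
      have hc : IsCoprime z.num (z.den : ZZ) := Rat.isCoprime_num_den z
      exact hc.isUnit_of_dvd' h0 h1
    have hlq : q.leadingCoeff = z.den := Polynomial.leadingCoeff_linear hden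
    have hprimj : (q ^ j).IsPrimitive := by
      clear_value j
      induction j with
      | zero => rw [pow_zero]; exact Polynomial.isPrimitive_one
      | succ j ih => rw [pow_succ]; exact Polynomial.IsPrimitive.mul ih hprim
    have hqmap : q.map Wx = Polynomial.C (z.den : QQ) * (Polynomial.X - Polynomial.C z) := by
      have : (z.den : QQ) * z = z.num := Rat.den_mul_eq_num z
      rw [mul_sub, <- Polynomial.C_mul, this]
      simp [hq, sub_eq_add_neg]
    have hdvd : (q ^ j).map Wx ∣ g := by
      rw [Polynomial.map_pow, hqmap, mul_pow, <- Polynomial.C_pow]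
      have hu : IsUnit (Polynomial.C ((z.den : QQ) ^ j)) := by
        rw [Polynomial.isUnit_C]; exact (pow_ne_zero _ (by exact_mod_cast z.den_nz)).isUnit
      rw [hu.mul_left_dvd]
      exact Polynomial.pow_rootMultiplicity_dvd g z
    obtain ⟨w, hw⟩ := (Polynomial.IsPrimitive.Int.dvd_iff_map_cast_dvd_map_cast _ _ hprimj).2 hdvd
    have hl : f.leadingCoeff = (z.den : ZZ) ^ j * w.leadingCoeff := by
      rw [hw, Polynomial.leadingCoeff_mul, Polynomial.leadingCoeff_pow, hlq]
    have hw0 : w.leadingCoeff ≠ 0 := by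
      intro h0; rw [h0, mul_zero] at hl; exact hf (Polynomial.leadingCoeff_eq_zero.1 hl)
    have h1 : (1 : RR) <= |(w.leadingCoeff : RR)| := by exact_mod_cast Int.one_le_abs hw0
    rw [hl]; push_cast; rw [abs_mul, zbc (by positivity : Yh <= (z.den : RR) ^ j)]
    exact le_mul_of_one_le_right Ye h1
  · rw [<- Polynomial.taylor_coeff]
    intro h
    have h2 : (Polynomial.X : Polynomial QQ) ^ (j+1) ∣ Polynomial.taylor z g := by
      rw [Polynomial.X_pow_dvd_iff]
      intro i hi
      rcases Nat.lt_succ_iff_lt_or_eq.1 hi with h3 | h3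
      · have hd : (Polynomial.X - Polynomial.C z) ^ j ∣ g := Polynomial.pow_rootMultiplicity_dvd g z
        obtain ⟨w, hw⟩ := hd
        have : Polynomial.X ^ j ∣ Polynomial.taylor z g := by
          rw [hw, Polynomial.taylor_mul, Polynomial.taylor_pow]
          simp
        exact Polynomial.X_pow_dvd_iff.1 this i h3
      · rw [h3]; exact h
    obtain ⟨w, hw⟩ := h2
    have h3 : (Polynomial.X - Polynomial.C z) ^ (j+1) ∣ g := by
      refine ⟨Polynomial.taylor (-z) w, ?_⟩
      have h4 := congrArg (Polynomial.taylor (-z)) hw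
      rw [Polynomial.taylor_taylor, Polynomial.taylor_mul, Polynomial.taylor_pow] at h4
      simpa [sub_eq_add_neg] using h4
    have := (Polynomial.le_rootMultiplicity_iff hg0).2 h3
    omega
end PartM4
section PartM5
open MvPolynomial
noncomputable def eA (m : NN) : MvPolynomial (Fin m) QQ →+* MvPolynomial (Fin (m+1)) QQ :=
  ((finSuccEquiv QQ m).symm : Polynomial (MvPolynomial (Fin m) QQ) →+* _).comp Polynomial.C
noncomputable def eB (m : NN) : Polynomial QQ →+* MvPolynomial (Fin (m+1)) QQ :=
  ((finSuccEquiv QQ m).symm : Polynomial (MvPolynomial (Fin m) QQ) →+* _).comp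
    (Polynomial.mapRingHom (C : QQ →+* MvPolynomial (Fin m) QQ))
lemma fse_AB {m : NN} (F : MvPolynomial (Fin m) QQ) (G : Polynomial QQ) :
    finSuccEquiv QQ m (eA m F * eB m G) = Polynomial.C F * G.map C := by
  rw [map_mul]; simp [eA, eB]
lemma coeff_AB {m : NN} (F : MvPolynomial (Fin m) QQ) (G : Polynomial QQ) (K : Fin (m+1) →₀ NN) :
    coeff K (eA m F * eB m G) = coeff K.tail F * G.coeff (K 0) := by
  conv_lhs => rw [<- Finsupp.cons_tail K]
  rw [<- finSuccEquiv_coeff_coeff, fse_AB, Polynomial.coeff_C_mul, Polynomial.coeff_map, mul_comm,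
    coeff_C_mul, mul_comm]
lemma hs_AB {m : NN} (F : MvPolynomial (Fin m) QQ) (G : Polynomial QQ) (K : Fin (m+1) →₀ NN) :
    hs K (eA m F * eB m G) = eA m (hs K.tail F) * eB m (Polynomial.hasseDeriv (K 0) G) := by
  ext I
  rw [coeff_hs, coeff_AB, coeff_AB, coeff_hs, Polynomial.hasseDeriv_coeff, Fin.prod_univ_succ]
  have : (I + K).tail = I.tail + K.tail := by ext i; simp [Finsupp.tail_apply]
  rw [this]
  simp only [Finsupp.tail_apply, Finsupp.coe_add, Pi.add_apply]
  push_cast; ring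
lemma eval_AB {m : NN} (F : MvPolynomial (Fin m) QQ) (G : Polynomial QQ) (z : Fin (m+1) -> QQ) :
    eval z (eA m F * eB m G) = eval (fun i => z i.succ) F * G.eval (z 0) := by
  have : z = Fin.cons (z 0) (fun i : Fin m => z i.succ) := by
    ext i; refine Fin.cases ?_ (fun i => ?_) i <;> simp
  conv_lhs => rw [this]
  rw [eval_eq_eval_mv_eval', fse_AB, Polynomial.map_mul, Polynomial.map_C, Polynomial.map_map,
    Polynomial.eval_mul, Polynomial.eval_C]
  congr 2
  have : (eval fun i : Fin m => z i.succ).comp C = RingHom.id QQ := by ext; simp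
  rw [this, Polynomial.map_id]
lemma wronskian_poly (l : NN) (G : Fin l -> Polynomial QQ) (hG : LinearIndependent QQ G) :
    ∃ β : Fin l -> NN, (∀ a, β a <= a) ∧
      (Matrix.of fun a b => Polynomial.hasseDeriv (β a) (G b)).det ≠ 0 := by
  have hc : ∀ (c : QQ) (g : Polynomial QQ), eB 0 (c • g) = c • eB 0 g := by
    intro c g
    rw [Polynomial.smul_eq_C_mul, map_mul, smul_eq_C_mul]
    congr 1
    simp only [eB, RingHom.comp_apply, Polynomial.coe_mapRingHom, Polynomial.map_C]
    exact (RingHom.congr_fun (finSuccEquiv_comp_C_eq_C (R := QQ) 0) c)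
  let B : Polynomial QQ →ₗ[QQ] MvPolynomial (Fin 1) QQ :=
    { toFun := eB 0, map_add' := map_add _, map_smul' := hc }
  have hinj : Function.Injective (eB 0) := by
    intro a b hab
    ext j
    have h := congrArg (coeff (Finsupp.cons j (0 : Fin 0 →₀ NN))) hab
    have e : ∀ g, eB 0 g = eA 0 1 * eB 0 g := by intro g; rw [map_one, one_mul]
    rw [e a, e b, coeff_AB, coeff_AB, Finsupp.tail_cons] at h
    simpa using h
  have hB : LinearIndependent QQ (fun s => eB 0 (G s)) :=
    hG.map' B (LinearMap.ker_eq_bot.2 hinj)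
  obtain ⟨Δ, h1, h2⟩ := wronskian l _ hB
  refine ⟨fun a => Δ a 0, fun a => (Finsupp.le_degree 0 (Δ a)).trans (h1 a), ?_⟩
  intro h0
  apply h2
  have : (Matrix.of fun a b => hs (Δ a) (eB 0 (G b))) =
      (eB 0).mapMatrix (Matrix.of fun a b => Polynomial.hasseDeriv (Δ a 0) (G b)) := by
    ext1 a b
    have e : eB 0 (G b) = eA 0 1 * eB 0 (G b) := by rw [map_one, one_mul]
    rw [Matrix.of_apply, e, hs_AB]
    have e2 : hs (Δ a).tail (1 : MvPolynomial (Fin 0) QQ) = 1 := by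
      have : (Δ a).tail = 0 := by ext i; exact i.elim0
      rw [this]; ext I; rw [coeff_hs]; simp
    rw [e2, map_one, one_mul]; rfl
  rw [this, <- RingHom.map_det, h0, map_zero]
lemma min_indep {M N K : Type} [AddCommGroup M] [AddCommGroup N] [AddCommGroup K] [Module QQ M]
    [Module QQ N] [Module QQ K] (B : M →ₗ[QQ] N →ₗ[QQ] K) (x : K) (l : NN)
    (hmin : ∀ l' < l, ¬ ∃ (F : Fin l' -> M) (G : Fin l' -> N), x = ∑ s, B (F s) (G s))
    (F : Fin l -> M) (G : Fin l -> N) (hx : x = ∑ s, B (F s) (G s)) : LinearIndependent QQ F := by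
  rw [Fintype.linearIndependent_iff]
  intro c hc
  by_contra hne
  push Not at hne
  obtain ⟨s0, hs0⟩ := hne
  obtain ⟨l, rfl⟩ : ∃ n, l = n + 1 := ⟨l - 1, by have := s0.2; omega⟩
  apply hmin l Wg
  refine ⟨fun t => F (s0.succAbove t), fun t => G (s0.succAbove t) -
    (c (s0.succAbove t) / c s0) • G s0, ?_⟩
  rw [hx, Fin.sum_univ_succAbove _ s0]
  rw [Fin.sum_univ_succAbove _ s0] at hc
  have hF : F s0 = - ∑ t, (c (s0.succAbove t) / c s0) • F (s0.succAbove t) := by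
    have h1 : c s0 • F s0 = - ∑ t, c (s0.succAbove t) • F (s0.succAbove t) := eq_neg_of_add_eq_zero_left hc
    have h2 : F s0 = (c s0)⁻¹ • (c s0 • F s0) := by rw [smul_smul, inv_mul_cancel₀ hs0, one_smul]
    rw [h2, h1, smul_neg, Finset.smul_sum]
    congr 1
    refine zah rfl fun t _ => ?_
    rw [smul_smul, div_eq_inv_mul]
  conv_lhs => rw [hF]
  simp only [map_neg, map_sum, LinearMap.neg_apply, LinearMap.sum_apply, map_smul, LinearMap.smul_apply,
    map_sub, Finset.sum_sub_distrib]
  abel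
noncomputable def bAB (m : NN) : MvPolynomial (Fin m) QQ →ₗ[QQ] Polynomial QQ →ₗ[QQ] MvPolynomial (Fin (m+1)) QQ :=
  LinearMap.mk₂ QQ (fun F G => eA m F * eB m G)
    (by intros; rw [map_add, add_mul])
    (by intro c F G; ext K; rw [coeff_smul, coeff_AB, coeff_AB, coeff_smul, zee, zee, mul_assoc])
    (by intros; rw [map_add, mul_add])
    (by intro c F G; ext K; rw [coeff_smul, coeff_AB, coeff_AB, Polynomial.coeff_smul, zee, zee]; ring)
lemma decomp {m : NN} (P : MvPolynomial (Fin (m+1)) QQ) (n : NN) (hn : degreeOf 0 P <= n) :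
    ∃ l ≤ n + 1, ∃ (F : Fin l -> MvPolynomial (Fin m) QQ) (G : Fin l -> Polynomial QQ),
      LinearIndependent QQ F ∧ LinearIndependent QQ G ∧ P = ∑ s, eA m (F s) * eB m (G s) := by
  classical
  have hex0 : ∃ (F : Fin (n+1) -> MvPolynomial (Fin m) QQ) (G : Fin (n+1) -> Polynomial QQ),
      P = ∑ s, bAB m (F s) (G s) := by
    refine ⟨fun s => (finSuccEquiv QQ m P).coeff s, fun s => Polynomial.X ^ (s : NN), ?_⟩
    ext K
    rw [coeff_sum]
    simp only [bAB, LinearMap.mk₂_apply, coeff_AB, finSuccEquiv_coeff_coeff, Polynomial.coeff_X_pow]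
    by_cases hK : K 0 < n + 1
    · rw [Finset.sum_eq_single (⟨K 0, hK⟩ : Fin (n+1))]
      · simp [Finsupp.cons_tail]
      · intro b _ hb
        rw [if_neg, mul_zero]
        intro h; apply hb; ext; exact h.symm
      · simp
    · rw [Finset.sum_eq_zero]
      · by_contra h0
        have := monomial_le_degreeOf 0 (mem_support_iff.2 h0)
        omega
      · intro b _
        rw [if_neg, mul_zero]
        have := b.2; omega
  have hex : ∃ l, ∃ (F : Fin l -> MvPolynomial (Fin m) QQ) (G : Fin l -> Polynomial QQ),
      P = ∑ s, bAB m (F s) (G s) := ⟨n+1, hex0⟩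
  have hle : Nat.find hex <= n + 1 := Nat.find_min' hex hex0
  obtain ⟨F, G, h⟩ := Nat.find_spec hex
  refine ⟨_, hle, F, G, ?_, ?_, h⟩
  · exact min_indep (bAB m) P _ (fun l' hl' => Nat.find_min hex hl') F G h
  · refine min_indep (bAB m).flip P _ (fun l' hl' hc => ?_) G F (by simpa using h)
    obtain ⟨F', G', h'⟩ := hc
    exact Nat.find_min hex hl' ⟨G', F', by simpa using h'⟩
end PartM5
section PartM6
open MvPolynomial
lemma sum_max_ge (l d : NN) (hd : 1 <= d) (hl : l <= d + 1) (θ : RR) (h0 : 0 < θ) (h1 : θ <= 1) :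
    (l : RR) * (θ ^ 2 / 8) <= ∑ b : Fin l, max 0 (θ - (b : RR) / d) := by
  have hd0 : Wh < d := by exact_mod_cast hd
  rw [Fin.sum_univ_eq_sum_range (fun b : NN => max 0 (θ - (b : RR) / d)) l]
  set k := min l (⌊(d : RR) * θ / 2⌋₊ + 1) with hk
  have hsub : Finset.range k ⊆ Finset.range l := Finset.range_subset_range.2 (min_le_left _ _)
  have hk' : (l : RR) * θ / 4 <= k := by
    rw [hk]; push_cast
    refine le_min ?_ ?_
    · nlinarith [(Nat.cast_nonneg l : Yh <= l)]
    · have := (Nat.lt_floor_add_one ((d : RR) * θ / 2)).le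
      have h2 : (l : RR) <= 2 * d := by
        have : l <= 2 * d := by omega
        exact_mod_cast this
      nlinarith
  calc (l : RR) * (θ ^ 2 / 8) = (l * θ / 4) * (θ / 2) := by ring
    _ <= k * (θ / 2) := by gcongr
    _ = ∑ b ∈ Finset.range k, θ / 2 := by simp
    _ <= ∑ b ∈ Finset.range k, max 0 (θ - (b : RR) / d) := by
        refine zba fun b hb => le_max_of_le_right ?_
        have hb1 : b <= ⌊(d : RR) * θ / 2⌋₊ := by
          have := zbb.1 hb
          have := min_le_right l (⌊(d : RR) * θ / 2⌋₊ + 1)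
          omega
        have hb2 : (b : RR) <= (d : RR) * θ / 2 := (Nat.le_floor_iff Ye).1 hb1
        have : (b : RR) / d <= θ / 2 := by rw [zae hd0]; linarith
        linarith
    _ <= _ := zch hsub fun _ _ _ => le_max_left _ _
lemma degreeOf_det {σ : Type} {l : NN} (M : Matrix (Fin l) (Fin l) (MvPolynomial σ QQ)) (i : σ) (B : NN)
    (h : ∀ a b, degreeOf i (M a b) <= B) : degreeOf i M.det <= l * B := by
  classical
  rw [Matrix.det_apply]
  refine (degreeOf_sum_le i _ _).trans ?_
  refine Finset.sup_le fun s _ => ?_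
  have h1 : degreeOf i (Equiv.Perm.sign s • ∏ b, M (s b) b) = degreeOf i (∏ b, M (s b) b) := by
    rcases Int.units_eq_one_or (Equiv.Perm.sign s) with e | e <;> rw [e]
    · rw [one_smul]
    · rw [Units.neg_smul, one_smul, degreeOf_neg]
  rw [h1]
  refine (degreeOf_prod_le i _ _).trans ?_
  refine (zcd _ _ _ fun b _ => h _ _).trans ?_
  simp
/-- generic conclusions for W = U V -/
lemma factor_facts {m : NN} (U : MvPolynomial (Fin m) QQ) (V : Polynomial QQ) (hU : U ≠ 0) (hV : V ≠ 0)
    (W : MvPolynomial (Fin (m+1)) QQ) (hW : W = eA m U * eB m V) (hI : IsI W) :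
    (∃ c : QQ, c ≠ 0 ∧ IsI (c • U) ∧ n1 (c • U) <= n1 W ∧ ∀ i, degreeOf i U <= degreeOf i.succ W) ∧
    (∃ c : QQ, c ≠ 0 ∧ ∃ f : Polynomial ZZ, f ≠ 0 ∧ f.map Wx = c • V ∧
      |(f.leadingCoeff : RR)| <= n1 W) := by
  classical
  have hco : ∀ I j, coeff (Finsupp.cons j I) W = coeff I U * V.coeff j := by
    intro I j; rw [hW, coeff_AB, Finsupp.tail_cons, Finsupp.cons_zero]
  have hmem : ∀ K, |((coeff K W : QQ) : RR)| <= n1 W := by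
    intro K
    by_cases hK : K ∈ W.support
    · exact Finset.single_le_sum (f := fun K => |((coeff K W : QQ) : RR)|) (fun _ _ => abs_nonneg _) hK
    · rw [notMem_support_iff.1 hK]; simpa using n1_nonneg W
  constructor
  · have hc : V.leadingCoeff ≠ 0 := Polynomial.leadingCoeff_ne_zero.2 hV
    refine ⟨V.leadingCoeff, hc, ?_, ?_, ?_⟩
    · intro I
      obtain ⟨a, ha⟩ := hI (Finsupp.cons V.natDegree I)
      exact ⟨a, by rw [coeff_smul, zee, <- ha, hco]; rw [mul_comm]; rfl⟩
    · have hinj : Function.Injective (fun I : Fin m →₀ NN => (Finsupp.cons V.natDegree I : Fin (m+1) →₀ NN)) := by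
        intro I I' h; simpa using congrArg Finsupp.tail h
      have e : n1 (V.leadingCoeff • U) = ∑ K ∈ (V.leadingCoeff • U).support.image
          (fun I : Fin m →₀ NN => (Finsupp.cons V.natDegree I : Fin (m+1) →₀ NN)), |((coeff K W : QQ) : RR)| := by
        rw [Finset.sum_image (fun x _ y _ h => hinj h), n1]
        refine zah rfl fun I _ => ?_
        rw [hco, coeff_smul, zee, mul_comm]; rfl
      rw [e, n1]
      refine zch ?_ fun _ _ _ => abs_nonneg _
      intro K hK
      obtain ⟨I, hI', rfl⟩ := Finset.mem_image.1 hK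
      rw [mem_support_iff] at hI' ⊢
      rw [hco]
      rw [coeff_smul, zee, mul_comm] at hI'
      exact hI'
    · intro i
      rw [degreeOf_le_iff]
      intro I hI'
      have : (Finsupp.cons V.natDegree I : Fin (m+1) →₀ NN) ∈ W.support := by
        rw [mem_support_iff, hco]
        exact mul_ne_zero (mem_support_iff.1 hI') hc
      have := monomial_le_degreeOf i.succ this
      simpa using this
  · obtain ⟨I, hI0⟩ := ne_zero_iff.1 hU
    refine ⟨coeff I U, hI0, ?_⟩
    have hl : coeff I U • V ∈ Polynomial.lifts Wx := by
      rw [Polynomial.lifts_iff_coeff_lifts]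
      intro j
      obtain ⟨a, ha⟩ := hI (Finsupp.cons j I)
      exact ⟨a, by rw [Polynomial.coeff_smul, zee, <- hco, ha]; rfl⟩
    obtain ⟨f, hf⟩ := (Polynomial.mem_lifts _).1 hl
    have hf0 : f ≠ 0 := by
      rintro rfl
      rw [Polynomial.map_zero] at hf
      exact smul_ne_zero hI0 hV hf.symm
    refine ⟨f, hf0, hf, ?_⟩
    have h1 := congrArg (fun p => p.coeff f.natDegree) hf
    simp only [Polynomial.coeff_map, Polynomial.coeff_smul, zee] at h1
    rw [<- hco] at h1
    have h2 := hmem (Finsupp.cons f.natDegree I)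
    rw [<- h1] at h2
    have e : ((Int.castRingHom QQ (f.coeff f.natDegree) : QQ) : RR) = (f.leadingCoeff : RR) := by
      rw [Polynomial.leadingCoeff]; exact Rat.cast_intCast _
    rwa [e] at h2
theorem roth_lemma (m : NN) : ∀ ε : RR, 0 < ε -> ∃ ω : RR, 0 < ω ∧ ∀ (d : Fin m -> NN) (D : RR) (z : Fin m -> QQ)
    (P : MvPolynomial (Fin m) QQ), (∀ i, 1 <= d i) -> (∀ i j, i < j -> (d i : RR) <= ω * d j) →
    (∀ i, (d i : RR) <= ω * D) -> IsI P -> P ≠ 0 -> (∀ i, degreeOf i P <= d i) -> n1 P <= Real.exp (ω * D) →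
    (∀ i, Real.exp D <= ((z i).den : RR) ^ (d i)) -> ∃ J, wt d J < ε ∧ eval z (hs J P) ≠ 0 := by
  induction m with
  | zero =>
    intro ε hε
    refine ⟨1, one_pos, fun d D z P _ _ _ _ hP _ _ _ => ⟨0, by simpa [wt] using hε, ?_⟩⟩
    have h0 : hs 0 P = P := by ext I; rw [coeff_hs]; simp
    rw [h0]
    obtain ⟨c, hc⟩ := C_surjective (R := QQ) (Fin 0) P
    rw [<- hc] at hP ⊢
    rw [eval_C]; rintro rfl; simp at hP
  | succ m ih =>
    intro ε hε
    set θ := min ε 1 with hθ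
    have hθ0 : 0 < θ := lt_min hε one_pos
    have hθ1 : θ <= 1 := min_le_right _ _
    obtain ⟨ω', hω'0, hω'⟩ := ih (θ ^ 2 / 64) Ye
    set ω := min ω' (θ ^ 2 / 64) / Vi with hω
    have hm3 : Wh < m + 3 := by positivity
    have hmin0 : 0 < min ω' (θ ^ 2 / 64) := lt_min hω'0 Ye
    have hω0 : 0 < ω := div_pos hmin0 hm3
    have hωm : Vi * ω = min ω' (θ ^ 2 / 64) := by rw [hω]; field_simp
    have hω1 : Vi * ω <= ω' := hωm ▸ min_le_left _ _
    have hω2 : Vi * ω <= θ ^ 2 / 64 := hωm ▸ min_le_right _ _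
    have hωle : ω <= Vi * ω := by nlinarith [(Nat.cast_nonneg m : Yh <= m)]
    refine ⟨ω, hω0, ?_⟩
    intro d D z P hd hdd hdD hI hP hdeg hn1 hden
    by_contra hcon
    push Not at hcon
    have hInd : IndGe d z P θ := fun J hJ => hcon J (hJ.trans_le (min_le_left _ _))
    obtain ⟨l, hl, F, G, hF, hG, hPs⟩ := decomp P (d 0) (hdeg 0)
    obtain ⟨Δ, hΔ, hUdet⟩ := wronskian l F hF
    obtain ⟨β, hβ, hVdet⟩ := wronskian_poly l G hG
    set MU := (Matrix.of fun a b => hs (Δ a) (F b)) with hMU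
    set MV := (Matrix.of fun a b => Polynomial.hasseDeriv (β a) (G b)) with hMV
    set MW : Matrix (Fin l) (Fin l) (MvPolynomial (Fin (m+1)) QQ) :=
      Matrix.of fun a b => hs (Finsupp.cons (β b) (Δ a)) P with hMW
    have hprod : MW = (eA m).mapMatrix MU * ((eB m).mapMatrix MV).transpose := by
      ext1 a b
      rw [Matrix.mul_apply, hMW, Matrix.of_apply]
      conv_lhs => rw [hPs, hs_sum]
      refine zah rfl fun s _ => ?_
      rw [hs_AB, Finsupp.tail_cons, Finsupp.cons_zero]
      simp [hMU, hMV]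
    have hWdet : MW.det = eA m MU.det * eB m MV.det := by
      rw [hprod, Matrix.det_mul, Matrix.det_transpose, <- RingHom.map_det, <- RingHom.map_det]
    have hl0 : 0 < l := by
      rcases Nat.eq_zero_or_pos l with h | h
      · subst h; simp at hPs; exact absurd hPs hP
      · exact h
    have hlR : Wh < l := by exact_mod_cast hl0
    have hd0 : Wh < d 0 := by exact_mod_cast hd 0
    have hD0 : 0 < D := by
      have := hdD 0
      by_contra h; push Not at h
      nlinarith
    have hindW : IndGe d z MW.det (l * (θ ^ 2 / 32)) := by
      have h1 : IndGe d z MW.det (∑ b : Fin l, max 0 ((θ - ω) - (b : RR) / d 0)) := by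
        refine IndGe.det _ _ fun a b => ?_
        have h2 := hInd.hs (Finsupp.cons (β b) (Δ a))
        have hw : wt d (Finsupp.cons (β b) (Δ a)) <= (b : RR) / d 0 + ω := by
          rw [wt, Fin.sum_univ_succ]
          refine zec ?_ ?_
          · rw [Finsupp.cons_zero]
            have : (β b : RR) <= (b : NN) := by exact_mod_cast hβ b
            gcongr
          · have h3 : ∀ i : Fin m, (((Finsupp.cons (β b) (Δ a) : Fin (m+1) →₀ NN) i.succ : NN) : RR) / d i.succ
                <= (Δ a i : RR) * (ω / d 0) := by
              intro i
              rw [Finsupp.cons_succ]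
              have hdi : Wh < d i.succ := by exact_mod_cast hd i.succ
              rw [div_eq_mul_inv]
              refine zaa ?_ (Nat.cast_nonneg _)
              rw [inv_le_iff_one_le_mul₀ hdi, div_mul_eq_mul_div, le_div_iff₀ hd0]
              linarith [hdd 0 i.succ (Fin.succ_pos i)]
            refine (zba fun i _ => h3 i).trans ?_
            rw [<- Finset.sum_mul]
            have h4 : (∑ i, (Δ a i : RR)) <= d 0 := by
              have e : ∑ i, Δ a i = (Δ a).degree := (Finsupp.degree_eq_sum _).symm
              have h5 : ∑ i, Δ a i <= d 0 := by rw [e]; have := hΔ a; have := a.2; omega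
              exact_mod_cast h5
            calc _ <= (d 0 : RR) * (ω / d 0) := by gcongr
              _ = ω := by field_simp
        rcases le_total 0 ((θ - ω) - (b : RR) / d 0) with h | h
        · rw [max_eq_right h]; exact h2.mono Wk
        · rw [max_eq_left h]; exact IndGe.zero _
      have hθω : θ / 2 <= θ - ω := by nlinarith
      refine h1.mono (le_trans ?_ (sum_max_ge l (d 0) (hd 0) hl (θ - ω) Wk Wk))
      refine zaa ?_ hlR.le
      have := pow_le_pow_left₀ Wk hθω 2
      nlinarith
    have hIW : IsI MW.det := IsI.det _ fun a b => hI.hs _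
    have hn1W : n1 MW.det <= Real.exp (l * (Vi * ω * D)) := by
      have h1 := n1_det_le MW (2 ^ Ys * n1 P) (fun a b => n1_hs_le _ P d hdeg)
      have hle2 : (2 : RR) <= Real.exp 1 := by linarith [Real.add_one_le_exp Yr]
      have hfac : (l.factorial : RR) <= (Real.exp (ω * D)) ^ l := by
        have h2 : (l.factorial : RR) <= (l : RR) ^ l := by exact_mod_cast Nat.factorial_le_pow l
        have h3 : (l : RR) <= Real.exp (ω * D) := by
          have h4 : (l : RR) <= d 0 + 1 := by exact_mod_cast hl
          have h5 := Real.add_one_le_exp (d 0 : RR)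
          have h6 : Real.exp (d 0 : RR) <= Real.exp (ω * D) := Real.exp_le_exp.2 (hdD 0)
          linarith
        exact h2.trans (by gcongr)
      have h2p : (2 : RR) ^ Ys <= Real.exp ((m + 1) * (ω * D)) := by
        calc (2 : RR) ^ Ys <= (Real.exp 1) ^ Ys := by gcongr
          _ = Real.exp (∑ i, (d i : RR)) := by rw [<- zca]; simp
          _ <= _ := by
            apply Real.exp_le_exp.2
            refine (zcd _ _ _ fun i _ => hdD i).trans ?_
            simp
      calc n1 MW.det <= l.factorial * (2 ^ Ys * n1 P) ^ l := h1
        _ <= (Real.exp (ω * D)) ^ l * (Real.exp ((m + 1) * (ω * D)) * Real.exp (ω * D)) ^ l := by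
            have := n1_nonneg P
            gcongr
        _ = Real.exp (l * (Vi * ω * D)) := by
            rw [<- mul_pow, <- Real.exp_add, <- Real.exp_add, <- zca]; congr 1; ring
    obtain ⟨⟨c, hc, hcI, hcn, hcd⟩, ⟨c', hc', f, hf0, hfV, hfl⟩⟩ :=
      factor_facts MU.det MV.det hUdet hVdet MW.det hWdet hIW
    obtain ⟨J', hJ'1, hJ'2⟩ := hω' (fun i => l * d i.succ) (l * D) (fun i => z i.succ) (c • MU.det)
      (fun i => Nat.mul_pos hl0 (hd _))
      (fun i j hij => by
        push_cast
        have h1 := hdd i.succ j.succ (Fin.succ_lt_succ_iff.2 hij)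
        have h2 : Wh <= d j.succ := Nat.cast_nonneg _
        nlinarith [zab (hωle.trans hω1) h2])
      (fun i => by
        push_cast
        have h1 := hdD i.succ
        nlinarith [zab (hωle.trans hω1) hD0.le])
      hcI (smul_ne_zero hc hUdet)
      (fun i => by
        have h1 : degreeOf i (c • MU.det) <= degreeOf i MU.det := by
          rw [smul_eq_C_mul]; exact degreeOf_C_mul_le _ _ _
        refine h1.trans ((hcd i).trans ?_)
        exact degreeOf_det _ _ _ fun a b => (degreeOf_hs _ _ _).trans (hdeg _))
      (hcn.trans (hn1W.trans (Real.exp_le_exp.2 (by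
        have : Vi * ω * D <= ω' * D := by gcongr
        nlinarith))))
      (fun i => by
        rw [pow_mul', zca]
        gcongr
        exact hden i.succ)
    obtain ⟨j, hj1, hj2⟩ := gauss_one f hf0 (z 0)
    have hjle : (j : RR) <= l * (Vi * ω) * d 0 := by
      have h1 : ((z 0).den : RR) ^ j <= Real.exp (l * (Vi * ω * D)) := hj1.trans (hfl.trans hn1W)
      have hq0 : Wh < (z 0).den := by exact_mod_cast (z 0).den_pos
      have h2 := Real.log_le_log Ye h1
      have h3 := Real.log_le_log (Real.exp_pos _) (hden 0)
      rw [Real.log_exp, Real.log_pow] at h2 h3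
      have hlog : 0 < Real.log ((z 0).den : RR) := by
        by_contra h; push Not at h; nlinarith
      have h4 : (j : RR) * Real.log ((z 0).den : RR) <= (l * (Vi * ω) * d 0) * Real.log ((z 0).den : RR) := by
        calc _ <= _ := h2
          _ = (l * (Vi * ω)) * D := by ring
          _ <= (l * (Vi * ω)) * (d 0 * Real.log ((z 0).den : RR)) := by gcongr
          _ = _ := by ring
      exact le_of_mul_le_mul_right h4 hlog
    have hz := hindW (Finsupp.cons j J') (by
      rw [wt, Fin.sum_univ_succ, Finsupp.cons_zero]
      simp only [Finsupp.cons_succ]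
      have h1 : ∑ i : Fin m, (J' i : RR) / d i.succ = l * wt (fun i => l * d i.succ) J' := by
        rw [wt, zbe]
        refine zah rfl fun i _ => ?_
        push_cast
        have hdi : Wh < d i.succ := by exact_mod_cast hd i.succ
        field_simp
      rw [h1]
      have h2 : (j : RR) / d 0 <= l * (Vi * ω) := by rw [zae hd0]; exact hjle
      have h3 : l * wt (fun i => l * d i.succ) J' < l * (θ ^ 2 / 64) := by gcongr
      have h4 : l * (Vi * ω) <= l * (θ ^ 2 / 64) := by gcongr
      linarith)
    rw [hWdet, hs_AB, Finsupp.tail_cons, Finsupp.cons_zero, eval_AB, mul_eq_zero] at hz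
    rcases hz with hz | hz
    · apply hJ'2; rw [hs_smul, smul_eval, hz, mul_zero]
    · apply hj2; rw [hfV, map_smul, Polynomial.eval_smul, hz, smul_zero]
end PartM6
section PartM7
open MvPolynomial
lemma one_tail (d : NN) (hd : 1 <= d) (t : RR) :
    ∑ j ∈ Finset.range (d+1), Real.exp Yy <= (d + 1) * Real.exp (t ^ 2 / 8) := by
  have hd0 : Wh < d := by exact_mod_cast hd
  have hr : ∑ j ∈ Finset.range (d+1), Real.exp Yy =
      ∑ j ∈ Finset.range (d+1), Real.exp (-Yy) := by
    rw [<- Finset.sum_range_reflect]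
    refine zah rfl fun j hj => ?_
    have hj' : j <= d := by have := zbb.1 hj; omega
    congr 1
    rw [show d + 1 - 1 - j = d - j by omega, Nat.cast_sub hj']
    field_simp; ring
  have h2 : ∑ j ∈ Finset.range (d+1), Real.exp Yy =
      ∑ j ∈ Finset.range (d+1), Real.cosh Yy := by
    have : ∑ j ∈ Finset.range (d+1), Real.cosh Yy =
      (∑ j ∈ Finset.range (d+1), Real.exp Yy +
        ∑ j ∈ Finset.range (d+1), Real.exp (-Yy)) / 2 := by
      rw [<- zde, Finset.sum_div]
      refine zah rfl fun j hj => ?_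
      rw [Real.cosh_eq]
    rw [this, <- hr]; ring
  rw [h2]
  refine (zcd _ _ (Real.exp (t ^ 2 / 8)) fun j hj => ?_).trans ?_
  · refine (Real.cosh_le_exp_half_sq _).trans (Real.exp_le_exp.2 ?_)
    have hj' : (j : RR) <= d := by
      have : j <= d := by have := zbb.1 hj; omega
      exact_mod_cast this
    have h3 : (j : RR) / d <= 1 := by rw [div_le_one hd0]; exact hj'
    have h4 : 0 <= (j : RR) / d := by positivity
    have h5 : ((j : RR) / d - 1/2) ^ 2 <= 1/4 := by nlinarith
    rw [mul_pow]
    nlinarith [sq_nonneg t]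
  · simp
noncomputable def toF {m : NN} (f : Fin m -> NN) : Fin m →₀ NN := Finsupp.equivFunOnFinite.symm f
lemma toF_apply {m : NN} (f : Fin m -> NN) (i : Fin m) : toF f i = f i := rfl
def box {m : NN} (d : Fin m -> NN) : Finset (Fin m -> NN) := Fintype.piFinset fun i => Finset.range (d i + 1)
lemma box_tail {m : NN} (d : Fin m -> NN) (hd : ∀ i, 1 <= d i) (ε : RR) (hε : 0 < ε) (s : RR) (hs : s ^ 2 = 1) :
    (((box d).filter fun f => ε * m < s * Wm).card : RR) ≤
      (box d).card * Real.exp (-(2 * ε ^ 2 * m)) := by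
  have hsum : ∑ f ∈ box d, Real.exp (4 * ε * (s * Wm)) ≤
      (box d).card * Real.exp (2 * ε ^ 2 * m) := by
    have e : ∀ f : Fin m -> NN, Real.exp (4 * ε * (s * Wm)) =
        ∏ i, Real.exp ((4 * ε * s) * ((f i : RR) / d i - 1 / 2)) := by
      intro f
      rw [<- Real.exp_sum]
      congr 1
      rw [<- zbe, Finset.sum_sub_distrib]
      simp only [wt, toF_apply, Finset.sum_const, Finset.card_univ, Fintype.card_fin, nsmul_eq_mul]
      ring
    simp only [e]
    rw [box, <- Finset.prod_univ_sum (fun i => Finset.range (d i + 1))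
      (fun i (j : NN) => Real.exp ((4 * ε * s) * ((j : RR) / d i - 1 / 2)))]
    refine (Finset.prod_le_prod (fun i _ => Finset.sum_nonneg fun j _ => (Real.exp_pos _).le)
      (fun i _ => one_tail (d i) (hd i) (4 * ε * s))).trans ?_
    rw [zdf, Fintype.card_piFinset, Finset.prod_const]
    simp only [Finset.card_range, Finset.card_univ, Fintype.card_fin]
    push_cast
    rw [<- zca]
    refine le_of_eq ?_
    congr 2
    have : (4 * ε * s) ^ 2 = 16 * ε ^ 2 := by rw [mul_pow, hs]; ring
    rw [this]; ring
  have h1 : (((box d).filter fun f => ε * m < s * Wm).card : RR) * Real.exp (4 * ε * (ε * m)) ≤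
      ∑ f ∈ box d, Real.exp (4 * ε * (s * Wm)) := by
    rw [<- nsmul_eq_mul]
    refine (Finset.card_nsmul_le_sum _ _ _ fun f hf => ?_).trans
      (zch (Finset.filter_subset _ _) fun _ _ _ => (Real.exp_pos _).le)
    have := (Finset.mem_filter.1 hf).2
    apply Real.exp_le_exp.2
    gcongr
  have h2 := h1.trans hsum
  have h3 : (box d).card * Real.exp (2 * ε ^ 2 * m) =
    ((box d).card * Real.exp (-(2 * ε ^ 2 * m))) * Real.exp (4 * ε * (ε * m)) := by
    rw [mul_assoc ((box d).card : RR), <- Real.exp_add]; congr 2; ring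
  rw [h3] at h2
  exact le_of_mul_le_mul_right h2 (Real.exp_pos _)
attribute [local instance] Matrix.seminormedAddCommGroup
lemma box_card_le {m : NN} (d : Fin m -> NN) : (box d).card <= 2 ^ Ys := by
  rw [box, Fintype.card_piFinset, <- zcc]
  refine Finset.prod_le_prod (fun _ _ => Nat.zero_le _) fun i _ => ?_
  rw [Finset.card_range]
  exact Nat.lt_two_pow_self
theorem aux_poly {m : NN} (hm : 1 <= m) (ε : RR) (hε : 0 < ε) (hε2 : ε < 1/2)
    (hme : Real.exp (-(2 * ε ^ 2 * m)) <= 1/4) (d : Fin m -> NN) (hd : ∀ i, 1 <= d i) :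
    ∃ P : MvPolynomial (Fin m) QQ, P ≠ 0 ∧ IsI P ∧ (∀ i, degreeOf i P <= d i) ∧
      n1 P <= 8 ^ Ys ∧ (∀ I ∈ P.support, |wt d I - m / 2| <= ε * m) ∧
      (∀ J, wt d J < (1/2 - ε) * m -> eval (fun _ => 1) (hs J P) = 0) := by
  classical
  have hm0 : Wh < m := by exact_mod_cast hm
  set A := (box d).filter (fun f => wt d (toF f) < (1/2 - ε) * m) with hA
  set B := (box d).filter (fun f => |wt d (toF f) - m / 2| <= ε * m) with hB
  have hA1 : (A.card : RR) <= (box d).card / 4 := by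
    have h1 := box_tail d hd ε hε (-1) Yn
    have h2 : A = (box d).filter fun f => ε * m < (-1) * Wm := by
      rw [hA]; refine Finset.filter_congr fun f _ => ?_
      constructor <;> intro h <;> linarith
    rw [h2]
    refine h1.trans ?_
    have : Wh <= (box d).card := Nat.cast_nonneg _
    nlinarith
  have hB1 : ((box d).card : RR) / 2 <= B.card := by
    have h1 := box_tail d hd ε hε (-1) Yn
    have h2 := box_tail d hd ε hε 1 Yn
    set T1 := (box d).filter fun f => ε * m < (-1) * Wm
    set T2 := (box d).filter fun f => ε * m < 1 * Wm
    have hsub : box d ⊆ B ∪ (T1 ∪ T2) := by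
      intro f hf
      simp only [Finset.mem_union, hB, Finset.mem_filter, hf, true_and, T1, T2]
      by_contra hc
      push Not at hc
      obtain ⟨h3, h4, h5⟩ := hc
      exact absurd (abs_le.2 ⟨by linarith, by linarith⟩) (not_le.2 h3)
    have h3 : ((box d).card : RR) <= B.card + (T1.card + T2.card) := by
      have := (Finset.card_le_card hsub).trans ((Finset.card_union_le _ _).trans
        (Nat.add_le_add_left (Finset.card_union_le _ _) _))
      exact_mod_cast this
    have : Wh <= (box d).card := Nat.cast_nonneg _
    nlinarith
  have hAB : 2 * A.card <= B.card := by
    have : (2 : RR) * A.card <= B.card := by linarith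
    exact_mod_cast this
  have hA0 : 0 < A.card := by
    apply Finset.card_pos.2
    refine ⟨fun _ => 0, ?_⟩
    simp only [hA, Finset.mem_filter, box, Fintype.mem_piFinset, zbb]
    refine ⟨fun i => by omega, ?_⟩
    simp only [wt, toF_apply, Nat.cast_zero, zero_div, Finset.sum_const_zero]
    nlinarith
  set M : Matrix A B ZZ := Matrix.of fun J I => ((∏ i, (I.1 i).choose (J.1 i) : NN) : ZZ) with hM
  have hcA : Fintype.card A = A.card := Fintype.card_coe A
  have hcB : Fintype.card B = B.card := Fintype.card_coe B
  obtain ⟨t, ht0, hMt, htn⟩ := Int.Matrix.exists_ne_zero_int_vec_norm_le M Wg Wg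
  rw [hcA, hcB] at htn
  have hBI : ∀ I : B, ∀ i, I.1 i <= d i := by
    intro I i
    have := (Finset.mem_filter.1 I.2).1
    have := zbb.1 (Fintype.mem_piFinset.1 this i)
    omega
  have hcard2 : (B.card : RR) <= 2 ^ Ys := by
    have := (Finset.card_filter_le (box d) (fun f => |wt d (toF f) - m / 2| <= ε * m)).trans (box_card_le d)
    exact_mod_cast this
  have hB0 : (1 : RR) <= B.card := by
    have : 1 <= B.card := by omega
    exact_mod_cast this
  have hMn : max 1 ‖M‖ <= 2 ^ Ys := by
    refine max_le (one_le_pow₀ Yn) ?_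
    rw [Matrix.norm_le_iff Ye]
    intro J I
    rw [hM, Matrix.of_apply, Int.norm_natCast, <- zcc]
    have : ∏ i, (I.1 i).choose (J.1 i) <= ∏ i, 2 ^ d i :=
      Finset.prod_le_prod (fun _ _ => Nat.zero_le _) fun i _ =>
        (Nat.choose_le_two_pow _ _).trans (Nat.pow_le_pow_right Yn (hBI I i))
    exact_mod_cast this
  have htn' : ‖t‖ <= 4 ^ Ys := by
    refine htn.trans ?_
    have hbase : (1 : RR) <= B.card * max 1 ‖M‖ := by
      have := le_max_left (1 : RR) ‖M‖
      nlinarith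
    have hexp : (A.card : RR) / (B.card - A.card) <= 1 := by
      have h1 : (2 : RR) * A.card <= B.card := by exact_mod_cast hAB
      have h2 : Wh < A.card := by exact_mod_cast hA0
      rw [div_le_one Wk]; linarith
    refine (Real.rpow_le_rpow_of_exponent_le hbase hexp).trans ?_
    rw [Real.rpow_one, show (4 : RR) = 2 * 2 by norm_num, mul_pow]
    gcongr
  have hinj : ∀ I I' : B, toF I.1 = toF I'.1 -> I = I' := by
    intro I I' h
    exact Subtype.ext (Finsupp.equivFunOnFinite.symm.injective h)
  set P : MvPolynomial (Fin m) QQ := ∑ I : B, monomial (toF I.1) ((t I : ZZ) : QQ) with hP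
  have hPc : ∀ I : B, coeff (toF I.1) P = t I := by
    intro I
    rw [hP, coeff_sum, Finset.sum_eq_single I]
    · rw [coeff_monomial, if_pos rfl]
    · intro I' _ hne
      rw [coeff_monomial, if_neg]
      intro h; exact hne (hinj _ _ h)
    · simp
  have hPs : ∀ K ∈ P.support, ∃ I : B, K = toF I.1 := by
    intro K hK
    rw [mem_support_iff, hP, coeff_sum] at hK
    obtain ⟨I, _, hI⟩ := Finset.exists_ne_zero_of_sum_ne_zero hK
    refine ⟨I, ?_⟩
    rw [coeff_monomial] at hI
    by_contra hne
    rw [if_neg (fun h => hne h.symm)] at hI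
    exact hI rfl
  refine ⟨P, ?_, ?_, ?_, ?_, ?_, ?_⟩
  · intro h0
    apply ht0
    ext I
    have := hPc I
    rw [h0, coeff_zero] at this
    exact_mod_cast this.symm
  · intro K
    by_cases hK : K ∈ P.support
    · obtain ⟨I, rfl⟩ := hPs K hK
      exact ⟨t I, hPc I⟩
    · exact ⟨0, by rw [notMem_support_iff.1 hK]; simp⟩
  · intro i
    rw [degreeOf_le_iff]
    intro K hK
    obtain ⟨I, rfl⟩ := hPs K hK
    exact hBI I i
  · refine (n1_sum_le _ _).trans ?_
    simp only [n1_monomial]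
    have h1 : ∀ I ∈ (Finset.univ : Finset B), |(((t I : ZZ) : QQ) : RR)| <= 4 ^ Ys := by
      intro I _
      have := (norm_le_pi_norm t I).trans htn'
      rw [Int.norm_eq_abs] at this
      simpa using this
    refine (zcd _ _ _ h1).trans ?_
    rw [nsmul_eq_mul, Finset.card_univ, hcB, show (8 : RR) = 2 * 4 by norm_num, mul_pow]
    gcongr
  · intro K hK
    obtain ⟨I, rfl⟩ := hPs K hK
    exact (Finset.mem_filter.1 I.2).2
  · intro J hJ
    have e : eval (fun _ => 1) (hs J P) = ∑ I : B, ((∏ i, (I.1 i).choose (J i) : NN) : QQ) * t I := by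
      rw [hP, hs_sum, map_sum]
      refine zah rfl fun I _ => ?_
      rw [hs_monomial, eval_monomial]
      simp [toF_apply]
    rw [e]
    by_cases hJb : ∀ i, J i <= d i
    · have hJA : (fun i => J i) ∈ A := by
        simp only [hA, Finset.mem_filter, box, Fintype.mem_piFinset, zbb]
        refine ⟨fun i => by have := hJb i; omega, ?_⟩
        exact hJ
      have := congrFun hMt ⟨_, hJA⟩
      simp only [Matrix.mulVec, dotProduct, hM, Matrix.of_apply, Pi.zero_apply] at this
      have h2 := congrArg (fun x : ZZ => (x : QQ)) this
      push_cast at h2 ⊢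
      exact h2
    · push Not at hJb
      obtain ⟨i, hi⟩ := hJb
      refine Finset.sum_eq_zero fun I _ => ?_
      have : ∏ i, (I.1 i).choose (J i) = 0 :=
        Finset.prod_eq_zero (Finset.mem_univ i) (Nat.choose_eq_zero_of_lt ((hBI I i).trans_lt hi))
      rw [this]; simp
end PartM7
section PartM8
open MvPolynomial
lemma taylor_eval {m : NN} (Q : MvPolynomial (Fin m) QQ) (x z : Fin m -> QQ) (d : Fin m -> NN)
    (hd : ∀ i, degreeOf i Q <= d i) :
    eval z Q = ∑ f ∈ box d, eval x (hs (toF f) Q) * ∏ i, (z i - x i) ^ (f i) := by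
  classical
  have h1 : eval z Q = eval (fun i => z i - x i) (map (eval x) (tayl (Fin m) QQ Q)) := by
    have : (eval z : MvPolynomial (Fin m) QQ →+* QQ) =
        ((eval (fun i => z i - x i)).comp (map (eval x))).comp (tayl (Fin m) QQ).toRingHom := by
      apply MvPolynomial.ringHom_ext
      · intro r
        simp [tayl, MvPolynomial.algebraMap_eq,
          IsScalarTower.algebraMap_apply QQ (MvPolynomial (Fin m) QQ) (MvPolynomial (Fin m) (MvPolynomial (Fin m) QQ))]
      · intro i; simp [tayl]
    exact RingHom.congr_fun this Q
  rw [h1, eval_eq']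
  have hsub : (map (eval x) (tayl (Fin m) QQ Q)).support ⊆ (box d).image toF := by
    intro J hJ
    rw [mem_support_iff, coeff_map] at hJ
    have hJ2 : hs J Q ≠ 0 := by intro h; apply hJ; rw [show coeff J (tayl (Fin m) QQ Q) = hs J Q from rfl, h, map_zero]
    refine Finset.mem_image.2 ⟨fun i => J i, ?_, by ext i; rfl⟩
    rw [box, Fintype.mem_piFinset]
    intro i
    rw [zbb]
    obtain ⟨I, hI⟩ := ne_zero_iff.1 hJ2
    have := monomial_le_degreeOf i (mem_support_hs (mem_support_iff.2 hI))
    simp only [Finsupp.coe_add, Pi.add_apply] at this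
    have := hd i
    omega
  rw [Finset.sum_subset hsub, Finset.sum_image]
  · refine zah rfl fun f _ => ?_
    rw [coeff_map]; rfl
  · intro f _ g _ h
    exact Finsupp.equivFunOnFinite.symm.injective h
  · intro J _ hJ
    rw [notMem_support_iff.1 hJ, zero_mul]
lemma eval_one_le {m : NN} (R : MvPolynomial (Fin m) QQ) : |((eval (fun _ => 1) R : QQ) : RR)| <= n1 R := by
  rw [eval_eq', n1]
  push_cast
  simp only [one_pow, Finset.prod_const_one, mul_one]
  exact zbg _ _
lemma core_lower (u v m D0 : NN) (hu : 1 <= u) (hv : 1 <= v) (b d w : Fin m -> NN) (hbd : ∀ i, b i * d i = D0)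
    (hd : ∀ i, 1 <= d i) (hw : ∀ i, 1 <= w i)
    (Q : MvPolynomial (Fin m) QQ) (hQ : IsI Q) (hdeg : ∀ i, degreeOf i Q <= d i) (κ : RR)
    (h1 : ∀ I ∈ Q.support, κ <= wt d I) (h2 : ∀ I ∈ Q.support, κ <= m - wt d I)
    (hne : eval (fun i => (u : QQ) ^ b i / Wb) Q ≠ 0) :
    Real.exp ((Real.log u + Real.log v) * (D0 * κ)) <= (∏ i, ((v : RR) ^ b i * w i) ^ d i) *
      |((eval (fun i => (u : QQ) ^ b i / Wb) Q : QQ) : RR)| := by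
  classical
  choose a ha using hQ
  have hu0 : Wh < u := by exact_mod_cast hu
  have hv0 : Wh < v := by exact_mod_cast hv
  have huQ : (u : QQ) ≠ 0 := by positivity
  have hvQ : (v : QQ) ≠ 0 := by positivity
  have hwQ : ∀ i, (w i : QQ) ≠ 0 := fun i => by have := hw i; positivity
  set E := ⌈D0 * κ⌉₊ with hE
  have hbI : ∀ I : Fin m →₀ NN, ((∑ i, b i * I i : NN) : RR) = D0 * wt d I := by
    intro I
    rw [wt, zbe]; push_cast
    refine zah rfl fun i _ => ?_
    have hdi : Wh < d i := by exact_mod_cast hd i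
    rw [<- hbd i]; push_cast; field_simp
  have hId : ∀ I ∈ Q.support, ∀ i, I i <= d i := fun I hI i => (monomial_le_degreeOf i hI).trans (hdeg i)
  have hbI2 : ∀ I ∈ Q.support, ((∑ i, b i * (d i - I i) : NN) : RR) = D0 * (m - wt d I) := by
    intro I hI
    rw [mul_sub, <- hbI]
    have : ∑ i, b i * (d i - I i) + ∑ i, b i * I i = m * D0 := by
      rw [<- zde]
      rw [zah rfl (g := fun _ => D0)]
      · simp
      · intro i _
        rw [<- Nat.mul_add, Nat.sub_add_cancel (hId I hI i), hbd]
    have h3 : ((∑ i, b i * (d i - I i) : NN) : RR) + ((∑ i, b i * I i : NN) : RR) = m * D0 := by exact_mod_cast this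
    linarith
  have hD0 : Wh <= D0 := Nat.cast_nonneg _
  have hterm : ∀ I ∈ Q.support, ∃ T : ZZ, (∏ i, Wb ^ d i) *
      (coeff I Q * ∏ i, ((u : QQ) ^ b i / Wb) ^ I i) = ((u : QQ) * v) ^ E * T := by
    intro I hI
    have e1 : E <= ∑ i, b i * I i := by
      rw [hE, Nat.ceil_le, hbI]
      exact zaa (h1 I hI) hD0
    have e2 : E <= ∑ i, b i * (d i - I i) := by
      rw [hE, Nat.ceil_le, hbI2 I hI]
      exact zaa (h2 I hI) hD0
    obtain ⟨s1, hs1⟩ := Nat.exists_eq_add_of_le e1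
    obtain ⟨s2, hs2⟩ := Nat.exists_eq_add_of_le e2
    refine ⟨a I * u ^ s1 * v ^ s2 * ∏ i, (w i : ZZ) ^ (d i - I i), ?_⟩
    have e3 : (∏ i, Wb ^ d i) * ∏ i, ((u : QQ) ^ b i / Wb) ^ I i
        = (u : QQ) ^ (∑ i, b i * I i) * (v : QQ) ^ (∑ i, b i * (d i - I i)) * ∏ i, (w i : QQ) ^ (d i - I i) := by
      rw [<- zcc, <- zcc, <- zdf,
        <- zdf, <- zdf]
      refine Finset.prod_congr rfl fun i _ => ?_
      obtain ⟨t, ht⟩ := Nat.exists_eq_add_of_le (hId I hI i)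
      rw [ht, Nat.add_sub_cancel_left, div_pow, pow_add, pow_mul, pow_mul]
      have := hwQ i
      field_simp
      rw [mul_pow]
    rw [mul_left_comm, e3, hs1, hs2, ha]
    push_cast
    ring
  choose! T hT using hterm
  have hZ : (∏ i, Wb ^ d i) * eval (fun i => (u : QQ) ^ b i / Wb) Q
      = ((u : QQ) * v) ^ E * ((∑ I ∈ Q.support, T I : ZZ) : QQ) := by
    rw [eval_eq', zbe]; push_cast; rw [zbe]
    exact zah rfl fun I hI => hT I hI
  have hY0 : (∏ i, Wb ^ d i) ≠ 0 :=
    Finset.prod_ne_zero_iff.2 fun i _ => pow_ne_zero _ (mul_ne_zero (pow_ne_zero _ hvQ) (hwQ i))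
  set TT := ∑ I ∈ Q.support, T I with hTT
  have hTT0 : TT ≠ 0 := by
    intro h
    rw [h] at hZ; simp only [Int.cast_zero, mul_zero, mul_eq_zero] at hZ
    exact hZ.elim hY0 hne
  have h5 : (1 : RR) <= |(TT : RR)| := by exact_mod_cast Int.one_le_abs hTT0
  have hZR := congrArg (fun x : QQ => |(x : RR)|) hZ
  simp only [Rat.cast_mul, Rat.cast_prod, Rat.cast_pow, Rat.cast_natCast, Rat.cast_intCast, abs_mul] at hZR
  rw [zbc (by positivity : Yh <= ∏ i, ((v : RR) ^ b i * w i) ^ d i)] at hZR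
  rw [hZR, zbc (by positivity : Yh <= ((u : RR) * v) ^ E)]
  calc Real.exp ((Real.log u + Real.log v) * (D0 * κ)) <= Real.exp ((Real.log u + Real.log v) * E) := by
        apply Real.exp_le_exp.2
        have := Real.log_nonneg (by exact_mod_cast hu : Yr <= u)
        have := Real.log_nonneg (by exact_mod_cast hv : Yr <= v)
        have := Nat.le_ceil (D0 * κ)
        gcongr
    _ = ((u : RR) * v) ^ E := by
        rw [mul_comm, zca, Real.exp_add, Real.exp_log hu0, Real.exp_log hv0]
    _ <= _ := le_mul_of_one_le_right Ye h5
lemma core_upper (m D0 : NN) (b d : Fin m -> NN) (hbd : ∀ i, b i * d i = D0) (hd : ∀ i, 1 <= d i)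
    (Q : MvPolynomial (Fin m) QQ) (hdeg : ∀ i, degreeOf i Q <= d i) (κ ρ : RR) (hρ : 0 <= ρ)
    (hv : ∀ J, wt d J < κ -> eval (fun _ => 1) (hs J Q) = 0) (z : Fin m -> QQ)
    (hz : ∀ i, |((z i : QQ) : RR) - 1| <= 2 * Real.exp (-(ρ * b i))) :
    |((eval z Q : QQ) : RR)| <= 8 ^ Ys * n1 Q * Real.exp Wq := by
  classical
  rw [taylor_eval Q (fun _ => 1) z d hdeg]
  push_cast
  refine (zbg _ _).trans ?_
  have hb : ∀ f ∈ box d, |((eval (fun _ => 1) (hs (toF f) Q) : QQ) : RR) * ∏ i, (((z i : QQ) : RR) - 1) ^ f i| ≤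
      4 ^ Ys * n1 Q * Real.exp Wq := by
    intro f hf
    have hfd : ∀ i, f i <= d i := fun i => by
      have := zbb.1 (Fintype.mem_piFinset.1 hf i); omega
    have hn := n1_nonneg Q
    by_cases hJ : wt d (toF f) < κ
    · rw [hv _ hJ]; simp; positivity
    · push Not at hJ
      rw [abs_mul, Finset.abs_prod]
      have h1 : |((eval (fun _ => 1) (hs (toF f) Q) : QQ) : RR)| <= 2 ^ Ys * n1 Q :=
        (eval_one_le _).trans (n1_hs_le _ Q d hdeg)
      have h2 : ∏ i, |(((z i : QQ) : RR) - 1) ^ f i| <= 2 ^ Ys * Real.exp Wq := by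
        have h3 : ∏ i, |(((z i : QQ) : RR) - 1) ^ f i| <= ∏ i, (2 ^ d i * Real.exp (-(ρ * (b i * f i)))) := by
          refine Finset.prod_le_prod (fun _ _ => abs_nonneg _) fun i _ => ?_
          rw [abs_pow]
          calc _ <= (2 * Real.exp (-(ρ * b i))) ^ f i := by gcongr; exact hz i
            _ = 2 ^ f i * Real.exp (-(ρ * (b i * f i))) := by
                rw [mul_pow, <- zca]; congr 2; ring
            _ <= _ := by
                gcongr
                · norm_num
                · exact hfd i
        refine h3.trans ?_
        rw [zdf, zcc, <- Real.exp_sum]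
        refine zaa (Real.exp_le_exp.2 ?_) Ye
        rw [Finset.sum_neg_distrib, <- zbe]
        have : ∑ i, (b i : RR) * f i = D0 * wt d (toF f) := by
          rw [wt, zbe]
          refine zah rfl fun i _ => ?_
          have hdi : Wh < d i := by exact_mod_cast hd i
          rw [<- hbd i, toF_apply]; push_cast; field_simp
        rw [this]
        have h0 : Yh <= D0 := Nat.cast_nonneg _
        have := zaa (zaa hJ h0) hρ
        linarith
      calc _ <= (2 ^ Ys * n1 Q) * (2 ^ Ys * Real.exp Wq) := by
            gcongr
        _ = _ := by rw [show (4:RR) = 2 * 2 by norm_num, mul_pow]; ring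
  refine (zcd _ _ _ hb).trans ?_
  rw [nsmul_eq_mul, show (8:RR) = 2 * 4 by norm_num, mul_pow]
  have hc : ((box d).card : RR) <= 2 ^ Ys := by exact_mod_cast box_card_le d
  have hn := n1_nonneg Q
  calc _ <= (2:RR) ^ Ys * (4 ^ Ys * n1 Q * Real.exp Wq) := by gcongr
    _ = _ := by ring
lemma den_ge (u v b w : NN) (hcop : Nat.Coprime u v) (hv : 1 <= v) (hw : 1 <= w) :
    v ^ b <= ((u : QQ) ^ b / ((v : QQ) ^ b * w)).den := by
  set z : QQ := (u : QQ) ^ b / ((v : QQ) ^ b * w) with hz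
  have hvQ : (v : QQ) ≠ 0 := by positivity
  have hwQ : (w : QQ) ≠ 0 := by positivity
  have h1 : z * ((v : QQ) ^ b * w) = (u : QQ) ^ b := by rw [hz]; field_simp
  have h2 : (z.num : QQ) * ((v : QQ) ^ b * w) = (u : QQ) ^ b * z.den := by
    have hd : (z.den : QQ) ≠ 0 := by exact_mod_cast z.den_nz
    have : z * z.den = z.num := Rat.mul_den_eq_num z
    rw [<- this, <- h1]; ring
  have h3 : z.num * ((v : ZZ) ^ b * w) = (u : ZZ) ^ b * z.den := by exact_mod_cast h2
  have h4 : (v : ZZ) ^ b ∣ (u : ZZ) ^ b * z.den := ⟨z.num * w, by rw [<- h3]; ring⟩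
  have h5 : IsCoprime ((v : ZZ) ^ b) ((u : ZZ) ^ b) := by
    apply IsCoprime.pow
    exact (Nat.isCoprime_iff_coprime.2 hcop).symm
  have h6 : (v : ZZ) ^ b ∣ z.den := h5.dvd_of_dvd_mul_left h4
  have h7 : v ^ b ∣ z.den := by exact_mod_cast h6
  exact Nat.le_of_dvd z.den_pos h7
end PartM8
section PartM9
open MvPolynomial
set_option maxHeartbeats 1000000 in
lemma mahler_core (u v : NN) (hcop : Nat.Coprime u v) (hv : 2 <= v) (hvu : v < u) (ε0 : RR) (h0 : 0 < ε0)
    (hinf : ∀ n : NN, ∃ b ≥ n, ∃ w : NN,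
      |Va ^ b - w| < Real.exp (-(ε0 * b * Real.log Va))) : False := by
  classical
  have hu0 : Wh < u := by
    have : 0 < u := by omega
    exact_mod_cast this
  have hv0 : Wh < v := by
    have : 0 < v := by omega
    exact_mod_cast this
  have hr1 : 1 < (u : RR) / v := by rw [lt_div_iff₀ hv0]; simpa using (by exact_mod_cast hvu : (v:RR) < u)
  set r := (u : RR) / v with hr
  set L := Real.log r with hL
  have hL0 : 0 < L := Real.log_pos hr1
  have hLe : L = Real.log u - Real.log v := by rw [hL, hr, Real.log_div hu0.ne' hv0.ne']
  have hlv : 0 < Real.log v := Real.log_pos (by exact_mod_cast (by omega : 1 < v))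
  have hlu : 0 < Real.log u := Real.log_pos (by exact_mod_cast (by omega : 1 < u))
  obtain ⟨ε, hε0, hε8, hεL⟩ : ∃ ε : RR, 0 < ε ∧ ε <= 1 / 8 ∧ ε * (64 * Real.log u) <= ε0 * L := by
    refine ⟨min (1/8) (ε0 * L / (64 * Real.log u)), by positivity, min_le_left _ _, ?_⟩
    rw [<- le_div_iff₀ Ye]
    exact min_le_right _ _
  obtain ⟨m, hm1, hme⟩ : ∃ m : NN, 1 <= m ∧ Real.exp (-(2 * ε ^ 2 * m)) <= 1 / 4 := by
    obtain ⟨m, hm⟩ := exists_nat_ge (2 / ε ^ 2)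
    refine ⟨m + 1, by omega, ?_⟩
    have : 4 <= 2 * ε ^ 2 * ((m + 1 : NN) : RR) := by
      rw [zae Ye] at hm
      push_cast; nlinarith [sq_nonneg ε]
    rw [Real.exp_neg, inv_le_comm₀ (Real.exp_pos _) Yn]
    have := Real.add_one_le_exp (2 * ε ^ 2 * ((m + 1 : NN) : RR))
    linarith
  have hm0 : Wh < m := by exact_mod_cast hm1
  obtain ⟨ω, hω, hroth⟩ := roth_lemma m (ε * m) Ye
  obtain ⟨B, hB1, hBr, hBa, hBb, hBc⟩ : ∃ B : NN, 1 <= B ∧ (2 : RR) <= r ^ B ∧ 1 <= B * (ω * Real.log v) ∧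
      m * Real.log 8 <= B * (ω * Real.log v) ∧ Real.log 256 * 32 <= B * (ε0 * L) := by
    have t1 := tendsto_pow_atTop_atTop_of_one_lt hr1
    have t2 : Filter.Tendsto (fun B : NN => (B : RR) * (ω * Real.log v)) Filter.atTop Filter.atTop :=
      tendsto_natCast_atTop_atTop.atTop_mul_const Ye
    have t3 : Filter.Tendsto (fun B : NN => (B : RR) * (ε0 * L)) Filter.atTop Filter.atTop :=
      tendsto_natCast_atTop_atTop.atTop_mul_const Ye
    have := (Filter.eventually_ge_atTop 1).and ((t1.eventually_ge_atTop 2).and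
      ((t2.eventually_ge_atTop 1).and ((t2.eventually_ge_atTop (m * Real.log 8)).and
      (t3.eventually_ge_atTop (Real.log 256 * 32)))))
    exact this.exists
  choose g hg W hW using hinf
  obtain ⟨c, hc0, hcs⟩ : ∃ c : NN -> NN, c 0 = g B ∧ ∀ n, c (n + 1) = g (⌈(c n : RR) * (1 / ω + 1)⌉₊) :=
    ⟨fun n => Nat.rec (motive := fun _ => NN) (g B) (fun _ x => g (⌈(Nat.cast x : RR) * (1 / ω + 1)⌉₊)) n, rfl, fun _ => rfl⟩
  have hcge : ∀ n, (c n : RR) * (1 / ω + 1) <= c (n + 1) := by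
    intro n
    rw [hcs]
    exact (Nat.le_ceil _).trans (by exact_mod_cast hg _)
  have hcmono1 : ∀ n, c n <= c (n + 1) := by
    intro n
    have h1 := hcge n
    have h2 : Wh <= c n * (1 / ω) := by positivity
    have : (c n : RR) <= c (n + 1) := by linarith
    exact_mod_cast this
  have hcmono : Monotone c := monotone_nat_of_le_succ hcmono1
  have hcB : ∀ n, B <= c n := fun n => (hg B).trans (hc0 ▸ hcmono (Nat.zero_le n))
  have hcω : ∀ n n', n < n' -> (c n : RR) <= ω * c n' := by
    intro n n' h
    have h1 := hcge n
    have h2 : (c (n + 1) : RR) <= c n' := by exact_mod_cast hcmono h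
    have h3 : (c n : RR) * (1 / ω) <= c n' := by
      have : Wh <= c n := by positivity
      linarith
    calc (c n : RR) = ω * (c n * (1 / ω)) := by field_simp
      _ <= _ := by gcongr
  have hcW : ∀ n, ∃ w : NN, |r ^ (c n) - w| < Real.exp (-(ε0 * (c n : NN) * L)) := by
    intro n
    cases n with
    | zero => rw [hc0]; exact ⟨_, hW B⟩
    | succ n => rw [hcs]; exact ⟨_, hW _⟩
  choose w' hw' using hcW
  let b : Fin m -> NN := fun i => c (m - 1 - i)
  let w : Fin m -> NN := fun i => w' (m - 1 - i)
  have hbB : ∀ i, B <= b i := fun i => hcB _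
  have hbw : ∀ i, |r ^ (b i) - w i| < Real.exp (-(ε0 * b i * L)) := fun i => hw' _
  have hbω : ∀ i j, i < j -> (b j : RR) <= ω * b i := by
    intro i j h
    apply hcω
    have : (i : NN) < j := h
    omega
  clear_value b w
  have hb0 : ∀ i, 0 < b i := fun i => lt_of_lt_of_le hB1 (hbB i)
  have hb0' : ∀ i, Wh < b i := fun i => by exact_mod_cast hb0 i
  set D0 := ∏ i, b i with hD0
  have hD0p : 0 < D0 := Finset.prod_pos fun i _ => hb0 i
  have hD0p' : Wh < D0 := by exact_mod_cast hD0p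
  let d : Fin m -> NN := fun i => ∏ j ∈ Finset.univ.erase i, b j
  have hbd : ∀ i, b i * d i = D0 := fun i => Finset.mul_prod_erase _ _ (Finset.mem_univ i)
  have hd1 : ∀ i, 1 <= d i := fun i => Finset.prod_pos fun i _ => hb0 i
  clear_value d
  have hbdR : ∀ i, (b i : RR) * d i = D0 := fun i => by exact_mod_cast hbd i
  have hdD : ∀ i, (B : RR) * d i <= D0 := by
    intro i
    rw [<- hbdR i]
    have : (B : RR) <= b i := by exact_mod_cast hbB i
    gcongr
  set S := ∑ i, d i with hS
  have hSD : (B : RR) * S <= m * D0 := by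
    rw [hS]; push_cast; rw [zbe]
    refine (zba fun i _ => hdD i).trans ?_
    simp
  have hB0 : Wh < B := by exact_mod_cast hB1
  obtain ⟨P, hP0, hPI, hPd, hPn, hPs, hPv⟩ := aux_poly hm1 ε hε0 Wk hme d hd1
  have hexp1 : ∀ i, Real.exp (-(ε0 * b i * L)) <= 1 := by
    intro i
    rw [Real.exp_le_one_iff]
    have := hb0' i
    have : 0 <= ε0 * b i * L := by positivity
    linarith
  have hr2 : ∀ i, 2 <= r ^ b i := fun i => hBr.trans (pow_le_pow_right₀ hr1.le (hbB i))
  have hwlo : ∀ i, r ^ b i / 2 <= w i := by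
    intro i
    have h1 := (abs_lt.1 (hbw i)).2
    have := hexp1 i; have := hr2 i
    linarith
  have hwhi : ∀ i, (w i : RR) <= 2 * r ^ b i := by
    intro i
    have h1 := (abs_lt.1 (hbw i)).1
    have := hexp1 i; have := hr2 i
    linarith
  have hw1 : ∀ i, 1 <= w i := by
    intro i
    have : (1 : RR) <= w i := by have := hwlo i; have := hr2 i; linarith
    exact_mod_cast this
  set z : Fin m -> QQ := fun i => (u : QQ) ^ b i / Wb with hz
  obtain ⟨J0, hJ0, hne⟩ := hroth d (D0 * Real.log v) z P hd1 (by
      intro i j h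
      have h1 := hbω i j h
      have e1 := hbdR i; have e2 := hbdR j
      have hbi := hb0' i; have hbj := hb0' j
      have : (d i : RR) = D0 / b i := by rw [eq_div_iff hbi.ne']; linarith
      rw [this]
      have : (d j : RR) = D0 / b j := by rw [eq_div_iff hbj.ne']; linarith
      rw [this, zae hbi]
      have : ω * (D0 / b j) * b i = D0 * ((ω * b i) / b j) := by ring
      rw [this]
      have : 1 <= (ω * b i) / b j := by rw [le_div_iff₀ hbj]; linarith
      nlinarith) (by
      intro i
      have h1 := hdD i
      have : (d i : RR) * 1 <= d i * (B * (ω * Real.log v)) := by gcongr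
      have h3 : (B * (d i : RR)) * (ω * Real.log v) <= D0 * (ω * Real.log v) := by gcongr
      nlinarith) hPI hP0 hPd (by
      refine hPn.trans ?_
      rw [<- Real.exp_log (by norm_num : Yh < 8), <- zca]
      apply Real.exp_le_exp.2
      have h8 : 0 < Real.log 8 := Real.log_pos Yn
      have h1 : (B : RR) * S * Real.log 8 <= m * D0 * Real.log 8 := by gcongr
      have h2 : D0 * (m * Real.log 8) <= D0 * (B * (ω * Real.log v)) := by gcongr
      have h3 : (B : RR) * (S * Real.log 8) <= B * (ω * (D0 * Real.log v)) := by nlinarith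
      exact le_of_mul_le_mul_left h3 hB0) (by
      intro i
      have h1 := den_ge u v (b i) (w i) hcop Wg (hw1 i)
      have h2 : ((v : RR) ^ b i) <= ((z i).den : RR) := by rw [<- Nat.cast_pow]; exact Nat.cast_le.2 h1
      calc Real.exp (D0 * Real.log v) = (v : RR) ^ D0 := by rw [zca, Real.exp_log hv0]
        _ = ((v : RR) ^ b i) ^ d i := by rw [<- pow_mul, hbd]
        _ <= _ := by gcongr)
  set κ := (1 / 2 - 2 * ε) * m with hκ
  have hκ0 : 0 <= κ := by apply mul_nonneg <;> linarith
  set ρ := (1 + ε0) * L with hρ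
  have hQs : ∀ I ∈ (hs J0 P).support, |wt d I + wt d J0 - m / 2| <= ε * m := by
    intro I hI
    rw [<- wt_add]
    exact hPs _ (mem_support_hs hI)
  have hdQ : ∀ i, degreeOf i (hs J0 P) <= d i := fun i => (degreeOf_hs _ _ _).trans (hPd i)
  have hJ0n := wt_nonneg d J0
  have low := core_lower u v m D0 Wg Wg b d w hbd hd1 hw1 (hs J0 P) (hPI.hs J0) hdQ κ (by
      intro I hI
      have := (abs_le.1 (hQs I hI)).1
      rw [hκ]; linarith) (by
      intro I hI
      have := (abs_le.1 (hQs I hI)).2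
      rw [hκ]; nlinarith) hne
  have up := core_upper m D0 b d hbd hd1 (hs J0 P) hdQ κ ρ Ye (by
      intro J hJ
      rw [hs_hs]
      have : eval (fun _ => 1) (hs (J + J0) P) = (0:QQ) := by
        apply hPv
        rw [wt_add]; rw [hκ] at hJ; linarith
      have h' : eval (fun _ => 1) (hs (J0 + J) P) = (0:QQ) := by rw [add_comm]; exact this
      simp [this, h']) z (by
      intro i
      have hwp : Wh < w i := by exact_mod_cast hw1 i
      have e1 : ((z i : QQ) : RR) - 1 = (r ^ b i - w i) / w i := by
        rw [hz]; push_cast; rw [hr, div_pow]; field_simp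
      rw [e1, abs_div, zea hwp, zae hwp]
      refine (hbw i).le.trans ?_
      have e2 : Real.exp (-(ρ * b i)) = Real.exp (-(ε0 * b i * L)) * (r ^ b i)⁻¹ := by
        rw [<- Real.exp_log (by positivity : 0 < r), <- zca, <- Real.exp_neg, <- Real.exp_add, hρ]
        congr 1; ring
      rw [e2]
      have hrp : 0 < r ^ b i := by positivity
      calc Real.exp (-(ε0 * b i * L)) = 2 * (Real.exp (-(ε0 * b i * L)) * (r ^ b i)⁻¹) * (r ^ b i / 2) := by
            field_simp
        _ <= _ := by gcongr; exact hwlo i)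
  have hn1 : n1 (hs J0 P) <= 2 ^ S * 8 ^ S := (n1_hs_le J0 P d hPd).trans (by gcongr)
  have hprod : (∏ i, ((v : RR) ^ b i * w i) ^ d i) <= 2 ^ S * Real.exp (m * D0 * Real.log u) := by
    calc (∏ i, ((v : RR) ^ b i * w i) ^ d i) <= ∏ i, (2 ^ d i * (u : RR) ^ D0) := by
          refine Finset.prod_le_prod (fun i _ => by positivity) fun i _ => ?_
          rw [<- hbd i, pow_mul, <- mul_pow]
          apply pow_le_pow_left₀ Ye
          calc (v : RR) ^ b i * w i <= v ^ b i * (2 * r ^ b i) := by gcongr; exact hwhi i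
            _ = _ := by rw [hr, div_pow]; field_simp
      _ = _ := by
          rw [zdf, zcc, Finset.prod_const, mul_assoc,
            zca, zca, Real.exp_log hu0]
          simp [<- pow_mul, mul_comm, hS]
  have hfin : Real.exp ((Real.log u + Real.log v) * (D0 * κ)) ≤
      (2 ^ S * Real.exp (m * D0 * Real.log u)) * (8 ^ S * (2 ^ S * 8 ^ S) * Real.exp Wq) := by
    refine low.trans (mul_le_mul hprod (up.trans ?_) (abs_nonneg _) Ye)
    gcongr
  have hfin2 : (2 ^ S * Real.exp (m * D0 * Real.log u)) * (8 ^ S * (2 ^ S * 8 ^ S) * Real.exp Wq)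
      = Real.exp (S * Real.log 256 + m * D0 * Real.log u - ρ * (D0 * κ)) := by
    rw [sub_eq_add_neg, Real.exp_add, Real.exp_add, zca, Real.exp_log Yn,
      show (256:RR) = 2 * (8 * (2 * 8)) by norm_num, mul_pow, mul_pow, mul_pow]
    ring
  rw [hfin2] at hfin
  have h1 := Real.exp_le_exp.1 hfin
  have h2 : ε0 * L * (1 / 2 - 2 * ε) * (m * D0) <= S * Real.log 256 + 4 * ε * Real.log u * (m * D0) := by
    rw [hρ, hκ] at h1
    have e : Real.log v = Real.log u - L := by linarith
    rw [e] at h1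
    nlinarith
  have hmD : Wh < m * D0 := by positivity
  have h3 : ε0 * L * (m * D0) / 4 <= ε0 * L * (1 / 2 - 2 * ε) * (m * D0) := by
    have : 0 < ε0 * L * (m * D0) := by positivity
    nlinarith
  have h4 : 4 * ε * Real.log u * (m * D0) <= ε0 * L / 16 * (m * D0) := by
    apply zab _ hmD.le
    linarith
  have h5 : S * Real.log 256 <= ε0 * L / 32 * (m * D0) := by
    have h256 : 0 < Real.log 256 := Real.log_pos Yn
    have a1 : (S : RR) * (Real.log 256 * 32) <= S * (B * (ε0 * L)) := by gcongr
    have a2 : B * (S : RR) * (ε0 * L) <= m * D0 * (ε0 * L) := by gcongr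
    nlinarith
  have : 0 < ε0 * L * (m * D0) := by positivity
  nlinarith
theorem mahler_thm (u v : NN) (hcop : Nat.Coprime u v) (hv : 2 <= v) (hvu : v < u) (ε0 : RR) (h0 : 0 < ε0) :
    ∃ h0 : NN, ∀ h ≥ h0, ∀ w : ZZ,
      Real.exp (-(ε0 * h * Real.log Va)) <= |Va ^ h - w| := by
  by_contra! hcon
  apply mahler_core u v hcop hv hvu ε0 h0
  intro n
  have hv0 : Wh < v := by
    have : 0 < v := by omega
    exact_mod_cast this
  have hr1 : 1 < (u : RR) / v := by rw [lt_div_iff₀ hv0]; simpa using (by exact_mod_cast hvu : (v:RR) < u)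
  obtain ⟨h, hh, w, hw⟩ := hcon n
  refine ⟨h, hh, w.toNat, ?_⟩
  have hw0 : 0 <= w := by
    by_contra! hneg
    have h1 : (w : RR) <= -1 := by exact_mod_cast (by omega : w <= -1)
    have h2 : 0 < Va ^ h := by positivity
    have h3 := (abs_lt.1 hw).2
    have h4 : Real.exp (-(ε0 * h * Real.log Va)) <= 1 := by
      rw [Real.exp_le_one_iff]
      have := Real.log_pos hr1
      have : 0 <= ε0 * h * Real.log Va := by positivity
      linarith
    linarith
  have : ((w.toNat : NN) : RR) = w := by
    have : ((w.toNat : NN) : ZZ) = w := Int.toNat_of_nonneg hw0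
    exact_mod_cast this
  rw [this]; exact hw
end PartM9
section PartZ1
open Set MeasureTheory Filter Topology
noncomputable def bz (j : NN) (x : RR) : RR := bernoulliFun j (Int.fract x)
lemma bf_cont (j : NN) : Continuous (bernoulliFun j) :=
  Polynomial.continuous _
lemma bz_bdd (j : NN) : ∃ C : RR, 0 < C ∧ ∀ x, |bz j x| <= C := by
  obtain ⟨C, hC⟩ := isCompact_Icc.exists_bound_of_continuousOn (s := Icc Yh 1) (bf_cont j).continuousOn
  refine ⟨max C 1, by positivity, fun x => ?_⟩
  exact (hC _ ⟨Int.fract_nonneg x, (Int.fract_lt_one x).le⟩).trans (le_max_left _ _)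
lemma bz_meas (j : NN) : Measurable (bz j) := (bf_cont j).measurable.comp measurable_fract
lemma bz_cont (j : NN) (hj : 2 <= j) : Continuous (bz j) := by
  have hj1 : j ≠ 1 := by omega
  exact ContinuousOn.comp_fract'' (f := bernoulliFun j) (bf_cont j).continuousOn
    (bernoulliFun_endpoints_eq_of_ne_one hj1).symm
lemma bz_per (j : NN) : Function.Periodic (bz j) 1 := fun x => by simp [bz]
lemma bz_deriv (j : NN) (x : RR) : HasDerivWithinAt (bz Ym) (Ym * bz j x) (Ioi x) x := by
  have h1 : HasDerivAt (fun y : RR => bernoulliFun Ym (y - ⌊x⌋)) (Ym * bz j x) x := by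
    have := (hasDerivAt_bernoulliFun Ym (x - ⌊x⌋)).comp x ((zed x).sub_const (⌊x⌋ : RR))
    refine this.congr_deriv ?_
    rw [bz, <- Int.self_sub_floor]; push_cast; simp
  refine h1.hasDerivWithinAt.congr_of_eventuallyEq ?_ ?_
  · have : Ioo x (⌊x⌋ + 1) ∈ 𝓝[>] x := Ioo_mem_nhdsGT (Int.lt_floor_add_one x)
    filter_upwards [this] with y hy
    have : ⌊y⌋ = ⌊x⌋ := by
      rw [Int.floor_eq_iff]
      exact ⟨(Int.floor_le x).trans hy.1.le, hy.2⟩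
    rw [bz, <- Int.self_sub_floor, this]
  · rw [bz, <- Int.self_sub_floor]
lemma psiB_eq (j : NN) (x : RR) (h : j ≠ 1 ∨ Int.fract x ≠ 0) : psiB j x = bz j x := by
  have hb : bz j x = Polynomial.aeval (Int.fract x) (Polynomial.bernoulli j) := by
    simp [bz, bernoulliFun, Polynomial.eval_map_algebraMap]
  by_cases hj : j = 1
  · subst hj
    have hx : Int.fract x ≠ 0 := by simpa using h
    rw [psiB, if_pos rfl, if_neg hx, bz, bernoulliFun_one]
  · rw [psiB, if_neg hj, hb]
lemma subst_exp {E : Type*} [NormedAddCommGroup E] [NormedSpace RR E] (X L a b : RR) (hX : 0 < X) (hL : 0 < L)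
    (hab : a <= b) (g : RR -> E) : ∫ t in (X * Real.exp (L * a))..(X * Real.exp (L * b)), g t =
      ∫ y in a..b, (L * (X * Real.exp Yi)) • g (X * Real.exp Yi) := by
  have hm : StrictMono fun y : RR => X * Real.exp Yi := fun x y h => by dsimp; gcongr
  have hc : Continuous fun y : RR => X * Real.exp Yi := by fun_prop
  have himg : (fun y : RR => X * Real.exp Yi) '' Icc a b =
      Icc (X * Real.exp (L * a)) (X * Real.exp (L * b)) := by
    apply Subset.antisymm
    · rintro _ ⟨y, hy, rfl⟩; exact ⟨hm.monotone hy.1, hm.monotone hy.2⟩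
    · exact intermediate_value_Icc hab hc.continuousOn
  rw [intervalIntegral.integral_of_le (hm.monotone hab), intervalIntegral.integral_of_le hab,
    <- integral_Icc_eq_integral_Ioc, <- integral_Icc_eq_integral_Ioc, <- himg]
  rw [integral_image_eq_integral_abs_deriv_smul measurableSet_Icc
    (f' := fun y => L * (X * Real.exp Yi)) _ hm.injective.injOn]
  · refine setIntegral_congr_fun measurableSet_Icc fun y _ => ?_
    rw [zea Ye]
  · intro y _
    have := (((zed y).const_mul L).exp.const_mul X).hasDerivWithinAt (s := Icc a b)
    refine this.congr_deriv ?_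
    simp; ring
end PartZ1
section PartZ2
open Set MeasureTheory Filter Topology
noncomputable def Gz (j : NN) (s : CC) : CC := ∫ x in Ioi (1 : RR), (bz j x : CC) * (x : CC) ^ (-Vb)
lemma bzc_meas (j : NN) : Measurable fun x => (bz j x : CC) := Complex.measurable_ofReal.comp (bz_meas j)
lemma bz_cpow_integrableOn (j : NN) (s : CC) (hs : 1 < s.re) (a : RR) (ha : 0 < a) :
    IntegrableOn (fun x : RR => (bz j x : CC) * (x : CC) ^ (-s)) (Ioi a) := by
  obtain ⟨C, hC0, hC⟩ := bz_bdd j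
  refine Integrable.bdd_mul (c := C) ?_ (bzc_meas j).aestronglyMeasurable (ae_of_all _ fun x => ?_)
  · exact integrableOn_Ioi_cpow_of_lt (by simpa using hs) ha
  · simpa using hC x
lemma bz_ii (j : NN) (a b : RR) : IntervalIntegrable (fun x => (bz j x : CC)) volume a b := by
  obtain ⟨C, hC0, hC⟩ := bz_bdd j
  refine (intervalIntegrable_const (c := C)).mono_fun (bzc_meas j).aestronglyMeasurable (ae_of_all _ fun x => ?_)
  simpa [zea hC0] using hC x
lemma bz_ibp (j : NN) (hj : 1 <= j) (s : CC) (Y : RR) (hY : 1 <= Y) :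
    ∫ x in Yr..Y, (bz j x : CC) * (x : CC) ^ (-Vb) =
      ((bz Ym Y : CC) * (Y : CC) ^ (-Vb) - bz Ym 1) / Ym +
      Vb / Ym * ∫ x in Yr..Y, (bz Ym x : CC) * (x : CC) ^ (-(s + (j + 1 : NN))) := by
  have hpos : ∀ x ∈ uIcc 1 Y, Wh < x := fun x hx => by
    rw [uIcc_of_le hY] at hx; linarith [hx.1]
  have hcont : ∀ c : CC, ContinuousOn (fun x : RR => (x : CC) ^ c) (uIcc 1 Y) := fun c x hx =>
    (Complex.continuousAt_ofReal_cpow_const _ _ (Or.inr (hpos x hx).ne')).continuousWithinAt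
  have key := intervalIntegral.integral_mul_deriv_eq_deriv_mul_of_hasDeriv_right
    (u := fun x : RR => (x : CC) ^ (-Vb)) (v := fun x => (bz Ym x : CC)) (a := 1) (b := Y)
    (u' := fun x : RR => -Vb * (x : CC) ^ (-(s + (j + 1 : NN)))) (v' := fun x => Ym * (bz j x : CC))
    (hcont _) ((Complex.continuous_ofReal.comp (bz_cont Ym Wg)).continuousOn)
    (fun x hx => by
      rw [min_eq_left hY, max_eq_right hY] at hx
      have hx0 : Yh < x := by linarith [hx.1]
      have hx1 : (x : CC) ∈ Complex.slitPlane := Complex.ofReal_mem_slitPlane.2 hx0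
      have := ((zed (x : CC)).cpow_const (c := -Vb) hx1).comp_ofReal
      refine (this.congr_deriv ?_).hasDerivWithinAt
      simp only [id, mul_one]
      congr 2; push_cast; ring)
    (fun x hx => by
      have := (bz_deriv j x).ofReal_comp
      refine this.congr_deriv ?_
      push_cast; rfl)
    (((hcont _).const_mul _).intervalIntegrable)
    ((bz_ii j 1 Y).const_mul _)
  have e1 : ∫ x in Yr..Y, (x : CC) ^ (-Vb) * (Ym * (bz j x : CC)) =
      Ym * ∫ x in Yr..Y, (bz j x : CC) * (x : CC) ^ (-Vb) := by
    rw [<- zad]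
    congr 1; ext x; ring
  have e2 : ∫ x in Yr..Y, -Vb * (x : CC) ^ (-(s + (j + 1 : NN))) * (bz Ym x : CC) =
      -(Vb * ∫ x in Yr..Y, (bz Ym x : CC) * (x : CC) ^ (-(s + (j + 1 : NN)))) := by
    rw [<- zad, <- intervalIntegral.integral_neg]
    congr 1; ext x; ring
  rw [e1, e2] at key
  have hj0 : (j : CC) + 1 ≠ 0 := by exact_mod_cast Nat.succ_ne_zero j
  rw [<- mul_right_inj' hj0, key]
  simp only [Complex.ofReal_one, Complex.one_cpow]
  field_simp
  ring
lemma Gz_rec (j : NN) (hj : 1 <= j) (s : CC) (hs : 1 < s.re + j) :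
    Gz j s = -(bz Ym 1 : CC) / Ym + Vb / Ym * Gz Ym s := by
  have t1 := intervalIntegral_tendsto_integral_Ioi 1
    (bz_cpow_integrableOn j Vb (by simpa using hs) 1 one_pos) tendsto_id
  have t2 := intervalIntegral_tendsto_integral_Ioi 1
    (bz_cpow_integrableOn Ym (s + (j + 1 : NN)) (by simp; linarith) 1 one_pos) tendsto_id
  obtain ⟨C, hC0, hC⟩ := bz_bdd Ym
  have t3 : Tendsto (fun Y : RR => (bz Ym Y : CC) * (Y : CC) ^ (-Vb)) atTop (𝓝 0) := by
    have h0 : Tendsto (fun Y : RR => C * Y ^ (-(s.re + j))) atTop (𝓝 0) := by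
      simpa using (tendsto_rpow_neg_atTop (by linarith : 0 < s.re + j)).const_mul C
    refine squeeze_zero_norm' ?_ h0
    filter_upwards [eventually_gt_atTop 0] with Y hY
    rw [norm_mul, Complex.norm_cpow_eq_rpow_re_of_pos hY]
    rw [show (-(s + (j:CC))).re = -(s.re + j) by simp]
    exact zab (by simpa using hC Y) Ye
  have t4 := ((t3.sub_const (bz Ym 1 : CC)).div_const ((j : CC) + 1)).add (t2.const_mul (Vb / Ym))
  have := tendsto_nhds_unique (t1.congr' ?_) t4
  · rw [Gz, this, Gz]; ring
  · filter_upwards [eventually_ge_atTop 1] with Y hY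
    exact bz_ibp j hj s Y hY
lemma zeta_one (s : CC) (hs : 1 < s.re) : riemannZeta s = 1 / (s - 1) + 1 / 2 - s * Gz 1 s := by
  have h := LSeries_eq_mul_integral' 1 zero_le_one hs (by
    refine Asymptotics.isBigO_of_le _ fun n => ?_
    simp)
  rw [LSeries_one_eq_riemannZeta hs] at h
  have hs0 : s ≠ 0 := by intro h; simp [h] at hs; linarith
  have hs1 : s - 1 ≠ 0 := by intro h; rw [sub_eq_zero] at h; simp [h] at hs
  have e : ∫ t in Ioi (1 : RR), (∑ k ∈ Finset.Icc 1 ⌊t⌋₊, (1 : NN -> CC) k) * (t : CC) ^ (-(s + 1)) =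
      ∫ t in Ioi (1 : RR), ((t : CC) ^ (-s) - 1 / 2 * (t : CC) ^ (-(s + 1)) - (bz 1 t : CC) * (t : CC) ^ (-(s + 1))) := by
    refine setIntegral_congr_fun measurableSet_Ioi fun t ht => ?_
    have ht0 : Yh < t := lt_trans one_pos ht
    have htc : (t : CC) ≠ 0 := by exact_mod_cast ht0.ne'
    have h1 : (t : CC) ^ (-s) = t * (t : CC) ^ (-(s + 1)) := by
      rw [neg_add, Complex.cpow_add _ _ htc, Complex.cpow_neg_one]; field_simp
    have h2 : ((⌊t⌋₊ : RR)) = t - Int.fract t := by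
      rw [Int.self_sub_fract, natCast_floor_eq_intCast_floor ht0.le]
    have h3 : ((⌊t⌋₊ : NN) : CC) = t - 1 / 2 - (bz 1 t : CC) := by
      rw [bz, bernoulliFun_one]; push_cast
      have := congrArg (fun x : RR => (x : CC)) h2
      push_cast at this; rw [this]; ring
    simp only [Pi.one_apply, Finset.sum_const, Nat.card_Icc, add_tsub_cancel_right, nsmul_eq_mul, mul_one]
    rw [h3, h1]; ring
  have i1 : IntegrableOn (fun t : RR => (t : CC) ^ (-s)) (Ioi 1) :=
    integrableOn_Ioi_cpow_of_lt (by simpa using hs) one_pos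
  have i2 : IntegrableOn (fun t : RR => 1 / 2 * (t : CC) ^ (-(s + 1))) (Ioi 1) :=
    (integrableOn_Ioi_cpow_of_lt (by simp; linarith) one_pos).const_mul _
  have i3 := bz_cpow_integrableOn 1 (s + 1) (by simp; linarith) 1 one_pos
  have i4 : IntegrableOn (fun t : RR => (t : CC) ^ (-s) - 1 / 2 * (t : CC) ^ (-(s + 1))) (Ioi 1) := i1.sub i2
  rw [h, e, integral_sub i4 i3, integral_sub i1 i2, integral_const_mul,
    integral_Ioi_cpow_of_lt (by simpa using hs) one_pos,
    integral_Ioi_cpow_of_lt (by simp; linarith) one_pos, Gz]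
  have hs2 : -s + 1 ≠ 0 := by intro h; apply hs1; linear_combination -h
  simp only [Complex.ofReal_one, Complex.one_cpow, Nat.cast_one]
  rw [show -(s + 1) + 1 = -s by ring, show -s + 1 = -(s - 1) by ring]
  field_simp
  ring
lemma zeta_poly (j : NN) : ∃ p : Polynomial CC, p.natDegree <= j ∧ ∀ s : CC, 1 < s.re →
    riemannZeta s = 1 / (s - 1) + p.eval s - (ascPochhammer CC Ym).eval s / (j + 1).factorial * Gz Ym s := by
  induction j with
  | zero =>
    refine ⟨Polynomial.C (1 / 2), by simp, fun s hs => ?_⟩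
    rw [zeta_one s hs]; simp
  | succ j ih =>
    obtain ⟨p, hp, h⟩ := ih
    refine ⟨p + Polynomial.C ((bz (j + 2) 1 : CC) / ((j + 2) * (j + 1).factorial)) * ascPochhammer CC Ym,
      ?_, fun s hs => ?_⟩
    · refine (Polynomial.natDegree_add_le _ _).trans (max_le Wg ?_)
      refine (Polynomial.natDegree_C_mul_le _ _).trans ?_
      rw [ascPochhammer_natDegree]
    · rw [h s hs, Gz_rec Ym Wg s (by push_cast; linarith), ascPochhammer_succ_eval Ym,
        Nat.factorial_succ Ym]
      have h1 : ((j + 1).factorial : CC) ≠ 0 := by exact_mod_cast Nat.factorial_ne_zero _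
      have h2 : (j : CC) + 2 ≠ 0 := by exact_mod_cast (by omega : j + 2 ≠ 0)
      have h3 : (j : CC) + 1 + 1 ≠ 0 := by exact_mod_cast (by omega : j + 1 + 1 ≠ 0)
      simp only [Polynomial.eval_add, Polynomial.eval_mul, Polynomial.eval_C]
      push_cast
      rw [show (j:CC) + 1 + 1 = j + 2 by ring]
      field_simp
      ring
end PartZ2
section PartZ3
open Set MeasureTheory Filter Topology
lemma Gz_eq_mellin (j : NN) (s : CC) :
    Gz j s = mellin (indicator (Ioi 1) fun x => (bz j x : CC)) (1 - s - j) := by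
  rw [Gz, mellin]
  have : ∀ t : RR, (t : CC) ^ (1 - s - j - 1) • indicator (Ioi 1) (fun x => (bz j x : CC)) t =
      indicator (Ioi 1) (fun t : RR => (bz j t : CC) * (t : CC) ^ (-Vb)) t := fun t => by
    by_cases h : t ∈ Ioi Yr
    · rw [indicator_of_mem h, indicator_of_mem h, zee, mul_comm]; congr 2; ring
    · rw [indicator_of_notMem h, indicator_of_notMem h, smul_zero]
  simp only [this]
  rw [setIntegral_indicator measurableSet_Ioi]
  congr 2
  ext x; constructor
  · intro h; exact ⟨lt_trans one_pos (mem_Ioi.1 h), h⟩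
  · intro h; exact h.2
lemma Gz_diff (j : NN) (s : CC) (hs : 1 < s.re + j) : DifferentiableAt CC (Gz j) s := by
  obtain ⟨C, hC0, hC⟩ := bz_bdd j
  have hb : ∀ x, ‖indicator (Ioi 1) (fun x => (bz j x : CC)) x‖ <= C := fun x => by
    refine (norm_indicator_le_norm_self _ _).trans ?_
    simpa using hC x
  have hm := (bzc_meas j).indicator (measurableSet_Ioi (a := Yr))
  have h : DifferentiableAt CC (mellin (indicator (Ioi 1) fun x => (bz j x : CC))) (1 - s - j) := by
    refine mellin_differentiableAt_of_isBigO_rpow (a := 0) (b := (1 - s - j).re - 1) ?_ ?_ ?_ ?_ Wk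
    · refine LocallyIntegrable.locallyIntegrableOn ?_ _
      refine (locallyIntegrable_const C).mono hm.aestronglyMeasurable (ae_of_all _ fun x => ?_)
      rw [zbf hC0.le]; exact hb x
    · refine Asymptotics.IsBigO.of_bound C (Eventually.of_forall fun x => ?_)
      simpa using hb x
    · simp; linarith
    · refine Asymptotics.IsBigO.of_bound 1 ?_
      filter_upwards [Ioo_mem_nhdsGT (one_pos : Yh < 1)] with x hx
      rw [indicator_of_notMem (by simpa using hx.2.le), norm_zero]; positivity
  have e : Gz j = (mellin (indicator (Ioi 1) fun x => (bz j x : CC))) ∘ fun s : CC => 1 - s - j := by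
    ext s; exact Gz_eq_mellin j s
  rw [e]
  exact h.comp s Yj
lemma zeta_ext (k : NN) : ∃ p : Polynomial CC, p.natDegree <= k ∧ ∀ s : CC, s.im ≠ 0 -> -1 - (k:RR) < s.re →
    riemannZeta s = 1 / (s - 1) + p.eval s - (ascPochhammer CC Wt).eval s / (k + 1).factorial *
      (-(bz Wp 1 : CC) / Wp + (s + Wt) / Wp * Gz Wp s) := by
  obtain ⟨p, hp, h⟩ := zeta_poly k
  refine ⟨p, hp, fun s hi hs => ?_⟩
  set F : CC -> CC := fun s => 1 / (s - 1) + p.eval s - (ascPochhammer CC Wt).eval s / (k + 1).factorial *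
      (-(bz Wp 1 : CC) / Wp + (s + Wt) / Wp * Gz Wp s) with hF
  have h1 : ∀ s : CC, 1 < s.re -> riemannZeta s = F s := fun s hs => by
    rw [h s hs, Gz_rec Wt Wg s (by push_cast; linarith), hF]
    push_cast; simp only [add_assoc]; norm_num
  have key : ∀ σ : RR, σ ≠ 0 -> 0 < σ * s.im -> riemannZeta s = F s := fun σ hσ hσs => by
    set U : Set CC := {z | -1 - (k:RR) < z.re} ∩ {z | 0 < σ * z.im} with hU
    have hUo : IsOpen U := (isOpen_lt Yj Yj).inter (isOpen_lt Yj Yj)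
    have hUc : IsPreconnected U := by
      apply Convex.isPreconnected
      apply Convex.inter
      · exact convex_halfSpace_re_gt _
      · intro a ha b hb t w ht hw htw
        simp only [mem_setOf_eq, Complex.add_im, Complex.real_smul, Complex.mul_im, Complex.ofReal_re, Complex.ofReal_im, zero_mul, add_zero] at *
        have : σ * (t * a.im + w * b.im) = t * (σ * a.im) + w * (σ * b.im) := by ring
        rw [this]
        rcases ht.eq_or_lt with h0 | h0
        · have : w = 1 := by linarith
          rw [<- h0, this]; linarith
        · have := mul_pos h0 ha; have := mul_nonneg hw hb.le; linarith
    have hne : ∀ z ∈ U, z ≠ 1 := by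
      rintro z ⟨_, hz⟩ rfl; simp at hz
    have a1 : AnalyticOnNhd CC riemannZeta U := by
      refine DifferentiableOn.analyticOnNhd (fun z hz => ?_) hUo
      exact (differentiableAt_riemannZeta (hne z hz)).differentiableWithinAt
    have a2 : AnalyticOnNhd CC F U := by
      refine DifferentiableOn.analyticOnNhd (fun z hz => ?_) hUo
      have hg := Gz_diff Wp z (by push_cast; linarith [hz.1.out])
      have hz1 : z - 1 ≠ 0 := sub_ne_zero.2 (hne z hz)
      have q1 : DifferentiableAt CC (fun s => p.eval s) z := p.differentiableAt
      have q2 : DifferentiableAt CC (fun s => (ascPochhammer CC Wt).eval s) z := Polynomial.differentiableAt _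
      refine DifferentiableAt.differentiableWithinAt ?_
      rw [hF]
      fun_prop (disch := assumption)
    have hz0 : (⟨2, σ⟩ : CC) ∈ U := ⟨by simp; linarith [(Nat.cast_nonneg k : Yh <= k)], by simpa using mul_self_pos.2 hσ⟩
    refine a1.eqOn_of_preconnected_of_eventuallyEq a2 hUc hz0 ?_ ⟨hs, hσs⟩
    have : {z : CC | 1 < z.re} ∈ 𝓝 (⟨2, σ⟩ : CC) := (isOpen_lt Yj Yj).mem_nhds (by simp)
    filter_upwards [this] with z hz using h1 z hz
  exact key s.im hi (mul_self_pos.2 hi)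
lemma zeta_final (k : NN) : ∃ p : Polynomial CC, p.natDegree <= k ∧ ∃ C : RR, 0 <= C ∧ ∀ s : CC, s.im ≠ 0 -> s.re = -k →
    ∀ Y : RR, 1 <= Y -> ‖riemannZeta s - (1 / (s - 1) + p.eval s - (ascPochhammer CC Wt).eval s / (k + 1).factorial *
      ∫ x in Yr..Y, (bz Wt x : CC) * (x : CC) ^ (-(s + Vc)))‖ ≤
        ‖(ascPochhammer CC Wt).eval s‖ * (C * (1 + ‖s + Wt‖)) / Y := by
  obtain ⟨p, hp, h⟩ := zeta_ext k
  obtain ⟨C, hC0, hC⟩ := bz_bdd Wp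
  refine ⟨p, hp, C, hC0.le, fun s hi hr Y hY => ?_⟩
  have hY0 : 0 < Y := by linarith
  rw [h s hi (by rw [hr]; linarith), bz_ibp Wt Wg s Y hY]
  have hint := bz_cpow_integrableOn Wp (s + (k + 2 : NN)) (by simp [hr]) 1 one_pos
  have hsplit : Gz Wp s = (∫ x in Yr..Y, (bz Wp x : CC) * (x : CC) ^ Wv) +
      ∫ x in Ioi Y, (bz Wp x : CC) * (x : CC) ^ Wv := by
    rw [Gz, intervalIntegral.integral_of_le hY, <- setIntegral_union (Ioc_disjoint_Ioi le_rfl) measurableSet_Ioi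
      (hint.mono_set Ioc_subset_Ioi_self) (hint.mono_set (Ioi_subset_Ioi hY)), Ioc_union_Ioi_eq_Ioi hY]
  have htail : ‖∫ x in Ioi Y, (bz Wp x : CC) * (x : CC) ^ Wv‖ <= C / Y := by
    have hh : ∀ x ∈ Ioi Y, ‖(bz Wp x : CC) * (x : CC) ^ Wv‖ <= C * x ^ (-2 : RR) := fun x hx => by
      have hx0 : 0 < x := hY0.trans hx
      rw [norm_mul, Complex.norm_cpow_eq_rpow_re_of_pos hx0, show (-(s + ((k + 2 : NN):CC))).re = -2 by simp [hr]]
      exact zab (by simpa using hC x) Ye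
    have i2 : IntegrableOn (fun x : RR => C * x ^ (-2 : RR)) (Ioi Y) :=
      (integrableOn_Ioi_rpow_of_lt Yn hY0).const_mul _
    refine (norm_integral_le_of_norm_le i2 ((ae_restrict_mem measurableSet_Ioi).mono hh)).trans ?_
    rw [integral_const_mul, integral_Ioi_rpow_of_lt Yn hY0]
    norm_num
    rw [Real.rpow_neg_one, div_eq_mul_inv]
  have hb : ‖(bz Wp Y : CC) * (Y : CC) ^ (-(s + Vc))‖ <= C / Y := by
    rw [norm_mul, Complex.norm_cpow_eq_rpow_re_of_pos hY0, show (-(s + (Vc:CC))).re = -1 by simp [hr],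
      Real.rpow_neg_one, div_eq_mul_inv]
    exact zab (by simpa using hC Y) Ye
  rw [hsplit]
  set T := ∫ x in Ioi Y, (bz Wp x : CC) * (x : CC) ^ Wv
  set B := (bz Wp Y : CC) * (Y : CC) ^ (-(s + Vc)) with hB
  set J := ∫ x in Yr..Y, (bz Wp x : CC) * (x : CC) ^ Wv with hJ
  set P := (ascPochhammer CC Wt).eval s
  have hk2 : ((k:CC) + 2) ≠ 0 := by exact_mod_cast (by omega : k + 2 ≠ 0)
  have hf : ((k + 1).factorial : CC) ≠ 0 := by exact_mod_cast Nat.factorial_ne_zero _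
  have e : 1 / (s - 1) + p.eval s - P / (k + 1).factorial * (-(bz Wp 1 : CC) / Wp + (s + Wt) / Wp * (J + T))
      - (1 / (s - 1) + p.eval s - P / (k + 1).factorial * ((B - (bz (k + 1 + 1) 1 : CC)) / (Vc + 1) + (s + Vc) / (Vc + 1) * J))
      = P / (k + 1).factorial * ((B - (s + Wt) * T) / Wp) := by
    push_cast
    rw [show (k:CC) + 1 + 1 = k + 2 by ring]
    field_simp
    ring
  change ‖_ - (1 / (s - 1) + p.eval s - P / (k + 1).factorial * ((B - (bz (k + 1 + 1) 1 : CC)) / (Vc + 1) + (s + Vc) / (Vc + 1) * J))‖ <= _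
  rw [e, norm_mul, norm_div, norm_div, mul_div_assoc]
  have f1 : Yr <= ‖((k + 1).factorial : CC)‖ := by
    rw [Complex.norm_natCast]; exact_mod_cast Nat.factorial_pos _
  have f2 : Yr <= ‖(k:CC) + 2‖ := by
    rw [show (k:CC) + 2 = ((k + 2 : NN) : CC) by push_cast; ring, Complex.norm_natCast]; exact_mod_cast Wg
  refine mul_le_mul (div_le_self (norm_nonneg _) f1) ((div_le_self (norm_nonneg _) f2).trans ?_) Ye (norm_nonneg _)
  refine (norm_sub_le _ _).trans ?_
  calc _ <= C / Y + ‖s + Wt‖ * (C / Y) := by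
        refine zec hb ?_
        rw [norm_mul]
        exact zaa htail (norm_nonneg _)
    _ = _ := by ring
end PartZ3
section PartK1
open Set MeasureTheory Filter Topology Real
lemma smv (a b : RR) (hab : a <= b) (φ : RR -> CC) (w w' : RR -> RR) (B : RR) (hφ : Continuous φ)
    (hw : ∀ x ∈ Icc a b, HasDerivAt w (w' x) x) (hwc : ContinuousOn w' (Icc a b))
    (hneg : ∀ x ∈ Icc a b, w' x <= 0) (hwb : 0 <= w b) (hB : ∀ x ∈ Icc a b, ‖∫ t in a..x, φ t‖ <= B) :
    ‖∫ x in a..b, (w x : CC) * φ x‖ <= B * w a := by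
  have hu : uIcc a b = Icc a b := uIcc_of_le hab
  have hwi : IntervalIntegrable w' volume a b := ContinuousOn.intervalIntegrable (by rwa [hu])
  have hwi' : IntervalIntegrable (fun x => (w' x : CC)) volume a b :=
    ContinuousOn.intervalIntegrable (by rw [hu]; exact Complex.continuous_ofReal.comp_continuousOn hwc)
  have key := intervalIntegral.integral_mul_deriv_eq_deriv_mul (a := a) (b := b)
    (u := fun x => (w x : CC)) (v := fun x => ∫ t in a..x, φ t) (u' := fun x => (w' x : CC)) (v' := φ)
    (fun x hx => (hw x (hu ▸ hx)).ofReal_comp)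
    (fun x _ => intervalIntegral.integral_hasDerivAt_right (hφ.intervalIntegrable _ _)
      (hφ.stronglyMeasurableAtFilter _ _) hφ.continuousAt)
    hwi' (hφ.intervalIntegrable _ _)
  rw [key]
  have hi : ∫ x in a..b, w' x = w b - w a :=
    zdb (fun x hx => hw x (hu ▸ hx)) hwi
  have h2 : ‖∫ x in a..b, (w' x : CC) * ∫ t in a..x, φ t‖ <= B * (w a - w b) := by
    calc _ <= ∫ x in a..b, (-B) * w' x := by
          refine zag hab (ae_of_all _ fun x hx => ?_) (hwi.const_mul _)
          have hx' : x ∈ Icc a b := ⟨hx.1.le, hx.2⟩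
          rw [norm_mul, zbd, Real.norm_of_nonpos (hneg x hx')]
          have := zaa (hB x hx') (neg_nonneg.2 (hneg x hx'))
          linarith
      _ = _ := by rw [zad, hi]; ring
  have h1 : ‖(w b : CC) * ∫ t in a..b, φ t‖ <= w b * B := by
    rw [norm_mul, zbd, zbf hwb]
    exact zaa (hB b ⟨hab, le_rfl⟩) hwb
  simp only [intervalIntegral.integral_same, mul_zero, sub_zero]
  refine (norm_sub_le _ _).trans ?_
  linarith
lemma sin_lb (y : RR) (h0 : 0 <= y) (h1 : y <= 1 / 2) : 2 * y <= sin Wl := by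
  have := mul_le_sin (x := π * y) Ye (by nlinarith [pi_pos])
  have e : 2 / π * Wl = 2 * y := by field_simp
  linarith
/-- weight lemma for `1/sin (π y)` -/
lemma smv_sin (a b : RR) (ha : 0 < a) (hab : a <= b) (hb : b <= 1 / 2) (φ : RR -> CC) (B : RR) (hφ : Continuous φ)
    (hB : ∀ x ∈ Icc a b, ‖∫ t in a..x, φ t‖ <= B) :
    ‖∫ x in a..b, ((1 / sin (π * x) : RR) : CC) * φ x‖ <= B / (2 * a) := by
  have hs : ∀ x ∈ Icc a b, 0 < sin (π * x) := fun x hx => by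
    have := sin_lb x (by linarith [hx.1]) (by linarith [hx.2]); linarith [hx.1]
  have hB0 : 0 <= B := by have := hB a ⟨le_rfl, hab⟩; simpa using this
  refine (smv a b hab φ (fun x => 1 / sin (π * x)) (fun x => -(cos (π * x) * π) / sin (π * x) ^ 2) B hφ ?_ ?_ ?_ ?_ hB).trans ?_
  · intro x hx
    have := (((zed x).const_mul π).sin).inv (hs x hx).ne'
    have h2 : HasDerivAt (fun x => 1 / sin (π * x)) (-(cos (π * id x) * (π * 1)) / sin (π * id x) ^ 2) x := by
      simp only [one_div]; exact this
    simpa using h2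
  · refine ContinuousOn.div Yj Yj fun x hx => (pow_pos (hs x hx) 2).ne'
  · intro x hx
    have : 0 <= cos (π * x) := cos_nonneg_of_neg_pi_div_two_le_of_le
      (by nlinarith [pi_pos, hx.1]) (by nlinarith [pi_pos, hx.2])
    refine div_nonpos_of_nonpos_of_nonneg ?_ (sq_nonneg _)
    have := mul_nonneg this pi_pos.le; linarith
  · have := hs b ⟨hab, le_rfl⟩; positivity
  · rw [div_eq_mul_one_div B]
    refine zaa (one_div_le_one_div_of_le Ye (sin_lb a ha.le Wk)) hB0
lemma int_sin_bound (b a x : RR) (hb : 0 < b) : ‖∫ t in a..x, ((sin (b * t) : RR) : CC)‖ <= 2 / b := by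
  rw [zdc, zbd]
  rw [intervalIntegral.integral_comp_mul_left (fun t => sin t) hb.ne', integral_sin, zee, norm_mul, norm_inv,
    zbf hb.le, div_eq_mul_inv, mul_comm]
  refine zab ?_ Ye
  rw [zac, abs_le]
  constructor <;> linarith [neg_one_le_cos (b * a), cos_le_one (b * a), neg_one_le_cos (b * x), cos_le_one (b * x)]
lemma sq_int (b y : RR) (h0 : 0 < y) (h1 : y <= 1 / 2) : ‖sin (b * y) / sin Wl‖ <= |b| / 2 := by
  have := sin_lb y h0.le h1
  rw [norm_div, zac, zbf Wk]
  rw [zae Wk]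
  have h2 := abs_sin_le_abs (x := b * y)
  rw [abs_mul, zea h0] at h2
  nlinarith [abs_nonneg b]
lemma sq_ii (b x y : RR) (hx : x ∈ Icc Yh Yf) (hy : y ∈ Icc Yh Yf) :
    IntervalIntegrable (fun y => sin (b * y) / sin Wl) volume x y := by
  refine (intervalIntegrable_const (c := |b| / 2)).mono_fun' ?_ ?_
  · exact (by fun_prop : Measurable fun y => sin (b * y) / sin Wl).aestronglyMeasurable
  · refine (ae_restrict_mem measurableSet_uIoc).mono fun t ht => ?_
    exact sq_int b t (lt_of_le_of_lt (le_min hx.1 hy.1) ht.1) (ht.2.trans (max_le hx.2 hy.2))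
lemma int_sin_div (b c d : RR) (hb : 0 < b) (hc : 0 < c) (hcd : c <= d) (hd : d <= 1 / 2) :
    |∫ y in c..d, sin (b * y) / sin Wl| <= 1 / (b * c) := by
  have := smv_sin c d hc hcd hd (fun t => ((sin (b * t) : RR) : CC)) (2 / b) Yj
    (fun x _ => int_sin_bound b c x hb)
  have e : ∫ x in c..d, ((1 / sin (π * x) : RR) : CC) * ((sin (b * x) : RR) : CC) =
      ((∫ y in c..d, sin (b * y) / sin Wl : RR) : CC) := by
    rw [<- zdc]
    congr 1; ext x; push_cast; ring
  rw [e, zbd, zac] at this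
  refine this.trans (le_of_eq ?_)
  field_simp
lemma Si_bound (b δ : RR) (h0 : 0 <= δ) (h1 : δ <= 1 / 2) : |∫ y in Yh..δ, sin (b * y) / sin Wl| <= 2 := by
  wlog hb : 0 <= b generalizing b
  · have := this (-b) Wk
    simpa [neg_mul, sin_neg, neg_div, intervalIntegral.integral_neg] using this
  rcases h0.eq_or_lt with rfl | h0
  · simp
  have small : ∀ c, 0 <= c -> c <= δ -> b * c <= 1 -> |∫ y in Yh..c, sin (b * y) / sin Wl| <= 1 := fun c hc hcδ hbc => by
    have := zbh (a := 0) (b := c) (C := |b| / 2)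
      (f := fun y => sin (b * y) / sin Wl) (fun y hy => by
        rw [uIoc_of_le hc] at hy
        exact sq_int b y hy.1 (by linarith [hy.2]))
    rw [zac] at this
    rw [zbc hb, sub_zero, zbc hc] at this
    linarith
  rcases le_or_gt (b * δ) 1 with h | h
  · linarith [small δ h0.le le_rfl h]
  · have hb0 : 0 < b := by by_contra hh; push Not at hh; nlinarith
    have hc : 1 / b <= δ := by rw [zae hb0]; linarith
    have hc0 : 0 < 1 / b := by positivity
    rw [<- zcb
      (sq_ii b 0 (1 / b) ⟨le_rfl, by norm_num⟩ ⟨hc0.le, by linarith⟩) (sq_ii b (1 / b) δ ⟨hc0.le, by linarith⟩ ⟨h0.le, h1⟩)]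
    have e1 := small (1 / b) hc0.le hc (by rw [mul_one_div_cancel hb0.ne'])
    have e2 := int_sin_div b (1 / b) δ hb0 hc0 hc h1
    rw [mul_one_div_cancel hb0.ne', div_one] at e2
    exact (abs_add_le _ _).trans Wk
noncomputable def Dk (N : NN) (y : RR) : RR := 1 + 2 * ∑ n ∈ Finset.range N, cos (2 * π * (n + 1) * y)
noncomputable def Dd (N : NN) (y : RR) : RR := 2 * ∑ n ∈ Finset.range N, -(2 * π * (n + 1) * sin (2 * π * (n + 1) * y))
noncomputable def wk (N : NN) (y : RR) : RR := 1 / (|y| + 1 / N)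
lemma Dk_cont (N : NN) : Continuous (Dk N) := by unfold Dk; fun_prop
lemma Dd_cont (N : NN) : Continuous (Dd N) := by unfold Dd; fun_prop
lemma Dk_even (N : NN) (y : RR) : Dk N (-y) = Dk N y := by simp [Dk]
lemma Dk_deriv (N : NN) (y : RR) : HasDerivAt (Dk N) (Dd N y) y := by
  unfold Dk Dd
  refine HasDerivAt.const_add _ (HasDerivAt.const_mul _ (HasDerivAt.fun_sum fun n _ => ?_))
  have := ((zed y).const_mul (2 * π * (n + 1))).cos
  refine this.congr_deriv ?_
  simp; ring
lemma Dk_sin (N : NN) (y : RR) : sin Wl * Dk N y = sin (Wd * π * y) := by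
  induction N with
  | zero => simp [Dk]
  | succ N ih =>
    have : Dk (N + 1) y = Dk N y + 2 * cos (2 * π * (N + 1) * y) := by
      simp only [Dk, Finset.sum_range_succ]; ring
    rw [this, mul_add, ih]
    have e1 : (2 * ((N + 1 : NN) : RR) + 1) * π * y = 2 * π * (N + 1) * y + π * y := by push_cast; ring
    have e2 : (2 * (N : RR) + 1) * π * y = 2 * π * (N + 1) * y - π * y := by ring
    rw [e1, e2, sin_add, sin_sub]; ring
lemma Dk_abs (N : NN) (y : RR) : |Dk N y| <= 2 * N + 1 := by
  have : |∑ n ∈ Finset.range N, cos (2 * π * (n + 1) * y)| <= N := by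
    refine (zbg _ _).trans ?_
    refine (zcd _ _ 1 fun n _ => abs_cos_le_one _).trans ?_
    simp
  rw [abs_le] at *
  constructor <;> simp only [Dk] <;> linarith [this.1, this.2]
lemma Dd_abs (N : NN) (y : RR) : |Dd N y| <= 4 * π * N ^ 2 := by
  have : |∑ n ∈ Finset.range N, -(2 * π * (n + 1) * sin (2 * π * (n + 1) * y))| <= N * (2 * π * N) := by
    refine (zbg _ _).trans ?_
    refine (zcd _ _ (2 * π * N) fun n hn => ?_).trans ?_
    · have hn' : Ws + 1 <= N := by exact_mod_cast zbb.1 hn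
      rw [abs_neg, abs_mul, zbc Ye]
      calc _ <= 2 * π * (n + 1) * 1 := by gcongr; exact abs_sin_le_one _
        _ <= _ := by rw [mul_one]; gcongr
    · simp
  rw [Dd, abs_mul, abs_two]
  nlinarith
lemma abs_sin_lb (y : RR) (h : |y| <= 1 / 2) : 2 * |y| <= |sin Wl| := by
  rcases le_total 0 y with h0 | h0
  · rw [zbc h0] at *; exact (sin_lb y h0 h).trans (le_abs_self _)
  · rw [abs_of_nonpos h0] at *
    have := sin_lb (-y) Wk h
    rw [mul_neg π, sin_neg] at this
    exact this.trans (neg_le_abs _)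
lemma wk_pos (N : NN) (hN : 1 <= N) (y : RR) : 0 < wk N y := by
  have : Yh < N := by exact_mod_cast hN
  unfold wk; positivity
lemma le_wk (N : NN) (hN : 1 <= N) (y f a b : RR) (h1 : |f| * |y| <= a) (h2 : |f| <= b * N) : |f| <= (a + b) * wk N y := by
  have hN0 : Yh < N := by exact_mod_cast hN
  rw [wk, mul_one_div, le_div_iff₀ Ye, mul_add]
  refine zec h1 ?_
  rw [mul_one_div, zae hN0]; exact h2
lemma Dk_le (N : NN) (hN : 1 <= N) (y : RR) (h : |y| <= 1 / 2) : |Dk N y| <= 4 * wk N y := by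
  have hN0 : Yr <= N := by exact_mod_cast hN
  have e := congrArg abs (Dk_sin N y)
  rw [abs_mul] at e
  have := abs_sin_le_one (Wd * π * y)
  have hl := zab (abs_sin_lb y h) (abs_nonneg (Dk N y))
  refine (le_wk N hN y (Dk N y) Yf 3 Wk ((Dk_abs N y).trans Wk)).trans ?_
  exact zab Yn (wk_pos N hN y).le
lemma Dd_le (N : NN) (hN : 1 <= N) (y : RR) (h : |y| <= 1 / 2) : |Dd N y| <= 30 * N * wk N y := by
  have hN0 : Yr <= N := by exact_mod_cast hN
  have d1 : HasDerivAt (fun y => sin Wl * Dk N y) (π * cos Wl * Dk N y + sin Wl * Dd N y) y := by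
    have := (((zed y).const_mul π).sin).mul (Dk_deriv N y)
    refine this.congr_deriv ?_; simp only [id]; ring
  have d2 : HasDerivAt (fun y => sin Wl * Dk N y) (Wd * π * cos (Wd * π * y)) y := by
    have := (((zed y).const_mul (Wd * π)).sin)
    refine (this.congr_of_eventuallyEq (Eventually.of_forall fun y => Dk_sin N y)).congr_deriv ?_
    simp; ring
  have e := d1.unique d2
  have e' : sin Wl * Dd N y = Wd * π * cos (Wd * π * y) - π * cos Wl * Dk N y := by linarith
  have hb : |sin Wl| * |Dd N y| <= 2 * Wd * π := by
    rw [<- abs_mul, e']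
    refine (abs_sub _ _).trans ?_
    have a1 : |Wd * π * cos (Wd * π * y)| <= Wd * π := by
      rw [abs_mul, zbc Ye]
      exact mul_le_of_le_one_right Ye (abs_cos_le_one _)
    have a2 : |π * cos Wl * Dk N y| <= π * Wd := by
      rw [abs_mul, abs_mul, zea pi_pos]
      refine mul_le_mul (mul_le_of_le_one_right pi_pos.le (abs_cos_le_one _)) (Dk_abs N y) (abs_nonneg _) pi_pos.le
    linarith
  have hl := zab (abs_sin_lb y h) (abs_nonneg (Dd N y))
  have hp := pi_lt_d2
  refine (le_wk N hN y (Dd N y) (10 * N) (13 * N) ?_ ?_).trans ?_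
  · have : 2 * Wd * π <= 20 * (N:RR) := by nlinarith
    linarith
  · refine (Dd_abs N y).trans ?_
    nlinarith [sq_nonneg (N:RR)]
  · exact zab Wk (wk_pos N hN y).le
/-- `Pk N y = ∫_y^{1/2} D` -/
noncomputable def Pk (N : NN) (y : RR) : RR := ∫ t in y.. Yf, Dk N t
lemma Dk_int (N : NN) (x y : RR) (hx : 0 <= x) (hxy : x <= y) (hy : y <= 1 / 2) :
    ∫ t in x..y, Dk N t = ∫ t in x..y, sin ((Wd * π) * t) / sin (π * t) := by
  refine intervalIntegral.integral_congr_ae (ae_of_all _ fun t ht => ?_)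
  rw [uIoc_of_le hxy] at ht
  have := sin_lb t (by linarith [ht.1]) (by linarith [ht.2])
  rw [<- Dk_sin, mul_div_cancel_left₀]
  have h0 : 0 < t := by linarith [ht.1]
  exact (by linarith : 0 < sin (π * t)).ne'
lemma Pk_le (N : NN) (hN : 1 <= N) (y : RR) (h0 : 0 <= y) (h : y <= 1 / 2) : |Pk N y| <= 5 / N * wk N y := by
  have hN0 : Yr <= N := by exact_mod_cast hN
  have hle4 : |Pk N y| <= 4 := by
    have e : Pk N y = (∫ t in Yh.. Yf, Dk N t) - ∫ t in Yh..y, Dk N t := by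
      rw [Pk, <- zcb ((Dk_cont N).intervalIntegrable 0 y)
        ((Dk_cont N).intervalIntegrable y Yf)]; ring
    rw [e, Dk_int N 0 _ le_rfl Yn le_rfl, Dk_int N 0 y le_rfl h0 h]
    refine (abs_sub _ _).trans ?_
    linarith [Si_bound (Wd * π) Yf Yn le_rfl, Si_bound (Wd * π) y h0 h]
  have := le_wk N hN y (Pk N y) (1 / N) (4 / N) ?_ ?_
  · rwa [<- add_div, show Yr + 4 = 5 by norm_num] at this
  · rcases h0.eq_or_lt with rfl | h0
    · simp
    · rw [Pk, Dk_int N y _ h0.le h le_rfl, zea h0]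
      have := int_sin_div (Wd * π) y Yf Ye h0 h le_rfl
      refine (zab this h0.le).trans ?_
      rw [div_mul_eq_mul_div, one_mul, zce Ye Ye]
      have : (N:RR) <= Wd * π := by nlinarith [pi_gt_three]
      nlinarith
  · rw [div_mul_cancel₀ _ Ye]; exact hle4
lemma wk_int (N : NN) (hN : 2 <= N) : Ya wk N y <= log N := by
  have hN0 : (2:RR) <= N := by exact_mod_cast hN
  have e : Ya wk N y = Ya (y + 1 / N)⁻¹ := by
    refine zcf fun y hy => ?_
    rw [uIcc_of_le Yn] at hy
    simp only [wk, zbc hy.1, one_div]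
  rw [e, intervalIntegral.integral_comp_add_right (fun y => y⁻¹), integral_inv_of_pos Ye Ye]
  refine log_le_log Ye ?_
  rw [zero_add, div_div_eq_mul_div, div_one, add_mul, one_div_mul_cancel Ye]; linarith
lemma wk_cont (N : NN) (hN : 1 <= N) : Continuous (wk N) := by
  have : Yh < N := by exact_mod_cast hN
  unfold wk
  exact continuous_const.div Yj fun y => by positivity
lemma wk_int' (N : NN) (hN : 2 <= N) : ∫ y in Vg..0, wk N y <= log N := by
  have := wk_int N hN
  have e := intervalIntegral.integral_comp_neg (a := Yh) (b := 1/2) (fun y => wk N y)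
  rw [neg_zero] at e
  rw [<- e]
  simpa [wk] using this
end PartK1
section PartK2
open Set MeasureTheory Filter Topology Real
lemma bzc_deriv (j : NN) (X L y : RR) (hX : 0 < X) (hL : 0 < L) :
    HasDerivWithinAt (fun y => bz Ym Yd) (Ym * bz j Yd * (L * Yd)) (Ioi y) y := by
  have h1 : HasDerivAt (fun y => X * exp Yi) (L * Yd) y := by
    have := ((zed y).const_mul L).exp.const_mul X
    refine this.congr_deriv ?_; simp; ring
  refine (bz_deriv j _).comp y h1.hasDerivWithinAt fun z hz => ?_
  have hz : y < z := hz
  simp only [mem_Ioi]; gcongr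
lemma bzc_ii (j : NN) (X L a b : RR) : IntervalIntegrable (fun y => bz j Yd) volume a b := by
  obtain ⟨C, hC0, hC⟩ := bz_bdd j
  refine (intervalIntegrable_const (c := C)).mono_fun' ?_ (ae_of_all _ fun x => hC _)
  exact ((bz_meas j).comp Yj).aestronglyMeasurable
lemma ibp_bz {E : Type*} [NormedAddCommGroup E] [NormedSpace RR E] [CompleteSpace E] (j : NN) (hj : 1 <= j) (X L a b : RR) (hX : 0 < X) (hL : 0 < L)
    (V V' : RR -> E) (hV : ∀ y, HasDerivAt V (V' y) y) (hV' : Continuous V') :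
    ∫ y in a..b, bz Ym Yd • V' y = bz Ym (X * exp (L * b)) • V b - bz Ym (X * exp (L * a)) • V a
      - ∫ y in a..b, (Ym * bz j Yd * (L * Yd)) • V y := by
  have hVc : Continuous V := zcg.2 fun y => (hV y).continuousAt
  exact intervalIntegral.integral_smul_deriv_eq_deriv_smul_of_hasDeriv_right
    (((bz_cont Ym Wg).comp Yj).continuousOn) hVc.continuousOn
    (fun y _ => bzc_deriv j X L y hX hL) (fun y _ => (hV y).hasDerivWithinAt)
    (((bzc_ii j X L a b).const_mul _).mul_continuousOn Yj) (hV'.intervalIntegrable _ _)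
lemma tail_bd (j : NN) (hj : 1 <= j) (L : RR) (hL : 0 < L) : ∃ C : RR, 0 < C ∧ ∀ X a b : RR, 0 < X -> a <= b →
    ∀ W W' : RR -> CC, (∀ y, HasDerivAt W (W' y) y) -> Continuous W' →
    ‖∫ y in a..b, bz j Yd • W y‖ <= C / X * (exp (-(L * a)) * ‖W a‖ + exp (-(L * b)) * ‖W b‖ +
      ∫ y in a..b, exp (-Yi) * (‖W' y‖ + ‖W y‖)) := by
  obtain ⟨C, hC0, hC⟩ := bz_bdd Ym
  refine ⟨C * (1 + L) / L, by positivity, fun X a b hX hab W W' hW hW' => ?_⟩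
  have hWc : Continuous W := zcg.2 fun y => (hW y).continuousAt
  have hV : ∀ y, HasDerivAt (fun y => exp (-Yi) • W y) (exp (-Yi) • W' y + (-(L * exp (-Yi))) • W y) y := fun y => by
    have h1 : HasDerivAt (fun y => exp (-Yi)) (-(L * exp (-Yi))) y := by
      have := ((zed y).const_mul L).neg.exp
      refine this.congr_deriv ?_; simp; ring
    exact h1.smul (hW y)
  have key := ibp_bz j hj X L a b hX hL _ _ hV Yj
  have e : ∫ y in a..b, (Ym * bz j Yd * (L * Yd)) • (exp (-Yi) • W y)
      = (((j:RR) + 1) * L * X) • ∫ y in a..b, bz j Yd • W y := by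
    rw [<- intervalIntegral.integral_smul]
    congr 1; ext y
    rw [smul_smul, smul_smul]; congr 1
    rw [exp_neg]; field_simp
  rw [e] at key
  set I := ∫ y in a..b, bz j Yd • W y
  have hb : ‖∫ y in a..b, bz Ym Yd • (exp (-Yi) • W' y + (-(L * exp (-Yi))) • W y)‖ ≤
      C * (1 + L) * ∫ y in a..b, exp (-Yi) * (‖W' y‖ + ‖W y‖) := by
    rw [<- zad]
    refine zag hab (ae_of_all _ fun y _ => ?_)
      (zaf Yj _ _)
    rw [norm_smul, zac, mul_assoc]
    refine mul_le_mul (hC _) ?_ (norm_nonneg _) hC0.le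
    refine (zeb _ _).trans ?_
    rw [norm_smul, norm_smul, norm_neg, norm_mul, zbf hL.le, zbf (exp_pos _).le]
    have h1 := mul_nonneg (exp_pos (-Yi)).le (norm_nonneg (W' y))
    have h2 := mul_nonneg (exp_pos (-Yi)).le (norm_nonneg (W y))
    nlinarith
  have hB : ∀ c, ‖bz Ym (X * exp (L * c)) • (exp (-(L * c)) • W c)‖ <= C * (1 + L) * (exp (-(L * c)) * ‖W c‖) := fun c => by
    rw [norm_smul, norm_smul, zbf (exp_pos _).le, zac]
    refine zab ((hC _).trans ?_) Ye
    nlinarith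
  have e2 : (((j:RR) + 1) * L * X) • I = bz Ym (X * exp (L * b)) • (exp (-(L * b)) • W b) - bz Ym (X * exp (L * a)) • (exp (-(L * a)) • W a)
     - ∫ y in a..b, bz Ym Yd • (exp (-Yi) • W' y + (-(L * exp (-Yi))) • W y) := by
    rw [key]; abel
  have e3 : ((j:RR) + 1) * L * X * ‖I‖ <= C * (1 + L) * (exp (-(L * a)) * ‖W a‖ + exp (-(L * b)) * ‖W b‖ +
      ∫ y in a..b, exp (-Yi) * (‖W' y‖ + ‖W y‖)) := by
    have := congrArg norm e2
    rw [norm_smul, zbf Ye] at this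
    rw [this]
    refine ((norm_sub_le _ _).trans (zec (norm_sub_le _ _) le_rfl)).trans ?_
    linarith [hB a, hB b]
  have e4 : L * X * ‖I‖ <= ((j:RR) + 1) * L * X * ‖I‖ := by
    have : 0 <= (j:RR) * (L * X * ‖I‖) := by positivity
    linarith
  rw [div_div, div_mul_eq_mul_div, le_div_iff₀ Ye]
  linarith
/-- tail estimate -/
lemma tail_est (j : NN) (hj : 1 <= j) (L : RR) (hL : 0 < L) : ∃ C : RR, 0 < C ∧ ∀ N : NN, 2 <= N -> ∀ X : RR, 0 < X →
    |Yb bz j Yd * Dk N y| <= C * (N * log N / X) := by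
  obtain ⟨C, hC0, hC⟩ := tail_bd j hj L hL
  refine ⟨C * exp Yq * 100, by positivity, fun N hN X hX => ?_⟩
  have hN2 : (2:RR) <= N := by exact_mod_cast hN
  have hlog : 1 / 2 <= log N := by
    have := log_le_log Yn hN2
    linarith [log_two_gt_d9]
  have h := hC X (-Yf) Yf hX Yn (fun y => (Dk N y : CC)) (fun y => (Dd N y : CC))
    (fun y => (Dk_deriv N y).ofReal_comp) (by have := Dd_cont N; fun_prop)
  have e : Yb bz j Yd • (Dk N y : CC) =
      ((Yb bz j Yd * Dk N y : RR) : CC) := by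
    rw [<- zdc]
    congr 1; ext y; simp
  rw [e, zbd, zac] at h
  refine h.trans ?_
  have hw : ∀ y, |y| = 1 / 2 -> |Dk N y| <= 8 := fun y hy => by
    refine (Dk_le N Wg y hy.le).trans ?_
    rw [wk, hy]
    have hn : 0 <= 1 / (N:RR) := by positivity
    have : 1 / (1 / 2 + 1 / (N:RR)) <= 1 / (1 / 2) := one_div_le_one_div_of_le Yn Wk
    linarith
  have hexp : ∀ y, -Yf <= y -> exp (-Yi) <= exp Yq := fun y hy => exp_le_exp.2 (by nlinarith)
  set A := exp Yq with hA
  have hA0 : 0 < A := exp_pos _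
  have h1 : exp (-(L * -Yf)) * ‖(Dk N (-Yf) : CC)‖ <= A * 8 := by
    refine mul_le_mul (hexp _ le_rfl) ?_ (norm_nonneg _) hA0.le
    rw [zbd]; exact hw _ Yn
  have h2 : exp (-Yq) * ‖(Dk N Yf : CC)‖ <= A * 8 := by
    refine mul_le_mul (hexp _ Yn) ?_ (norm_nonneg _) hA0.le
    rw [zbd]; exact hw _ Yn
  have c1 := Dk_cont N
  have c2 := Dd_cont N
  have c3 := wk_cont N Wg
  have h3 : Yb exp (-Yi) * (‖(Dd N y : CC)‖ + ‖(Dk N y : CC)‖) <= A * (34 * N) * (2 * log N) := by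
    have s : Yb wk N y <= 2 * log N := by
      rw [<- zcb (c3.intervalIntegrable (-Yf) 0) (c3.intervalIntegrable 0 Yf)]
      linarith [wk_int N hN, wk_int' N hN]
    refine le_trans ?_ (zaa s (by positivity : 0 <= A * (34 * (N:RR))))
    rw [<- zad]
    refine intervalIntegral.integral_mono_on Yn (zaf Yj _ _)
      (zaf Yj _ _) fun y hy => ?_
    have hy' : |y| <= 1 / 2 := abs_le.2 ⟨by linarith [hy.1], hy.2⟩
    rw [zbd, zbd, zac, zac, mul_assoc]
    refine mul_le_mul (hexp y (by linarith [hy.1])) ?_ Ye hA0.le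
    have := Dk_le N Wg y hy'
    have := Dd_le N Wg y hy'
    have h4 := zab hN2 (wk_pos N Wg y).le
    have h5 := wk_pos N Wg y
    linarith
  have hN1 : 1 <= N * log N := by nlinarith
  calc _ <= C / X * (A * 8 + A * 8 + A * (34 * N) * (2 * log N)) := by
        refine zaa ?_ Ye
        linarith
    _ <= C / X * (A * 100 * (N * log N)) := by
        refine zaa ?_ Ye
        nlinarith
    _ = _ := by ring
lemma small_n (j : NN) (hj : 1 <= j) (L : RR) (hL : 0 < L) (n : ZZ) : ∃ C : RR, ∀ b : RR, 0 <= b →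
    ‖∫ y in Yh..b, Yz * Complex.exp (-(2 * π * Complex.I * n * y))‖ <= C := by
  obtain ⟨C, hC0, hC⟩ := tail_bd j hj L hL
  set c : CC := -(2 * π * Complex.I * n) with hc
  refine ⟨C / 1 * (1 + 1 + (‖c‖ + 1) * (1 / L)), fun b hb => ?_⟩
  have hd : ∀ y : RR, HasDerivAt (fun y : RR => Complex.exp (c * y)) (c * Complex.exp (c * y)) y := fun y => by
    have := (((zed (y:CC)).const_mul c).cexp).comp_ofReal
    refine this.congr_deriv ?_; simp; ring
  have h := hC 1 0 b one_pos hb _ _ hd Yj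
  have hn : ∀ y : RR, ‖Complex.exp (c * y)‖ = 1 := fun y => by
    rw [Complex.norm_exp]; simp [hc]
  have e : ∫ y in Yh..b, Yz * Complex.exp (-(2 * π * Complex.I * n * y)) =
      ∫ y in Yh..b, bz j (1 * exp Yi) • Complex.exp (c * y) := by
    congr 1; ext y; rw [one_mul, Complex.real_smul, hc]; congr 2; ring
  rw [e]
  refine h.trans (zaa ?_ Ye)
  simp only [hn, norm_mul, mul_one]
  rw [intervalIntegral.integral_mul_const]
  have h1 : exp (-(L * b)) <= 1 := exp_le_one_iff.2 (by nlinarith)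
  have h2 : ∫ y in Yh..b, exp (-Yi) <= 1 / L := by
    have : ∫ y in Yh..b, exp (-Yi) = (1 - exp (-(L * b))) / L := by
      have := intervalIntegral.integral_comp_mul_left (a := 0) (b := b) (fun y => exp y) (neg_ne_zero.2 hL.ne')
      simp only [neg_mul] at this
      rw [this, integral_exp]; simp; field_simp; ring
    rw [this]
    gcongr
    linarith [exp_pos (-(L * b))]
  have : 0 <= ‖c‖ + 1 := by positivity
  simp only [mul_zero, neg_zero, exp_zero]
  nlinarith
end PartK2
section PartK3
open Set MeasureTheory Filter Topology Real
lemma Dk_half (N : NN) : ∫ t in Yh.. Yf, Dk N t = 1 / 2 := by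
  unfold Dk
  rw [zda (by simp) (zaf Yj _ _),
    zad, zdd fun n _ => zaf Yj _ _]
  have : ∀ n ∈ Finset.range N, ∫ x in Yh.. Yf, cos (2 * π * (n + 1) * x) = 0 := fun n _ => by
    rw [intervalIntegral.integral_comp_mul_left (fun x => cos x) Ye, integral_cos]
    rw [show 2 * π * (Ws + 1) * (1 / 2) = ((n + 1 : NN) : RR) * π by push_cast; ring, sin_nat_mul_pi]; simp
  rw [Finset.sum_eq_zero this]; simp
lemma Pk_deriv (N : NN) (y : RR) : HasDerivAt (Pk N) (-Dk N y) y :=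
  intervalIntegral.integral_hasDerivAt_left ((Dk_cont N).intervalIntegrable _ _)
      ((Dk_cont N).stronglyMeasurableAtFilter _ _) (Dk_cont N).continuousAt
lemma Pk_cont (N : NN) : Continuous (Pk N) := zcg.2 fun y => (Pk_deriv N y).continuousAt
lemma one_right (N : NN) (hN : 2 <= N) (f f' : RR -> RR) (B : RR) (hf : Continuous f)
    (hd : ∀ y, HasDerivWithinAt f (f' y) (Ioi y) y) (hi : IntervalIntegrable f' volume 0 Yf)
    (hB : ∀ y ∈ Icc Yh Yf, |f' y| <= B) :
    |(Ya f y * Dk N y) - f 0 / 2| <= 5 * B / N * log N := by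
  have key := intervalIntegral.integral_mul_deriv_eq_deriv_mul_of_hasDeriv_right (a := 0) (b := 1/2)
    (u := f) (v := fun y => -Pk N y) (u' := f') (v' := Dk N)
    hf.continuousOn (Pk_cont N).neg.continuousOn (fun y _ => hd y)
    (fun y _ => ((Pk_deriv N y).fun_neg.congr_deriv (neg_neg _)).hasDerivWithinAt) hi ((Dk_cont N).intervalIntegrable _ _)
  have h1 : Pk N Yf = 0 := by simp [Pk]
  have h0 : Pk N 0 = 1 / 2 := Dk_half N
  rw [key, h1, h0]
  have e : f Yf * -0 - f 0 * -Yf - (∫ x in Yh.. Yf, f' x * -Pk N x) - f 0 / 2 = -∫ x in Yh.. Yf, f' x * -Pk N x := by ring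
  rw [e, abs_neg, <- zac]
  have hB0 : 0 <= B := (abs_nonneg _).trans (hB 0 ⟨le_rfl, by norm_num⟩)
  calc _ <= ∫ x in Yh.. Yf, (5 * B / N) * wk N x := by
        refine zag Yn (ae_of_all _ fun y hy => ?_)
          (((wk_cont N Wg).const_mul _).intervalIntegrable _ _)
        rw [norm_mul, norm_neg, zac, zac]
        refine (mul_le_mul (hB y ⟨hy.1.le, hy.2⟩) (Pk_le N Wg y hy.1.le hy.2) (abs_nonneg _) hB0).trans (le_of_eq ?_)
        ring
    _ <= _ := by
        rw [zad]
        exact zaa (wk_int N hN) Ye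
lemma one_left (N : NN) (hN : 2 <= N) (f f' : RR -> RR) (B : RR) (hf : Continuous f)
    (hd : ∀ y, HasDerivWithinAt f (f' y) (Ioi y) y) (hi : IntervalIntegrable f' volume (-Yf) 0)
    (hB : ∀ y ∈ Icc Vg 0, |f' y| <= B) :
    |(∫ y in Vg..0, f y * Dk N y) - f 0 / 2| <= 5 * B / N * log N := by
  have hdv : ∀ y, HasDerivAt (fun y => Pk N (-y)) (Dk N y) y := fun y => by
    have := (Pk_deriv N (-y)).comp y (hasDerivAt_neg y)
    refine this.congr_deriv ?_; rw [Dk_even]; ring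
  have key := intervalIntegral.integral_mul_deriv_eq_deriv_mul_of_hasDeriv_right (a := -Yf) (b := 0)
    (u := f) (v := fun y => Pk N (-y)) (u' := f') (v' := Dk N)
    hf.continuousOn ((Pk_cont N).comp continuous_neg).continuousOn (fun y _ => hd y)
    (fun y _ => (hdv y).hasDerivWithinAt) hi ((Dk_cont N).intervalIntegrable _ _)
  have h1 : Pk N Yf = 0 := by simp [Pk]
  have h0 : Pk N 0 = 1 / 2 := Dk_half N
  rw [key, neg_neg, neg_zero, h1, h0]
  have e : f 0 * Yf - f (-Yf) * 0 - (∫ x in Vg..0, f' x * Pk N (-x)) - f 0 / 2 = -∫ x in Vg..0, f' x * Pk N (-x) := by ring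
  rw [e, abs_neg, <- zac]
  have hB0 : 0 <= B := (abs_nonneg _).trans (hB 0 ⟨by norm_num, le_rfl⟩)
  calc _ <= ∫ x in Vg..0, (5 * B / N) * wk N x := by
        refine zag Yn (ae_of_all _ fun y hy => ?_)
          (((wk_cont N Wg).const_mul _).intervalIntegrable _ _)
        rw [norm_mul, zac, zac]
        refine (mul_le_mul (hB y ⟨hy.1.le, hy.2⟩) (Pk_le N Wg (-y) (by linarith [hy.2]) (by linarith [hy.1])) (abs_nonneg _) hB0).trans (le_of_eq ?_)
        rw [wk, wk, abs_neg]; ring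
    _ <= _ := by
        rw [zad]
        exact zaa (wk_int' N hN) Ye
lemma ind_int (N : NN) (s : RR -> RR) (c : RR) (h0 : 0 <= c) (h1 : c <= 1/2) (hs : ∀ y, c < y -> s y = 1) (hs' : ∀ y, y < c -> s y = 0) :
    IntervalIntegrable (fun y => s y * Dk N y) volume 0 Yf ∧ Ya s y * Dk N y = Pk N c := by
  have hae : ∀ᵐ y : RR, y ≠ c := Measure.ae_ne volume c
  have e1 : ∀ᵐ y : RR, y ∈ uIoc 0 c -> Yh = s y * Dk N y := by
    filter_upwards [hae] with y hy hyc
    rw [uIoc_of_le h0] at hyc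
    rw [hs' y (lt_of_le_of_ne hyc.2 hy), zero_mul]
  have e2 : ∀ᵐ y : RR, y ∈ uIoc c Yf -> Dk N y = s y * Dk N y := by
    refine ae_of_all _ fun y hyc => ?_
    rw [uIoc_of_le h1] at hyc
    rw [hs y hyc.1, one_mul]
  have i1 : IntervalIntegrable (fun y => s y * Dk N y) volume 0 c :=
    (intervalIntegrable_const (c := Yh)).congr_ae ((ae_restrict_iff' measurableSet_uIoc).2 e1)
  have i2 : IntervalIntegrable (fun y => s y * Dk N y) volume c Yf :=
    ((Dk_cont N).intervalIntegrable _ _).congr_ae ((ae_restrict_iff' measurableSet_uIoc).2 e2)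
  refine ⟨i1.trans i2, ?_⟩
  rw [<- zcb i1 i2, <- intervalIntegral.integral_congr_ae e1,
    <- intervalIntegral.integral_congr_ae e2]
  simp [Pk]
lemma floor_up (a : ZZ) (n : NN) (z : RR) (h1 : a <= ⌊z⌋) (h2 : ⌊z⌋ <= a + n) :
    (⌊z⌋ : RR) = a + ∑ i ∈ Finset.range n, if ((a + 1 + i : ZZ) : RR) <= z then Yr else 0 := by
  rw [Finset.sum_ite, Finset.sum_const_zero, add_zero, Finset.sum_const, nsmul_eq_mul, mul_one]
  have : (Finset.range n).filter (fun i : NN => ((a + 1 + i : ZZ) : RR) <= z) = Finset.range (⌊z⌋ - a).toNat := by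
    ext i
    simp only [Finset.mem_filter, zbb, <- Int.le_floor]
    omega
  rw [this, Finset.card_range]
  have h3 : (((⌊z⌋ - a).toNat : ZZ) : RR) = ((⌊z⌋ - a : ZZ) : RR) := by rw [Int.toNat_of_nonneg Wg]
  rw [Int.cast_natCast] at h3
  rw [h3]; push_cast; ring
lemma floor_down (b : ZZ) (n : NN) (z : RR) (h1 : ⌊z⌋ <= b) (h2 : b - n <= ⌊z⌋) :
    (⌊z⌋ : RR) = b - ∑ i ∈ Finset.range n, if z < ((b - i : ZZ) : RR) then Yr else 0 := by
  rw [Finset.sum_ite, Finset.sum_const_zero, add_zero, Finset.sum_const, nsmul_eq_mul, mul_one]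
  have : (Finset.range n).filter (fun i : NN => z < ((b - i : ZZ) : RR)) = Finset.range (b - ⌊z⌋).toNat := by
    ext i
    simp only [Finset.mem_filter, zbb, <- Int.floor_lt]
    omega
  rw [this, Finset.card_range]
  have h3 : (((b - ⌊z⌋).toNat : ZZ) : RR) = ((b - ⌊z⌋ : ZZ) : RR) := by rw [Int.toNat_of_nonneg Wg]
  rw [Int.cast_natCast] at h3
  rw [h3]; push_cast; ring
lemma ii_sum (n : NN) (f : NN -> RR -> RR) (a b : RR) (h : ∀ i ∈ Finset.range n, IntervalIntegrable (f i) volume a b) :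
    IntervalIntegrable (fun t => ∑ i ∈ Finset.range n, f i t) volume a b := by
  have := IntervalIntegrable.sum (Finset.range n) h
  rwa [Finset.sum_fn] at this
lemma floor_right (N : NN) (X L : RR) (hX : 0 < X) (hL : 0 < L) (n : NN) (hn : ⌊X * exp Yq⌋ = ⌊X⌋ + n) :
    ∃ y : NN -> RR, (∀ i < n, y i = log (Yp / X) / L ∧ 0 <= y i ∧ y i <= 1/2) ∧
    ∫ t in Yh.. Yf, (⌊X * exp Ve⌋ : RR) * Dk N t = ⌊X⌋ / 2 + ∑ i ∈ Finset.range n, Pk N (y i) := by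
  have hpos : ∀ i : NN, Yh < X ∧ X < Yp := fun i => by
    refine ⟨hX, ?_⟩
    have := Int.lt_floor_add_one X; push_cast; have : Yh <= i := by positivity
    linarith
  have hiff : ∀ (i : NN) (t : RR), Yp <= X * exp Ve ↔ log (Yp / X) / L <= t := fun i t => by
    have := (hpos i).2
    rw [zae hL, mul_comm t, log_le_iff_le_exp (by have := hX.trans this; positivity), zae hX, mul_comm X]
  refine ⟨fun i => log (Yp / X) / L, fun i hi => ⟨rfl, ?_, ?_⟩, ?_⟩
  · have := (hpos i).2
    refine div_nonneg (log_nonneg ?_) hL.le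
    rw [le_div_iff₀ hX]; linarith
  · rw [<- hiff, <- Int.le_floor, hn]; omega
  · have hi : ∀ i < n, _ := fun i hi => ind_int N (fun t => if Yp <= X * exp Ve then 1 else 0)
      (log (Yp / X) / L) (by
        have := (hpos i).2
        refine div_nonneg (log_nonneg ?_) hL.le
        rw [le_div_iff₀ hX]; linarith) (by rw [<- hiff, <- Int.le_floor, hn]; omega)
      (fun t ht => if_pos ((hiff i t).2 ht.le)) (fun t ht => if_neg (by rw [hiff]; linarith))
    have e : ∫ t in Yh.. Yf, (⌊X * exp Ve⌋ : RR) * Dk N t = ∫ t in Yh.. Yf, (⌊X⌋ * Dk N t +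
        ∑ i ∈ Finset.range n, (if Yp <= X * exp Ve then 1 else 0) * Dk N t) := by
      refine zcf fun t ht => ?_
      rw [uIcc_of_le Yn] at ht
      have f1 : ⌊X⌋ <= ⌊X * exp Ve⌋ := Int.floor_le_floor (le_mul_of_one_le_right hX.le (one_le_exp (by nlinarith [ht.1])))
      have f2 : ⌊X * exp Ve⌋ <= ⌊X⌋ + n := hn ▸ Int.floor_le_floor (by gcongr; exact ht.2)
      rw [<- Finset.sum_mul, <- add_mul, <- floor_up ⌊X⌋ n _ f1 f2]
    rw [e, zda (((Dk_cont N).intervalIntegrable _ _).const_mul _)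
      (ii_sum n _ _ _ fun i h => (hi i (zbb.1 h)).1),
      zad, Dk_half, zdd fun i h => (hi i (zbb.1 h)).1]
    congr 1
    · ring
    · exact zah rfl fun i h => (hi i (zbb.1 h)).2
lemma floor_left (N : NN) (X L : RR) (hX : 0 < X) (hL : 0 < L) (n : NN) (hn : ⌊X * exp (-Yq)⌋ = ⌊X⌋ - n) :
    ∃ y : NN -> RR, (∀ i < n, y i = log (X / Yk) / L ∧ 0 < Yk ∧ 0 <= y i ∧ y i <= 1/2) ∧
    ∫ t in Vg..0, (⌊X * exp Ve⌋ : RR) * Dk N t = ⌊X⌋ / 2 - ∑ i ∈ Finset.range n, Pk N (y i) := by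
  have hpos : ∀ i < n, 0 < Yk ∧ Yk <= X ∧ X * exp (-Yq) < Yk := fun i hi => by
    have h3 : X * exp (-Yq) < Yk := by rw [<- Int.floor_lt, hn]; omega
    refine ⟨lt_trans Ye h3, ?_, h3⟩
    have := Int.floor_le X; push_cast; have : Yh <= i := by positivity
    linarith
  have hiff : ∀ i < n, ∀ (t : RR), X * exp (-Ve) < Yk ↔ log (X / Yk) / L < t := fun i hi t => by
    have := (hpos i hi).1
    rw [div_lt_iff₀ hL, mul_comm t, log_lt_iff_lt_exp Ye, div_lt_iff₀ this, exp_neg, <- div_eq_mul_inv, div_lt_iff₀ (exp_pos _), mul_comm]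
  have hy : ∀ i < n, 0 <= log (X / Yk) / L ∧ log (X / Yk) / L <= 1/2 := fun i hi => by
    obtain ⟨h1, h2, h3⟩ := hpos i hi
    exact ⟨div_nonneg (log_nonneg (by rw [le_div_iff₀ h1]; linarith)) hL.le, ((hiff i hi _).1 h3).le⟩
  refine ⟨fun i => log (X / Yk) / L, fun i hi => ⟨rfl, (hpos i hi).1, hy i hi⟩, ?_⟩
  have hi : ∀ i < n, _ := fun i hi => ind_int N (fun t => if X * exp (-Ve) < Yk then 1 else 0)
      (log (X / Yk) / L) (hy i hi).1 (hy i hi).2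
      (fun t ht => if_pos ((hiff i hi t).2 ht)) (fun t ht => if_neg (by rw [hiff i hi]; linarith))
  have e0 := intervalIntegral.integral_comp_neg (a := Yh) (b := 1/2) (fun t => (⌊X * exp Ve⌋ : RR) * Dk N t)
  rw [neg_zero] at e0
  rw [<- e0]
  have e : ∫ t in Yh.. Yf, (⌊X * exp (L * -t)⌋ : RR) * Dk N (-t) = ∫ t in Yh.. Yf, (⌊X⌋ * Dk N t -
        ∑ i ∈ Finset.range n, (if X * exp (-Ve) < Yk then 1 else 0) * Dk N t) := by
      refine zcf fun t ht => ?_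
      rw [uIcc_of_le Yn] at ht
      have f1 : ⌊X * exp (-Ve)⌋ <= ⌊X⌋ := Int.floor_le_floor (mul_le_of_le_one_right hX.le (exp_le_one_iff.2 (by nlinarith [ht.1])))
      have f2 : ⌊X⌋ - n <= ⌊X * exp (-Ve)⌋ := hn ▸ Int.floor_le_floor (by gcongr; exact ht.2)
      rw [<- Finset.sum_mul, <- sub_mul, <- floor_down ⌊X⌋ n _ f1 f2, Dk_even, mul_neg]
  rw [e, zdh (((Dk_cont N).intervalIntegrable _ _).const_mul _)
      (ii_sum n _ _ _ fun i h => (hi i (zbb.1 h)).1),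
      zad, Dk_half, zdd fun i h => (hi i (zbb.1 h)).1]
  congr 1
  · ring
  · exact zah rfl fun i h => (hi i (zbb.1 h)).2
end PartK3
section PartK4
open Set MeasureTheory Filter Topology Real
lemma Pk_le' (N : NN) (hN : 1 <= N) (y : RR) (h0 : 0 <= y) (h : y <= 1 / 2) : |Pk N y| <= 5 ∧ ∀ z, 0 < z -> z <= y -> |Pk N y| <= 5 / (N * z) := by
  have hN0 : Yr <= N := by exact_mod_cast hN
  have h1 := Pk_le N hN y h0 h
  have e : 5 / N * wk N y = 5 / (N * y + 1) := by
    rw [wk, zbc h0]; field_simp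
  rw [e] at h1
  refine ⟨h1.trans ((zae Ye).2 (by nlinarith [mul_nonneg (by linarith : Yh <= N) h0])), fun z hz hzy => h1.trans ?_⟩
  gcongr
  nlinarith
lemma psum (N : NN) (hN : 1 <= N) (X c δ : RR) (hX : 0 < X) (hc : 0 < c) (hδ : 0 < δ) (n : NN) (y : NN -> RR)
    (h1 : ∀ i < n, Vk ∧ c * i / X <= y i) (h2 : 0 < n -> c * δ / X <= y 0) :
    ∑ i ∈ Finset.range n, |Pk N (y i)| <= 5 * (1 + 1 / c) * min 1 Vj + 5 / c * (X / N) * (1 + log n) := by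
  have hN0 : Yr <= N := by exact_mod_cast hN
  have hlog : 0 <= log n := log_natCast_nonneg n
  rcases n with _ | n
  · simp only [Finset.range_zero, Finset.sum_empty]; positivity
  rw [Finset.sum_range_succ', add_comm]
  refine zec ?_ ?_
  · obtain ⟨a1, a2⟩ := Pk_le' N hN (y 0) (h1 0 Wg).1.1 (h1 0 Wg).1.2
    have a3 := a2 _ Ye (h2 Wg)
    rcases min_cases Yr Vj with h | h <;> rw [h.1]
    · have : 0 < 1 / c := by positivity
      linarith
    · refine a3.trans (le_of_eq_of_le (b := 5 * (1 / c) * Vj) (by field_simp) ?_)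
      gcongr; linarith
  · have hh : ∑ i ∈ Finset.range n, |Pk N (y (i + 1))| <= ∑ i ∈ Finset.range n, 5 / c * (X / N) * (1 / ((i:RR) + 1)) := by
      refine zba fun i hi => ?_
      have hi' := h1 (i + 1) (by have := zbb.1 hi; omega)
      refine ((Pk_le' N hN (y (i + 1)) hi'.1.1 hi'.1.2).2 _ Ye hi'.2).trans (le_of_eq ?_)
      push_cast; field_simp
    refine hh.trans ?_
    rw [<- zbe]
    gcongr
    have h3 := harmonic_le_one_add_log n
    rw [harmonic] at h3
    push_cast at h3
    simp only [one_div]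
    refine h3.trans ?_
    rcases n with _ | n
    · simpa using hlog
    · gcongr; simp
lemma bz_one (x : RR) : bz 1 x = (x - 1 / 2) - ⌊x⌋ := by
  rw [bz, bernoulliFun_one, <- Int.self_sub_floor]; ring
lemma bulk_sm (j : NN) (hj : 2 <= j) (L : RR) (hL : 0 < L) : ∃ C : RR, 0 < C ∧ ∀ N : NN, 2 <= N -> ∀ X : RR, 0 < X →
    |(Ya bz j Yd * Dk N y) - bz j X / 2| <= C * (X / N * log N) ∧
    |(∫ y in Vg..0, bz j Yd * Dk N y) - bz j X / 2| <= C * (X / N * log N) := by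
  obtain ⟨j, rfl⟩ : ∃ i, j = i + 1 := ⟨j - 1, by omega⟩
  obtain ⟨C, hC0, hC⟩ := bz_bdd j
  refine ⟨5 * (Ym * C * (L * exp Yq)), by positivity, fun N hN X hX => ?_⟩
  have hcon : Continuous (fun y => bz Ym Yd) := (bz_cont Ym hj).comp Yj
  have hB : ∀ y : RR, y <= 1/2 -> |Ym * bz j Yd * (L * Yd)| <= Ym * C * (L * (X * exp Yq)) := fun y hy => by
    rw [abs_mul, abs_mul, zbc (by positivity : Yh <= j + 1), zea (by positivity : 0 < L * Yd)]
    gcongr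
    exact hC _
  have hi : ∀ a b, IntervalIntegrable (fun y => Ym * bz j Yd * (L * Yd)) volume a b := fun a b =>
    ((bzc_ii j X L a b).const_mul _).mul_continuousOn Yj
  have r := one_right N hN (fun y => bz Ym Yd) _ _ hcon (fun y => bzc_deriv j X L y hX hL) (hi _ _) (fun y hy => hB y hy.2)
  have l := one_left N hN (fun y => bz Ym Yd) _ _ hcon (fun y => bzc_deriv j X L y hX hL) (hi _ _) (fun y hy => hB y (by linarith [hy.2]))
  simp only [mul_zero, exp_zero, mul_one] at r l
  exact ⟨r.trans (le_of_eq (by ring)), l.trans (le_of_eq (by ring))⟩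
lemma fl_ii (X L : RR) (N : NN) (a b : RR) : IntervalIntegrable (fun y => (⌊X * exp Yi⌋ : RR) * Dk N y) volume a b := by
  have : (fun y => (⌊X * exp Yi⌋ : RR) * Dk N y) = fun y => (X * exp Yi - 1 / 2) * Dk N y - bz 1 Yd * Dk N y := by
    funext y; rw [bz_one]; ring
  rw [this]
  have := Dk_cont N
  exact (zaf Yj _ _).sub ((bzc_ii 1 X L a b).mul_continuousOn this.continuousOn)
lemma bulk_one (L : RR) (hL : 0 < L) : ∃ C c : RR, 0 < C ∧ 0 < c ∧ ∀ N : NN, 2 <= N -> ∀ X : RR, 1 <= X →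
    (∃ (n : NN) (y : NN -> RR), n <= X * exp Yq ∧ (∀ i < n, Vk ∧ c * i / X <= y i) ∧
      (∀ δ : RR, Vh -> 0 < n -> c * δ / X <= y 0) ∧
    |(Ya bz 1 Yd * Dk N y) - bz 1 X / 2| <= C * (X / N * log N) + ∑ i ∈ Finset.range n, |Pk N (y i)|) ∧
    (∃ (n : NN) (y : NN -> RR), n <= X * exp Yq ∧ (∀ i < n, Vk ∧ c * i / X <= y i) ∧
      (∀ δ : RR, Vh -> 0 < n -> c * δ / X <= y 0) ∧
    |(∫ y in Vg..0, bz 1 Yd * Dk N y) - bz 1 X / 2| <= C * (X / N * log N) + ∑ i ∈ Finset.range n, |Pk N (y i)|) := by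
  refine ⟨5 * (L * exp Yq), 1 / (exp Yq * L), by positivity, by positivity, fun N hN X hX1 => ?_⟩
  have hX : 0 < X := by linarith
  have hE : 1 <= exp Yq := one_le_exp Ye
  have hd : ∀ y, HasDerivWithinAt (fun y => X * exp Yi - 1 / 2) (L * Yd) (Ioi y) y := fun y => by
    have := (((zed y).const_mul L).exp.const_mul X).sub_const Yf
    refine (this.congr_deriv ?_).hasDerivWithinAt; simp; ring
  have hB : ∀ y : RR, y <= 1/2 -> |L * Yd| <= L * (X * exp Yq) := fun y hy => by
    rw [zea (by positivity : 0 < L * Yd)]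
    gcongr
  have r := one_right N hN (fun y => X * exp Yi - 1 / 2) _ _ Yj hd (zaf Yj _ _) (fun y hy => hB y hy.2)
  have l := one_left N hN (fun y => X * exp Yi - 1 / 2) _ _ Yj hd (zaf Yj _ _) (fun y hy => hB y (by linarith [hy.2]))
  simp only [mul_zero, exp_zero, mul_one] at r l
  have hsub : ∀ a b : RR, ∫ y in a..b, bz 1 Yd * Dk N y =
      (∫ y in a..b, (X * exp Yi - 1 / 2) * Dk N y) - ∫ y in a..b, (⌊X * exp Yi⌋ : RR) * Dk N y := fun a b => by
    rw [<- zdh (zaf (by have := Dk_cont N; fun_prop) _ _) (fl_ii X L N a b)]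
    refine zcf fun y _ => ?_
    rw [bz_one]; ring
  have hfl0 : 0 <= ⌊X⌋ := Int.floor_nonneg.2 hX.le
  have habs : ∀ (a b s : RR) (n : NN) (y : NN -> RR), |a - (X - 1/2) / 2| <= 5 * (L * (X * exp (L * (1 / 2)))) / N * log N -> b = ⌊X⌋ / 2 + s -> |s| <= ∑ i ∈ Finset.range n, |Pk N (y i)| →
      |a - b - bz 1 X / 2| <= 5 * (L * exp Yq) * (X / N * log N) + ∑ i ∈ Finset.range n, |Pk N (y i)| := fun a b s n y h1 h2 h3 => by
    rw [bz_one, h2, show a - (⌊X⌋ / 2 + s) - (X - 1/2 - ⌊X⌋) / 2 = (a - (X - 1/2)/2) - s by ring]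
    refine (abs_sub _ _).trans (zec (h1.trans (le_of_eq (by ring))) h3)
  constructor
  · obtain ⟨n, hn⟩ : ∃ n : NN, ⌊X * exp Yq⌋ = ⌊X⌋ + n :=
      ⟨(⌊X * exp Yq⌋ - ⌊X⌋).toNat, by
        have : ⌊X⌋ <= ⌊X * exp Yq⌋ := Int.floor_le_floor (le_mul_of_one_le_right hX.le hE)
        omega⟩
    obtain ⟨y, hy, hint⟩ := floor_right N X L hX hL n hn
    have hlow : ∀ i < n, ∀ a : RR, a <= Yp - X -> 1 / (exp Yq * L) * a / X <= y i := fun i hi a ha => by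
      obtain ⟨h1, h2, h3⟩ := hy i hi
      have hm : X < Yp := by
        have := Int.lt_floor_add_one X; push_cast; have : Yh <= i := by positivity
        linarith
      set m := Yp
      have hm0 : 0 < m := hX.trans hm
      have hmE : m <= X * exp Yq := by
        rw [h1, zae hL, log_le_iff_le_exp Ye, zae hX] at h3
        rw [mul_comm, mul_comm L]; exact h3
      have hl : 1 - (m / X)⁻¹ <= log (m / X) := one_sub_inv_le_log_of_pos Ye
      rw [inv_div, one_sub_div hm0.ne'] at hl
      rw [h1, zce hX hL]
      have : 1 / (exp Yq * L) * a * L <= (m - X) / (X * exp Yq) * X := by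
        rw [show 1 / (exp Yq * L) * a * L = a / exp Yq by field_simp, show (m - X) / (X * exp Yq) * X = (m - X) / exp Yq by field_simp]
        gcongr
      refine this.trans ?_
      gcongr
      refine le_trans ?_ hl
      gcongr
    refine ⟨n, y, ?_, fun i hi => ⟨(hy i hi).2, ?_⟩, fun δ hδ hn0 => ?_, ?_⟩
    · have h1 := Int.floor_le (X * exp Yq)
      rw [hn] at h1; push_cast at h1
      have : Yh <= ⌊X⌋ := by exact_mod_cast hfl0
      linarith
    · refine hlow i hi _ ?_
      have := Int.lt_floor_add_one X; push_cast; linarith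
    · refine hlow 0 hn0 _ ?_
      have := hδ (⌊X⌋ + 1)
      rw [abs_of_neg (by push_cast; linarith [Int.lt_floor_add_one X])] at this
      push_cast at this ⊢; linarith
    · rw [hsub]
      exact habs _ _ _ n y r hint (zbg _ _)
  · obtain ⟨n, hn⟩ : ∃ n : NN, ⌊X * exp (-Yq)⌋ = ⌊X⌋ - n :=
      ⟨(⌊X⌋ - ⌊X * exp (-Yq)⌋).toNat, by
        have : ⌊X * exp (-Yq)⌋ <= ⌊X⌋ := Int.floor_le_floor (mul_le_of_le_one_right hX.le (exp_le_one_iff.2 (by linarith [mul_pos hL (by norm_num : Yh < 1/2)])))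
        omega⟩
    obtain ⟨y, hy, hint⟩ := floor_left N X L hX hL n hn
    have hlow : ∀ i < n, ∀ a : RR, 0 <= a -> a <= X - Yk -> 1 / (exp Yq * L) * a / X <= y i := fun i hi a ha0 ha => by
      obtain ⟨h1, h2, h3⟩ := hy i hi
      set m := Yk
      have hl : 1 - (X / m)⁻¹ <= log (X / m) := one_sub_inv_le_log_of_pos Ye
      rw [inv_div, one_sub_div hX.ne'] at hl
      rw [h1, zce hX hL]
      have h4 : 1 / (exp Yq * L) * a * L <= (X - m) / X * X := by
        rw [show 1 / (exp Yq * L) * a * L = a / exp Yq by field_simp, div_mul_cancel₀ _ hX.ne']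
        exact (div_le_self ha0 hE).trans ha
      refine h4.trans ?_
      gcongr
    refine ⟨n, y, ?_, fun i hi => ⟨(hy i hi).2.2, ?_⟩, fun δ hδ hn0 => ?_, ?_⟩
    · have h1 : (0:ZZ) <= ⌊X * exp (-Yq)⌋ := Int.floor_nonneg.2 Ye
      rw [hn] at h1
      have h2 : Ws <= ⌊X⌋ := by exact_mod_cast (by omega : (n:ZZ) <= ⌊X⌋)
      have := Int.floor_le X
      nlinarith
    · refine hlow i hi _ Ye ?_
      have := Int.floor_le X; push_cast; linarith
    · have := hδ ⌊X⌋
      rw [zbc (by linarith [Int.floor_le X])] at this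
      rcases le_or_gt 0 δ with h | h
      · refine hlow 0 hn0 _ h ?_
        push_cast; linarith
      · refine le_trans ?_ (hy 0 hn0).2.2.1
        exact div_nonpos_of_nonpos_of_nonneg (mul_nonpos_of_nonneg_of_nonpos Ye h.le) hX.le
    · rw [hsub]
      refine habs _ _ (-∑ i ∈ Finset.range n, Pk N (y i)) n y l (hint.trans (sub_eq_add_neg _ _)) ?_
      rw [abs_neg]; exact zbg _ _
lemma split0 (j : NN) (X L : RR) (N : NN) : Yb bz j Yd * Dk N y =
    (∫ y in Vg..0, bz j Yd * Dk N y) + Ya bz j Yd * Dk N y :=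
  (zcb ((bzc_ii j X L _ _).mul_continuousOn (Dk_cont N).continuousOn)
    ((bzc_ii j X L _ _).mul_continuousOn (Dk_cont N).continuousOn)).symm
lemma logn_bd (L : RR) (hL : 0 < L) (N : NN) (hN : 2 <= N) (X : RR) (hX : 0 < X) (hXN : X <= N) (n : NN) (hn : n <= X * exp Yq) :
    1 + log n <= (3 + L) * log N := by
  have hN2 : (2:RR) <= N := by exact_mod_cast hN
  have h2 : 1/2 <= log N := (by linarith [log_two_gt_d9] : 1/2 <= log 2).trans (log_le_log Yn hN2)
  rcases Nat.eq_zero_or_pos n with rfl | h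
  · simp; nlinarith
  · have h1 : log n <= log (N * exp Yq) := log_le_log Ye (hn.trans (by gcongr))
    rw [log_mul Ye Ye, log_exp] at h1
    nlinarith
lemma bulk (j : NN) (hj : 1 <= j) (L : RR) (hL : 0 < L) : ∃ C : RR, 0 < C ∧ ∀ N : NN, 2 <= N -> ∀ X : RR, 1 <= X -> X <= N →
    ∀ δ : RR, 0 < δ -> Vh →
    |(Yb bz j Yd * Dk N y) - bz j X| <= C * (X / N * log N + min 1 Vj) := by
  have hab : ∀ a b c d e : RR, |a - c / 2| <= d -> |b - c / 2| <= e -> |a + b - c| <= d + e := fun a b c d e h1 h2 => by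
    rw [show a + b - c = (a - c/2) + (b - c/2) by ring]
    exact (abs_add_le _ _).trans (zec h1 h2)
  rcases Nat.lt_or_ge j 2 with h | h
  · obtain rfl : j = 1 := by omega
    obtain ⟨C, c, hC, hc, H⟩ := bulk_one L hL
    refine ⟨2 * (C + (5 * (1 + 1 / c) + 5 / c * (3 + L))), by positivity, fun N hN X hX hXN δ hδ hw => ?_⟩
    have hN2 : (2:RR) <= N := by exact_mod_cast hN
    have hlog : 0 <= log N := log_natCast_nonneg N
    have hX0 : 0 < X := by linarith
    obtain ⟨⟨n, y, h1, h2, h3, h4⟩, n', y', h1', h2', h3', h4'⟩ := H N hN X hX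
    rw [split0]
    have key : ∀ (n : NN) (y : NN -> RR), n <= X * exp Yq -> (∀ i < n, Vk ∧ c * i / X <= y i) →
      (∀ δ : RR, Vh -> 0 < n -> c * δ / X <= y 0) -> C * (X / N * log N) + ∑ i ∈ Finset.range n, |Pk N (y i)| ≤
        (C + (5 * (1 + 1 / c) + 5 / c * (3 + L))) * (X / N * log N + min 1 Vj) := fun n y h1 h2 h3 => by
      have p := psum N Wg X c δ hX0 hc hδ n y h2 (h3 δ hw)
      have q : 5 / c * (X / N) * (1 + log n) <= 5 / c * (X / N) * ((3 + L) * log N) := by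
        gcongr; exact logn_bd L hL N hN X hX0 hXN n h1
      have m0 : 0 <= min 1 Vj := by positivity
      have x0 : 0 <= X / N * log N := by positivity
      have e1 : 5 / c * (X / N) * ((3 + L) * log N) = 5 / c * (3 + L) * (X / N * log N) := by ring
      rw [e1] at q
      have a0 : 0 <= 5 * (1 + 1/c) := by positivity
      have b0 : 0 <= 5 / c * (3 + L) := by positivity
      nlinarith [mul_nonneg a0 x0, mul_nonneg b0 m0, mul_nonneg hC.le m0]
    refine (hab _ _ _ _ _ h4' h4).trans ?_
    linarith [key n y h1 h2 h3, key n' y' h1' h2' h3']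
  · obtain ⟨C, hC, H⟩ := bulk_sm j h L hL
    refine ⟨2 * C, by positivity, fun N hN X hX hXN δ hδ hw => ?_⟩
    obtain ⟨r, l⟩ := H N hN X Wk
    rw [split0]
    refine (hab _ _ _ _ _ l r).trans ?_
    have m0 : 0 <= min 1 Vj := by
      have : Yh < X := by linarith
      positivity
    nlinarith
lemma half_bd (j : NN) (hj : 1 <= j) (L : RR) (hL : 0 < L) : ∃ C : RR, ∀ N : NN, 2 <= N →
    |Ya bz j (exp Yi) * Dk N y| <= C := by
  obtain ⟨B, hB0, hB⟩ := bz_bdd j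
  have hlog : ∀ N : NN, 2 <= N -> 1 / (N:RR) * log N <= 1 := fun N hN => by
    have hN2 : (2:RR) <= N := by exact_mod_cast hN
    rw [one_div_mul_eq_div, div_le_one Wk]
    linarith [log_le_sub_one_of_pos (by linarith : Yh < N)]
  have hab : ∀ a d : RR, |a - bz j 1 / 2| <= d -> |a| <= d + B := fun a d h => by
    have h1 := hB 1
    rw [abs_le] at *; constructor <;> linarith
  rcases Nat.lt_or_ge j 2 with h | h
  · obtain rfl : j = 1 := by omega
    obtain ⟨C, c, hC, hc, H⟩ := bulk_one L hL
    refine ⟨C + 5 * exp Yq + B, fun N hN => ?_⟩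
    obtain ⟨⟨n, y, h1, h2, h3, h4⟩, -⟩ := H N hN 1 le_rfl
    simp only [one_mul] at h1 h4
    refine (hab _ _ h4).trans ?_
    have s : ∑ i ∈ Finset.range n, |Pk N (y i)| <= ∑ i ∈ Finset.range n, (5:RR) :=
      zba fun i hi => (Pk_le' N Wg (y i) (h2 i (zbb.1 hi)).1.1 (h2 i (zbb.1 hi)).1.2).1
    rw [Finset.sum_const, Finset.card_range, nsmul_eq_mul] at s
    nlinarith [hlog N hN]
  · obtain ⟨C, hC, H⟩ := bulk_sm j h L hL
    refine ⟨C + B, fun N hN => ?_⟩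
    obtain ⟨r, -⟩ := H N hN 1 one_pos
    simp only [one_mul] at r
    refine (hab _ _ r).trans ?_
    nlinarith [hlog N hN]
end PartK4
section PartK5
open Set MeasureTheory Filter Topology Real
lemma vdc (κ : CC) (hκ : κ = Complex.I ∨ κ = -Complex.I) (F F1 F2 : RR -> RR) (a b μ : RR) (hab : a <= b) (hμ : 0 < μ) (h1 : ∀ y, HasDerivAt F (F1 y) y)
    (h2 : ∀ y, HasDerivAt F1 (F2 y) y) (hc : Continuous F2) (hl : ∀ y ∈ Icc a b, μ ^ 2 <= F2 y) :
    ‖∫ y in a..b, Complex.exp (κ * F y)‖ <= 8 / μ := by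
  have hκ2 : κ * κ = -1 := by rcases hκ with rfl | rfl <;> simp
  have hκn : ‖κ‖ = 1 := by rcases hκ with rfl | rfl <;> simp
  have hn : ∀ t : RR, ‖Complex.exp (κ * t)‖ = 1 := fun t => by
    rw [Complex.norm_exp]; rcases hκ with rfl | rfl <;> simp
  have hpos : ∀ y, 0 < F1 y ^ 2 + μ ^ 2 := fun y => by positivity
  have cF : Continuous F := zcg.2 fun y => (h1 y).continuousAt
  have cF1 : Continuous F1 := zcg.2 fun y => (h2 y).continuousAt
  set G : RR -> RR := fun y => F1 y / Yx
  set G' : RR -> RR := fun y => F2 y * (μ ^ 2 - F1 y ^ 2) / Yx ^ 2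
  have hG : ∀ y, HasDerivAt G (G' y) y := fun y => by
    refine ((h2 y).div (((h2 y).pow 2).add_const _) (hpos y).ne').congr_deriv ?_
    simp only [G', Pi.pow_apply]; congr 1; push_cast; ring
  have cG' : Continuous G' := by
    refine Continuous.div Yj Yj fun y => ?_
    have := hpos y; positivity
  have cG : Continuous G := zcg.2 fun y => (hG y).continuousAt
  set Φ : RR -> CC := fun y => Complex.exp (κ * F y) * (-κ * G y)
  set Φ' : RR -> CC := fun y => Complex.exp (κ * F y) * (F1 y * G y - κ * G' y)
  have hΦ : ∀ y, HasDerivAt Φ (Φ' y) y := fun y => by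
    have e1 := ((h1 y).ofReal_comp.const_mul κ).cexp.mul ((hG y).ofReal_comp.const_mul (-κ))
    refine e1.congr_deriv ?_
    simp only [Φ']
    linear_combination (Complex.exp (κ * F y) * F1 y * G y) * (-hκ2)
  have i1 : IntervalIntegrable (fun y => Complex.exp (κ * F y)) volume a b := zaf Yj _ _
  have i2 : IntervalIntegrable Φ' volume a b := zaf Yj _ _
  have hΦi := zdb (a := a) (b := b) (fun y _ => hΦ y) i2
  have hΦn : ∀ y, ‖Φ y‖ <= 1 / (2 * μ) := fun y => by
    simp only [Φ]
    rw [norm_mul, hn, one_mul, norm_mul, norm_neg, hκn, one_mul, zbd, norm_div, zac, zbf (hpos y).le,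
      zce (hpos y) Ye]
    nlinarith [sq_nonneg (|F1 y| - μ), sq_abs (F1 y)]
  have hT : ∀ y, HasDerivAt (fun y => 2 / μ * arctan (F1 y / μ)) (2 * F2 y / Yx) y := fun y => by
    refine ((((h2 y).div_const μ).arctan).const_mul (2 / μ)).congr_deriv ?_
    have := (hpos y).ne'
    have e : 1 + (F1 y / μ) ^ 2 = Yx / μ ^ 2 := by field_simp; ring
    rw [e]; field_simp
  have cT : Continuous fun y => 2 * F2 y / Yx := Continuous.div Yj Yj fun y => (hpos y).ne'
  have hTi := zdb (a := a) (b := b) (fun y _ => hT y) (cT.intervalIntegrable _ _)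
  have hd : ‖∫ y in a..b, (Complex.exp (κ * F y) - Φ' y)‖ <= ∫ y in a..b, 2 * F2 y / Yx := by
    refine zag hab (ae_of_all _ fun y hy => ?_) (cT.intervalIntegrable _ _)
    have hly := hl y ⟨hy.1.le, hy.2⟩
    have hp := hpos y
    have e : Complex.exp (κ * F y) - Φ' y = Complex.exp (κ * F y) * (((1 - F1 y * G y : RR) : CC) + κ * G' y) := by
      simp only [Φ']; push_cast; ring
    rw [e, norm_mul, hn, one_mul]
    refine (zeb _ _).trans ?_
    rw [norm_mul, hκn, one_mul, zbd, zbd]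
    have a1 : 1 - F1 y * G y = μ ^ 2 / Yx := by simp only [G]; field_simp; ring
    have a2 : ‖G' y‖ <= F2 y / Yx := by
      have hF2 : 0 <= F2 y := (sq_nonneg μ).trans hly
      simp only [G']
      rw [norm_div, norm_mul, zbf hF2, zbf (by positivity : 0 <= Yx ^ 2), zce Ye hp,
        pow_two Yx, mul_assoc]
      gcongr
      rw [zac, abs_le]; constructor <;> nlinarith [sq_nonneg (F1 y), sq_nonneg μ]
    rw [a1, zbf Ye, show 2 * F2 y / Yx = F2 y / Yx + F2 y / Yx by ring]
    gcongr
  rw [zdh i1 i2, hΦi, hTi] at hd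
  have ht : 2 / μ * arctan (F1 b / μ) - 2 / μ * arctan (F1 a / μ) <= 2 / μ * π := by
    rw [<- mul_sub]; gcongr
    linarith [arctan_lt_pi_div_two (F1 b / μ), neg_pi_div_two_lt_arctan (F1 a / μ)]
  have hfin : ‖∫ y in a..b, Complex.exp (κ * F y)‖ <= 2 / μ * π + (1 / (2 * μ) + 1 / (2 * μ)) := by
    rw [show ∫ y in a..b, Complex.exp (κ * F y) = ((∫ y in a..b, Complex.exp (κ * F y)) - (Φ b - Φ a)) + (Φ b - Φ a) by ring]
    exact (zeb _ _).trans (zec (hd.trans ht) ((norm_sub_le _ _).trans (zec (hΦn b) (hΦn a))))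
  refine hfin.trans ?_
  rw [show 2 / μ * π + (1 / (2 * μ) + 1 / (2 * μ)) = (2 * π + 1) / μ by field_simp; ring]
  gcongr
  linarith [pi_lt_d2]
lemma vdE (A Λ ω a b μ : RR) (hab : a <= b) (hμ : 0 < μ) (hl : ∀ y ∈ Icc a b, μ ^ 2 <= |A| * (Λ ^ 2 * exp Wi)) :
    ‖∫ y in a..b, Complex.exp (Complex.I * ((A * exp Wi + ω * y : RR) : CC))‖ <= 8 / μ := by
  have hd1 : ∀ B θ y : RR, HasDerivAt (fun y => B * exp Wi + θ * y) (B * (Λ * exp Wi) + θ) y := fun B θ y => by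
    refine ((((zed y).const_mul Λ).exp.const_mul B).add ((zed y).const_mul θ)).congr_deriv ?_
    simp only [id, mul_one]; ring
  have hd2 : ∀ B θ y : RR, HasDerivAt (fun y => B * (Λ * exp Wi) + θ) (B * (Λ ^ 2 * exp Wi)) y := fun B θ y => by
    refine (((((zed y).const_mul Λ).exp.const_mul Λ).const_mul B).add_const θ).congr_deriv ?_
    simp only [id, mul_one]; ring
  rcases le_or_gt 0 A with hA | hA
  · rw [zbc hA] at hl
    exact vdc _ (Or.inl rfl) _ _ _ a b μ hab hμ (hd1 A ω) (hd2 A ω) Yj hl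
  · rw [abs_of_neg hA] at hl
    have := vdc _ (Or.inr rfl) _ _ _ a b μ hab hμ (hd1 (-A) (-ω)) (hd2 (-A) (-ω)) Yj hl
    convert this using 4
    · push_cast; ring_nf
noncomputable def eW (A Λ y : RR) : CC := Complex.exp (Complex.I * ((A * exp Wi : RR) : CC))
lemma eW_cont (A Λ : RR) : Continuous (eW A Λ) := by unfold eW; fun_prop
lemma eW_norm (A Λ y : RR) : ‖eW A Λ y‖ = 1 := by rw [eW, mul_comm]; exact Complex.norm_exp_ofReal_mul_I _
lemma eW_far (A Λ δ μ : RR) (N : NN) (hδ : 0 < δ) (hδ2 : δ <= 1/2) (hμ : 0 < μ) (hl : ∀ y ∈ Icc δ Yf, μ ^ 2 <= |A| * (Λ ^ 2 * exp Wi)) :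
    ‖∫ y in δ.. Yf, eW A Λ y * Dk N y‖ <= 8 / μ / (2 * δ) := by
  set ω : RR := Wd * π
  have e : ∫ y in δ.. Yf, eW A Λ y * Dk N y = ∫ y in δ.. Yf, ((1 / sin Wl : RR) : CC) * (eW A Λ y * (sin (ω * y) : RR)) := by
    refine zcf fun y hy => ?_
    rw [uIcc_of_le hδ2] at hy
    have hs := sin_lb y (by linarith [hy.1]) hy.2
    have hs0 : sin Wl ≠ 0 := by have := hy.1; exact (by linarith : 0 < sin Wl).ne'
    have hs1 : ((sin Wl : RR) : CC) ≠ 0 := by exact_mod_cast hs0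
    rw [<- Dk_sin]; push_cast; push_cast at hs1; field_simp
  rw [e]
  refine smv_sin δ Yf hδ hδ2 le_rfl _ _ ((eW_cont A Λ).mul Yj) fun x hx => ?_
  have e2 : ∀ t : RR, eW A Λ t * (sin (ω * t) : RR) = (1 / (2 * Complex.I)) * (Complex.exp (Complex.I * ((A * exp (Λ * t) + ω * t : RR) : CC)) -
      Complex.exp (Complex.I * ((A * exp (Λ * t) + (-ω) * t : RR) : CC))) := fun t => by
    rw [eW, Complex.ofReal_sin, Complex.sin]
    push_cast
    rw [mul_add, mul_add, Complex.exp_add, Complex.exp_add, show Complex.I * (-(ω:CC) * t) = -(ω * t) * Complex.I by ring,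
      show Complex.I * ((ω:CC) * t) = (ω * t) * Complex.I by ring]
    field_simp
    rw [Complex.I_sq]; ring
  simp_rw [e2]
  have hl' : ∀ y ∈ Icc δ x, μ ^ 2 <= |A| * (Λ ^ 2 * exp Wi) := fun y hy => hl y ⟨hy.1, hy.2.trans hx.2⟩
  rw [zad, zdh (zaf Yj _ _) (zaf Yj _ _), norm_mul]
  have b1 := vdE A Λ ω δ x μ hx.1 hμ hl'
  have b2 := vdE A Λ (-ω) δ x μ hx.1 hμ hl'
  have b3 := (norm_sub_le _ _).trans (zec b1 b2)
  have : ‖1 / (2 * Complex.I)‖ = 1 / 2 := by simp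
  rw [this]
  refine (zaa b3 Yn).trans (le_of_eq (by ring))
lemma eW_near (A L δ : RR) (N : NN) (hN : 1 <= N) (hL : 0 < L) (hδ : 0 <= δ) (hδ2 : δ <= 1/2) (hδL : L * δ <= 1) :
    ‖∫ y in Yh..δ, Wo * Dk N y‖ <= 8 * |A| * L ^ 2 * δ ^ 2 + 4 := by
  set ω : RR := Wd * π
  have hcos : ∀ t : RR, Complex.exp (Complex.I * ((A + A * Ve : RR) : CC)) + Complex.exp (Complex.I * ((A + A * (-L * t) : RR) : CC)) = Complex.exp (Complex.I * A) * ((2 * cos (A * L * t) : RR) : CC) := fun t => by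
    push_cast; rw [Complex.cos, mul_add, mul_add, Complex.exp_add, Complex.exp_add, show Complex.I * ((A:CC) * (-L * t)) = -(A * L * t) * Complex.I by ring,
      show Complex.I * ((A:CC) * Ve) = (A * L * t) * Complex.I by ring]; ring
  have hlin : ∀ Λ y : RR, |Λ * y| <= 1 -> ‖eW A Λ y - Complex.exp (Complex.I * ((A + A * Wi : RR) : CC))‖ <= |A| * Wi ^ 2 := fun Λ y h => by
    have h1 := abs_exp_sub_one_sub_id_le h
    have e : eW A Λ y - Complex.exp (Complex.I * ((A + A * Wi : RR) : CC)) = Complex.exp (Complex.I * ((A + A * Wi : RR) : CC)) *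
        (Complex.exp (Complex.I * ((A * (exp Wi - 1 - Λ * y) : RR) : CC)) - 1) := by
      rw [mul_sub, <- Complex.exp_add, eW, mul_one]; congr 2; push_cast; ring
    rw [e, norm_mul, mul_comm Complex.I, Complex.norm_exp_ofReal_mul_I, one_mul]
    refine (Real.norm_exp_I_mul_ofReal_sub_one_le).trans ?_
    rw [norm_mul, zac, zac]
    gcongr
  have hDc := Dk_cont N
  have c1 : Continuous fun y => Wo * (Dk N y : CC) := by
    have := eW_cont A L; have := eW_cont A (-L); fun_prop
  have c2 : Continuous fun y : RR => Complex.exp (Complex.I * A) * Wr * (Dk N y : CC) := by fun_prop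
  have hd : ‖∫ y in Yh..δ, (Wo * Dk N y - Complex.exp (Complex.I * A) * Wr * Dk N y)‖ <= (8 * |A| * L ^ 2 * δ) * |δ - 0| := by
    refine zbh fun y hy => ?_
    rw [uIoc_of_le hδ] at hy
    have hy0 := hy.1
    have hz : |L * y| <= 1 := by rw [zbc Ye]; exact (by gcongr; exact hy.2 : L * y <= L * δ).trans hδL
    have hz' : |-L * y| <= 1 := by rwa [neg_mul, abs_neg]
    have b1 := hlin L y hz
    have b2 := hlin (-L) y hz'
    rw [<- sub_mul, <- hcos, norm_mul, add_sub_add_comm, zbd]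
    have b3 : |Dk N y| <= 4 / y := by
      refine (Dk_le N hN y (by rw [zea hy0]; linarith [hy.2])).trans ?_
      rw [wk, mul_one_div, zea hy0]
      gcongr
      have : Yh <= 1 / N := by positivity
      linarith
    refine (mul_le_mul ((zeb _ _).trans (zec b1 b2)) b3 (abs_nonneg _) Ye).trans ?_
    rw [show (|A| * Yi ^ 2 + |A| * (-L * y) ^ 2) * (4 / y) = 8 * |A| * L ^ 2 * y by field_simp; ring]
    gcongr
    exact hy.2
  rw [zdh (c1.intervalIntegrable _ _) (c2.intervalIntegrable _ _), sub_zero, zbc hδ] at hd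
  have hS : ‖∫ y in Yh..δ, Complex.exp (Complex.I * A) * Wr * Dk N y‖ <= 4 := by
    have e : ∀ y : RR, Complex.exp (Complex.I * A) * Wr * Dk N y = Complex.exp (Complex.I * A) * ((2 * cos (A * L * y) * Dk N y : RR) : CC) := fun y => by
      push_cast; ring
    simp_rw [e]
    rw [zad, zdc, norm_mul, mul_comm Complex.I, Complex.norm_exp_ofReal_mul_I, one_mul, zbd]
    have m0 : Yh ∈ Icc Yh Yf := ⟨le_rfl, by norm_num⟩
    have mδ : δ ∈ Icc Yh Yf := ⟨hδ, hδ2⟩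
    have e2 : ∫ y in Yh..δ, 2 * cos (A * L * y) * Dk N y = ∫ y in Yh..δ, (sin ((ω + A * L) * y) / sin Wl + sin ((ω - A * L) * y) / sin Wl) := by
      refine intervalIntegral.integral_congr_ae (ae_of_all _ fun y hy => ?_)
      rw [uIoc_of_le hδ] at hy
      have hs := sin_lb y hy.1.le (hy.2.trans hδ2)
      have hs0 : 0 < sin Wl := by linarith [hy.1]
      rw [<- add_div, eq_div_iff hs0.ne', add_mul, sub_mul, sin_add, sin_sub]
      linear_combination (2 * cos (A * L * y)) * Dk_sin N y
    rw [e2, zda (sq_ii _ _ _ m0 mδ) (sq_ii _ _ _ m0 mδ)]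
    refine (zeb _ _).trans ?_
    have s1 := Si_bound (ω + A * L) δ hδ hδ2
    have s2 := Si_bound (ω - A * L) δ hδ hδ2
    rw [zac, zac]; linarith
  set I1 := ∫ y in Yh..δ, Wo * Dk N y
  set I2 := ∫ y in Yh..δ, Complex.exp (Complex.I * A) * Wr * Dk N y
  calc ‖I1‖ = ‖(I1 - I2) + I2‖ := by ring_nf
    _ <= _ := (zeb _ _).trans (zec (hd.trans (le_of_eq (by ring))) hS)
lemma fdt (A Λ x : RR) (hA : A ≠ 0) (hΛ : Λ ≠ 0) (hx : 0 <= x) (hx2 : x <= 1/2) :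
    ‖∫ y in Yh..x, eW A Λ y‖ <= exp |Λ| * (2 / |Λ| + 1) / |A| := by
  set h : RR -> RR := fun y => exp (-Wi) / (A * Λ)
  have hh : ∀ y, HasDerivAt h (-(exp (-Wi) / A)) y := fun y => by
    refine ((((zed y).const_mul Λ).neg.exp).div_const (A * Λ)).congr_deriv ?_
    simp; field_simp
  have hE : ∀ y, HasDerivAt (eW A Λ) (eW A Λ y * (Complex.I * ((A * (exp Wi * Λ) : RR) : CC))) y := fun y => by
    have e1 : HasDerivAt (fun y => A * exp Wi) (A * (exp Wi * Λ)) y := by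
      refine (((zed y).const_mul Λ).exp.const_mul A).congr_deriv (by simp)
    exact (e1.ofReal_comp.const_mul Complex.I).cexp
  have hΦ : ∀ y, HasDerivAt (fun y => eW A Λ y * (-Complex.I * h y)) (eW A Λ y + eW A Λ y * (Complex.I * ((exp (-Wi) / A : RR) : CC))) y := fun y => by
    refine ((hE y).mul ((hh y).ofReal_comp.const_mul (-Complex.I))).congr_deriv ?_
    have e : A * (exp Wi * Λ) * h y = 1 := by
      simp only [h]; rw [exp_neg]; field_simp
    have e' : ((A * (exp Wi * Λ) : RR) : CC) * h y = 1 := by exact_mod_cast e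
    push_cast at e' ⊢
    linear_combination (eW A Λ y) * e' - (eW A Λ y * (A * (Complex.exp Wi * Λ)) * h y) * Complex.I_sq
  have cE := eW_cont A Λ
  have i := zdb (a := 0) (b := x) (fun y _ => hΦ y) (zaf Yj _ _)
  rw [zda (zaf Yj _ _) (zaf Yj _ _)] at i
  have hexp : ∀ y ∈ Icc Yh Yf, exp (-Wi) <= exp |Λ| := fun y hy => by
    gcongr
    have := neg_abs_le Wi
    rw [abs_mul, zbc hy.1] at this
    nlinarith [abs_nonneg Λ, hy.2]
  have hb : ∀ y ∈ Icc Yh Yf, ‖eW A Λ y * (-Complex.I * h y)‖ <= exp |Λ| / (|A| * |Λ|) := fun y hy => by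
    rw [norm_mul, eW_norm, one_mul, norm_mul, norm_neg, Complex.norm_I, one_mul, zbd, norm_div, norm_mul, zbf (exp_pos _).le]
    simp only [zac]
    exact div_le_div_of_nonneg_right (hexp y hy) Ye
  have hr : ‖∫ y in Yh..x, eW A Λ y * (Complex.I * ((exp (-Wi) / A : RR) : CC))‖ <= exp |Λ| / |A| * |x - 0| := by
    refine zbh fun y hy => ?_
    rw [uIoc_of_le hx] at hy
    rw [norm_mul, eW_norm, one_mul, norm_mul, Complex.norm_I, one_mul, zbd, norm_div, zbf (exp_pos _).le, zac]
    exact div_le_div_of_nonneg_right (hexp y ⟨hy.1.le, hy.2.trans hx2⟩) Ye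
  rw [sub_zero, zbc hx] at hr
  rw [eq_sub_of_add_eq i]
  refine (norm_sub_le _ _).trans ((zec ((norm_sub_le _ _).trans (zec (hb x ⟨hx, hx2⟩) (hb 0 ⟨le_rfl, by norm_num⟩))) hr).trans ?_)
  have : exp |Λ| / |A| * x <= exp |Λ| / |A| * 1 := by gcongr; linarith
  have hA' := abs_pos.2 hA
  have hL' := abs_pos.2 hΛ
  refine (add_le_add_right this _).trans (le_of_eq ?_)
  field_simp; ring
lemma eW_wk (A Λ : RR) (N : NN) (hN : 1 <= N) (hA : A ≠ 0) (hΛ : Λ ≠ 0) :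
    ‖Ya (wk N y : CC) * eW A Λ y‖ <= exp |Λ| * (2 / |Λ| + 1) / |A| * N := by
  have hN0 : Yh < N := by exact_mod_cast hN
  have e : Ya (wk N y : CC) * eW A Λ y = Ya ((1 / (y + 1 / N) : RR) : CC) * eW A Λ y := by
    refine zcf fun y hy => ?_
    rw [uIcc_of_le Yn] at hy
    rw [wk, zbc hy.1]
  rw [e]
  have hp : ∀ x ∈ Icc Yh Yf, x + 1 / (N:RR) ≠ 0 := fun x hx => by
    have := hx.1
    positivity
  refine (smv 0 Yf Yn (eW A Λ) (fun y => 1 / (y + 1 / N)) (fun y => -1 / (y + 1 / N) ^ 2) _ (eW_cont A Λ) (fun x hx => ?_) ?_ (fun x hx => ?_) ?_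
    fun x hx => fdt A Λ x hA hΛ hx.1 hx.2).trans (le_of_eq ?_)
  · have := ((zed x).add_const (1 / (N:RR))).fun_inv (hp x hx)
    simpa [one_div] using this
  · refine ContinuousOn.div Yj Yj fun x hx => pow_ne_zero 2 (hp x hx)
  · exact div_nonpos_of_nonpos_of_nonneg Yn Ye
  · positivity
  · simp
end PartK5
section PartK6
open Set MeasureTheory Filter Topology Real
lemma mode_Dk (L K : RR) (hL : 0 < L) (hK : 1 <= K) (m : ZZ) (hm : m ≠ 0) : ∃ C : RR, ∀ᶠ N : NN in atTop, ∀ X : RR, N / K <= X -> X <= N * K →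
    ‖Ya (Dk N y : CC) * Yt‖ <= C := by
  set c : RR := L ^ 2 * exp (-Yq) / K
  have hc : 0 < c := by positivity
  refine ⟨8 * (2 * π * |(m:RR)| * K) * L ^ 2 + 4 + (4 / √c + 4 / √c), ?_⟩
  filter_upwards [eventually_ge_atTop 4, eventually_ge_atTop ⌈L ^ 2⌉₊] with N hN4 hNL X hX1 hX2
  have hN : (4:RR) <= N := by exact_mod_cast hN4
  have hNL' : L ^ 2 <= N := (Nat.le_ceil _).trans (by exact_mod_cast hNL)
  have hX : 0 < X := lt_of_lt_of_le Ye hX1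
  have hm1 : Yr <= |(m:RR)| := by exact_mod_cast Int.one_le_abs hm
  have hs2 : 2 <= √N := by apply le_sqrt_of_sq_le; linarith
  have hsL : L <= √N := le_sqrt_of_sq_le hNL'
  have hsq : √(N:RR) ^ 2 = N := sq_sqrt Wk
  set δ : RR := 1 / √N with hδ
  have hδ0 : 0 < δ := by positivity
  have hδ2 : δ <= 1/2 := by rw [hδ]; gcongr
  have hδL : L * δ <= 1 := by rw [hδ, mul_one_div, div_le_one Ye]; exact hsL
  set A := 2 * π * m * X with hA
  have hAabs : |A| = 2 * π * |(m:RR)| * X := by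
    rw [hA, abs_mul, abs_mul, zea hX, zea (by positivity : 0 < 2 * π)]
  have near := eW_near A L δ N Wg hL hδ0.le hδ2 hδL
  have hl : ∀ Λ : RR, (Λ = L ∨ Λ = -L) -> ∀ y ∈ Icc δ Yf, √(N * c) ^ 2 <= |A| * (Λ ^ 2 * exp Wi) := fun Λ hΛ y hy => by
    rw [sq_sqrt Ye, hAabs]
    have h1 : Λ ^ 2 = L ^ 2 := by rcases hΛ with rfl | rfl <;> ring
    have h2 : -Yq <= Λ * y := by rcases hΛ with rfl | rfl <;> nlinarith [hy.1, hy.2]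
    rw [h1]
    calc N * c = 1 * (N / K) * (L ^ 2 * exp (-Yq)) := by simp only [c]; ring
      _ <= (2 * π * |(m:RR)|) * X * (L ^ 2 * exp Wi) := by
        gcongr
        nlinarith [pi_gt_three]
  have hμ : 0 < √(N * c) := by positivity
  have f1 := eW_far A L δ _ N hδ0 hδ2 hμ (hl L (Or.inl rfl))
  have f2 := eW_far A (-L) δ _ N hδ0 hδ2 hμ (hl (-L) (Or.inr rfl))
  have e : 8 / √(N * c) / (2 * δ) = 4 / √c := by
    rw [sqrt_mul Wk, hδ]; field_simp; norm_num
  rw [e] at f1 f2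
  have cD := Dk_cont N
  have c1 := eW_cont A L
  have c2 := eW_cont A (-L)
  have e1 : Ya (Dk N y : CC) * Wo = (∫ y in Yh..δ, Wo * Dk N y) +
      ((∫ y in δ.. Yf, eW A L y * Dk N y) + ∫ y in δ.. Yf, eW A (-L) y * Dk N y) := by
    rw [<- zda (zaf Yj _ _) (zaf Yj _ _)]
    simp_rw [<- add_mul]
    rw [zcb (zaf Yj _ _) (zaf Yj _ _)]
    simp_rw [mul_comm]
  rw [e1]
  refine (zeb _ _).trans (zec (near.trans ?_) ((zeb _ _).trans (zec f1 f2)))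
  refine add_le_add_left ?_ 4
  rw [hAabs, hδ, div_pow, hsq]
  calc 8 * (2 * π * |(m:RR)| * X) * L ^ 2 * (1 ^ 2 / N) <= 8 * (2 * π * |(m:RR)| * (N * K)) * L ^ 2 * (1 ^ 2 / N) := by gcongr
    _ = _ := by field_simp
lemma mode_wk (L K : RR) (hL : 0 < L) (hK : 1 <= K) (m : ZZ) (hm : m ≠ 0) : ∃ C : RR, ∀ᶠ N : NN in atTop, ∀ X : RR, N / K <= X -> X <= N * K →
    ‖Ya (wk N y : CC) * Yt‖ <= C := by
  refine ⟨exp L * (2 / L + 1) * K + exp L * (2 / L + 1) * K, ?_⟩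
  filter_upwards [eventually_ge_atTop 1] with N hN1 X hX1 hX2
  have hN : Yr <= N := by exact_mod_cast hN1
  have hX : 0 < X := lt_of_lt_of_le Ye hX1
  have hm1 : Yr <= |(m:RR)| := by exact_mod_cast Int.one_le_abs hm
  set A := 2 * π * m * X with hA
  have hAabs : |A| = 2 * π * |(m:RR)| * X := by
    rw [hA, abs_mul, abs_mul, zea hX, zea (by positivity : 0 < 2 * π)]
  have hA0 : A ≠ 0 := by rw [<- abs_pos, hAabs]; positivity
  have f1 := eW_wk A L N hN1 hA0 hL.ne'
  have f2 := eW_wk A (-L) N hN1 hA0 (neg_ne_zero.2 hL.ne')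
  rw [abs_neg] at f2
  rw [zea hL] at f1 f2
  have cD := wk_cont N hN1
  have c1 := eW_cont A L
  have c2 := eW_cont A (-L)
  have h : exp L * (2 / L + 1) / |A| * N <= exp L * (2 / L + 1) * K := by
    rw [div_mul_eq_mul_div, zae Ye, mul_assoc _ K]
    refine zaa ?_ Ye
    rw [zae Wk] at hX1
    rw [hAabs]
    have : 1 * (X * K) <= (2 * π * |(m:RR)|) * (X * K) := by gcongr; nlinarith [pi_gt_three]
    nlinarith
  simp_rw [mul_add ((wk N _ : RR) : CC)]
  rw [zda (zaf Yj _ _) (zaf Yj _ _)]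
  exact (zeb _ _).trans (zec (f1.trans h) (f2.trans h))
noncomputable def Zf (W : RR -> RR) (X L : RR) (p : C(UnitAddCircle, CC)) : CC :=
  (Ya (W y : CC) * (p Wj + p Wa)) -
    2 * (Yc p (t : UnitAddCircle)) * Ya (W y : CC)
lemma circ_cont (p : C(UnitAddCircle, CC)) (X L : RR) : Continuous fun y : RR => p Wj :=
  p.continuous.comp (continuous_quotient_mk'.comp Yj)
lemma circ_cont' (p : C(UnitAddCircle, CC)) : Continuous fun y : RR => p (y : UnitAddCircle) :=
  p.continuous.comp continuous_quotient_mk'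
lemma Zf_add (W : RR -> RR) (hW : Continuous W) (X L : RR) (p q : C(UnitAddCircle, CC)) : Zf W X L (p + q) = Zf W X L p + Zf W X L q := by
  have h1 := circ_cont p X L
  have h2 := circ_cont p X (-L)
  have h3 := circ_cont q X L
  have h4 := circ_cont q X (-L)
  have h5 := circ_cont' p
  have h6 := circ_cont' q
  simp only [Zf, ContinuousMap.add_apply]
  rw [zda (h5.intervalIntegrable _ _) (h6.intervalIntegrable _ _)]
  have : Ya (W y : CC) * (p Wj + q Wj + (p Wa + q Wa)) =
    (Ya (W y : CC) * (p Wj + p Wa)) +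
    Ya (W y : CC) * (q Wj + q Wa) := by
    rw [<- zda (zaf Yj _ _) (zaf Yj _ _)]
    refine zcf fun y _ => ?_
    ring
  rw [this]; ring
lemma Zf_smul (W : RR -> RR) (X L : RR) (a : CC) (p : C(UnitAddCircle, CC)) : Zf W X L (a • p) = a * Zf W X L p := by
  simp only [Zf, ContinuousMap.smul_apply, zee, <- mul_add]
  simp_rw [mul_left_comm _ a]
  rw [zad, zad]; ring
lemma Zf_norm (W : RR -> RR) (hW : Continuous W) (X L : RR) (p : C(UnitAddCircle, CC)) :
    ‖Zf W X L p‖ <= 4 * ‖p‖ * Ya |W y| := by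
  have hi : IntervalIntegrable (fun y => |W y|) volume 0 Yf := zaf Yj _ _
  have a1 : ‖Ya (W y : CC) * (p Wj + p Wa)‖ <= Ya 2 * ‖p‖ * |W y| := by
    refine zag Yn (ae_of_all _ fun y _ => ?_) (hi.const_mul _)
    rw [norm_mul, zbd, zac, mul_comm]
    gcongr
    exact (zeb _ _).trans (by linarith [p.norm_coe_le_norm Wj, p.norm_coe_le_norm Wa])
  have a2 : ‖Yc p (t : UnitAddCircle)‖ <= ‖p‖ * |1 - 0| :=
    zbh fun t _ => p.norm_coe_le_norm _
  have a3 : ‖Ya (W y : CC)‖ <= Ya |W y| := by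
    refine zag Yn (ae_of_all _ fun y _ => ?_) hi
    rw [zbd, zac]
  rw [zad] at a1
  rw [sub_zero, abs_one, mul_one] at a2
  refine (norm_sub_le _ _).trans ?_
  rw [norm_mul, norm_mul, Complex.norm_ofNat]
  have := mul_le_mul a2 a3 (norm_nonneg _) (norm_nonneg _)
  nlinarith
lemma trig (W : NN -> RR -> RR) (hW : ∀ N ≥ 1, Continuous (W N)) (L K : RR)
    (hmode : ∀ m : ZZ, m ≠ 0 -> ∃ C : RR, ∀ᶠ N : NN in atTop, ∀ X : RR, N / K <= X -> X <= N * K →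
      ‖Ya (W N y : CC) * Yt‖ <= C)
    (p : C(UnitAddCircle, CC)) (hp : p ∈ Submodule.span CC (range (@fourier Yr))) :
    ∃ C : RR, ∀ᶠ N : NN in atTop, ∀ X : RR, N / K <= X -> X <= N * K -> ‖Zf (W N) X L p‖ <= C := by
  induction hp using Submodule.span_induction with
  | mem p h =>
    obtain ⟨m, rfl⟩ := h
    have hf : ∀ (X Λ y : RR), (fourier m : C(UnitAddCircle, CC)) ((X * exp Wi : RR) : UnitAddCircle) = eW (2 * π * m * X) Λ y := fun X Λ y => by
      rw [fourier_coe_apply, eW]; congr 1; push_cast; simp; ring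
    rcases eq_or_ne m 0 with rfl | hm
    · refine ⟨0, Eventually.of_forall fun N X _ _ => ?_⟩
      simp only [Zf, fourier_zero]
      rw [intervalIntegral.integral_mul_const]; simp; ring
    · obtain ⟨C, hC⟩ := hmode m hm
      refine ⟨C, hC.mono fun N h X h1 h2 => ?_⟩
      have h0 : Yc (fourier m : C(UnitAddCircle, CC)) (t : UnitAddCircle) = 0 := by
        simp_rw [fourier_coe_apply]
        have hc : (2 * π * Complex.I * m : CC) ≠ 0 := by simp [pi_ne_zero, hm]
        have := integral_exp_mul_complex (a := 0) (b := 1) hc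
        simp only [Complex.ofReal_one, div_one] at this ⊢
        rw [this, show (2 * π * Complex.I * m * 1 : CC) = m * (2 * π * Complex.I) by ring, Complex.exp_int_mul_two_pi_mul_I]; simp
      rw [Zf, h0]
      simp_rw [hf]
      simpa using h X h1 h2
  | zero => exact ⟨0, Eventually.of_forall fun N X _ _ => by simp [Zf]⟩
  | add p q _ _ h1 h2 =>
    obtain ⟨C1, h1⟩ := h1
    obtain ⟨C2, h2⟩ := h2
    refine ⟨C1 + C2, ?_⟩
    filter_upwards [h1, h2, eventually_ge_atTop 1] with N h1 h2 hN X hX1 hX2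
    rw [Zf_add _ (hW N hN)]
    exact (zeb _ _).trans (zec (h1 X hX1 hX2) (h2 X hX1 hX2))
  | smul a p _ h =>
    obtain ⟨C, h⟩ := h
    refine ⟨‖a‖ * C, h.mono fun N h X h1 h2 => ?_⟩
    rw [Zf_smul, norm_mul]
    gcongr
    exact h X h1 h2
lemma log_top : Tendsto (fun N : NN => log N) atTop atTop := tendsto_log_atTop.comp tendsto_natCast_atTop_atTop
lemma contW (W : NN -> RR -> RR) (hW : ∀ N ≥ 1, Continuous (W N)) (hWi : ∀ N ≥ 2, Ya |W N y| <= 4 * log N) (L K : RR)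
    (hmode : ∀ m : ZZ, m ≠ 0 -> ∃ C : RR, ∀ᶠ N : NN in atTop, ∀ X : RR, N / K <= X -> X <= N * K →
      ‖Ya (W N y : CC) * Yt‖ <= C)
    (f : C(UnitAddCircle, CC)) (ε : RR) (hε : 0 < ε) :
    ∀ᶠ N : NN in atTop, ∀ X : RR, N / K <= X -> X <= N * K -> ‖Zf (W N) X L f‖ <= ε * log N := by
  have hmem : f ∈ (Submodule.span CC (range (@fourier Yr))).topologicalClosure := by rw [span_fourier_closure_eq_top]; trivial
  obtain ⟨p, hp, hd⟩ := Metric.mem_closure_iff.1 hmem (ε / 32) Ye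
  obtain ⟨C, hC⟩ := trig W hW L K hmode p hp
  filter_upwards [hC, eventually_ge_atTop 2, log_top.eventually_ge_atTop (C * (2 / ε))] with N hC hN hlog X hX1 hX2
  have e : f = (f - p) + p := by simp
  rw [e, Zf_add _ (hW N Wg)]
  rw [dist_eq_norm] at hd
  have h1 := Zf_norm (W N) (hW N Wg) X L (f - p)
  have h2 := hWi N hN
  have h3 := hC X hX1 hX2
  have h4 : C <= ε / 2 * log N := by
    rw [mul_div_assoc', zae hε] at hlog; linarith
  have h5 : 4 * ‖f - p‖ * Ya |W N y| <= 4 * (ε / 32) * (4 * log N) := by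
    have : 0 <= Ya |W N y| := intervalIntegral.integral_nonneg Yn fun _ _ => abs_nonneg _
    gcongr
  refine (zeb _ _).trans ?_
  linarith
noncomputable def mkC (F : RR -> RR) (h : F 0 = F 1) (hc : Continuous F) : C(UnitAddCircle, CC) :=
  ⟨fun x => ((AddCircle.liftIco 1 0 F x : RR) : CC), Complex.continuous_ofReal.comp
    (AddCircle.liftIco_continuous (by simpa using h) hc.continuousOn)⟩
lemma mkC_apply (F : RR -> RR) (h : F 0 = F 1) (hc : Continuous F) (x : RR) : mkC F h hc (x : UnitAddCircle) = ((F (Int.fract x) : RR) : CC) := by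
  have e : (x : UnitAddCircle) = ((Int.fract x : RR) : UnitAddCircle) := by
    have h0 : ((⌊x⌋ : RR) : UnitAddCircle) = 0 := (AddCircle.coe_eq_zero_iff 1).2 ⟨⌊x⌋, by simp⟩
    conv_lhs => rw [<- Int.fract_add_floor x, AddCircle.coe_add, h0, add_zero]
  simp only [mkC, ContinuousMap.coe_mk]
  rw [e, AddCircle.liftIco_zero_coe_apply ⟨Int.fract_nonneg x, Int.fract_lt_one x⟩]
lemma mkC_mean (F : RR -> RR) (h : F 0 = F 1) (hc : Continuous F) : Yc mkC F h hc (t : UnitAddCircle) = ((Yc F t : RR) : CC) := by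
  rw [<- zdc]
  refine zcf fun t ht => ?_
  rw [uIcc_of_le zero_le_one] at ht
  rw [mkC_apply]
  rcases ht.2.eq_or_lt with rfl | h1
  · simp [h]
  · rw [Int.fract_eq_self.2 ⟨ht.1, h1⟩]
end PartK6
section PartK7
open Set MeasureTheory Filter Topology Real
lemma fr_cont (F : RR -> RR) (h : F 0 = F 1) (hc : Continuous F) (X L : RR) : Continuous fun y : RR => F (Int.fract Yd) := by
  have := Complex.continuous_re.comp (circ_cont (mkC F h hc) X L)
  refine this.congr fun y => ?_
  simp [mkC_apply]
lemma contR (W : NN -> RR -> RR) (hW : ∀ N ≥ 1, Continuous (W N)) (hWi : ∀ N ≥ 2, Ya |W N y| <= 4 * log N) (L K : RR)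
    (hmode : ∀ m : ZZ, m ≠ 0 -> ∃ C : RR, ∀ᶠ N : NN in atTop, ∀ X : RR, N / K <= X -> X <= N * K →
      ‖Ya (W N y : CC) * Yt‖ <= C)
    (F : RR -> RR) (h : F 0 = F 1) (hc : Continuous F) (ε : RR) (hε : 0 < ε) :
    ∀ᶠ N : NN in atTop, ∀ X : RR, N / K <= X -> X <= N * K →
      |(Ya W N y * (F (Int.fract Yd) + F (Int.fract Wf))) - 2 * (Yc F t) * Ya W N y| <= ε * log N := by
  filter_upwards [contW W hW hWi L K hmode (mkC F h hc) ε hε] with N hN X h1 h2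
  have := hN X h1 h2
  rw [Zf, mkC_mean] at this
  simp only [mkC_apply] at this
  rw [<- zac, <- zbd]
  convert this using 2
  push_cast [<- zdc]
  rfl
lemma Dk_L1 (N : NN) (hN : 2 <= N) : Ya |Dk N y| <= 4 * log N := by
  have h1 : 1 <= N := by omega
  have := intervalIntegral.integral_mono_on (by norm_num : Yh <= 1/2) ((Dk_cont N).abs.intervalIntegrable (μ := volume) _ _)
    (((wk_cont N h1).const_mul 4).intervalIntegrable _ _) (fun y hy => Dk_le N h1 y (by rw [zbc hy.1]; exact hy.2))
  rw [zad] at this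
  linarith [wk_int N hN]
lemma wk_L1 (N : NN) (hN : 2 <= N) : Ya |wk N y| <= 4 * log N := by
  have h1 : 1 <= N := by omega
  simp only [fun y => zea (wk_pos N h1 y)]
  have := wk_int N hN
  have : 0 <= log N := log_natCast_nonneg N
  linarith
lemma window (j : NN) (hj : 1 <= j) (L K : RR) (hL : 0 < L) (hK : 1 <= K) (ε : RR) (hε : 0 < ε) :
    ∀ᶠ N : NN in atTop, ∀ X : RR, N / K <= X -> X <= N * K →
      |Yb bz j Yd * Dk N y| <= ε * log N := by
  obtain ⟨B, hB, hb⟩ := bz_bdd j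
  obtain ⟨n, hn⟩ := exists_nat_gt (32 * B / ε)
  have hn0 : Yh < n := lt_of_le_of_lt Ye hn
  set q : RR -> RR := fun t => B * (1 - 2 * t)^(2*n) with hq
  set F : RR -> RR := fun t => bernoulliFun j t * (1 - (1 - 2 * t)^(2*n)) with hF
  have qc : Continuous q := by fun_prop
  have Fc : Continuous F := by have := bf_cont j; fun_prop
  have q01 : q 0 = q 1 := by simp [hq]; rw [show Yr-2 = -1 by norm_num]; simp
  have F01 : F 0 = F 1 := by simp [hF]; right; rw [show Yr-2 = -1 by norm_num]; simp
  have qm : Yc q t = B / (2*n+1) := by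
    simp only [hq]
    rw [zad, intervalIntegral.integral_comp_sub_mul (fun x : RR => x^(2*n)) (by norm_num : (2:RR) ≠ 0), integral_pow]
    have : (-1:RR)^(2*n+1) = -1 := by rw [pow_succ]; simp
    norm_num [this]; field_simp
  have key : ∀ x, |bz j x - F (Int.fract x)| <= q (Int.fract x) := fun x => by
    have e : bz j x - F (Int.fract x) = bz j x * (1 - 2 * Int.fract x)^(2*n) := by simp only [bz, hF]; ring
    rw [e, abs_mul, zbc (Even.pow_nonneg (by simp) _ : 0 <= (1 - 2 * Int.fract x)^(2*n))]
    exact zab (hb x) (Even.pow_nonneg (by simp) _)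
  have hw1 := contR (fun N => wk N) (fun N h => wk_cont N h) wk_L1 L K (fun m hm => mode_wk L K hL hK m hm) q q01 qc (ε/16) Ye
  have hw2 := contR (fun N => Dk N) (fun N h => Dk_cont N) Dk_L1 L K (fun m hm => mode_Dk L K hL hK m hm) F F01 Fc (ε/4) Ye
  filter_upwards [hw1, hw2, eventually_ge_atTop 2, log_top.eventually_ge_atTop (4 * |Yc F t| / ε)] with N h1 h2 hN hlog X hX1 hX2
  have hN1 : 1 <= N := by omega
  have h1 := h1 X hX1 hX2
  have h2 := h2 X hX1 hX2
  rw [Dk_half] at h2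
  rw [qm] at h1
  rw [split0]
  have r : ∫ y in Vg..0, bz j Yd * Dk N y = Ya bz j Wf * Dk N y := by
    have := intervalIntegral.integral_comp_neg (a := 0) (b := 1/2) (fun y => bz j Yd * Dk N y)
    rw [neg_zero] at this
    rw [<- this]
    simp only [Dk_even, mul_neg, neg_mul]
  have i1 := fun L' : RR => (bzc_ii j X L' 0 Yf).mul_continuousOn (Dk_cont N).continuousOn
  have i2 : ∀ W : RR -> RR, Continuous W -> ∀ G : RR -> RR, G 0 = G 1 -> Continuous G -> IntervalIntegrable (fun y => W y * (G (Int.fract Yd) + G (Int.fract Wf))) volume 0 Yf := fun W hW G h hc =>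
    (hW.mul ((fr_cont G h hc X L).add (fr_cont G h hc X (-L)))).intervalIntegrable _ _
  have j2 := i2 _ (Dk_cont N) F F01 Fc
  have j3 := i2 _ (wk_cont N hN1) q q01 qc
  have d : |((∫ y in Vg..0, bz j Yd * Dk N y) + Ya bz j Yd * Dk N y) - Ya Dk N y * (F (Int.fract Yd) + F (Int.fract Wf))| <= 4 * Ya wk N y * (q (Int.fract Yd) + q (Int.fract Wf)) := by
    rw [r, <- zda (i1 _) (i1 _), <- zdh ((i1 _).add (i1 _)) j2, <- zad, <- zac]
    refine zag Yn (Eventually.of_forall fun y hy => ?_) (j3.const_mul 4)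
    rw [zac]
    have e : bz j Wf * Dk N y + bz j Yd * Dk N y - Dk N y * (F (Int.fract Yd) + F (Int.fract Wf))
      = Dk N y * ((bz j Yd - F (Int.fract Yd)) + (bz j Wf - F (Int.fract Wf))) := by ring
    rw [e, abs_mul]
    have a1 := Dk_le N hN1 y (by rw [zbc hy.1.le]; exact hy.2)
    have a2 := (abs_add_le (bz j Yd - F (Int.fract Yd)) (bz j Wf - F (Int.fract Wf))).trans (zec (key _) (key _))
    have := mul_le_mul a1 a2 (abs_nonneg _) (by have := wk_pos N hN1 y; positivity)
    linarith
  have hlog' : |Yc F t| <= ε/4 * log N := by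
    rw [zae hε] at hlog; linarith
  have hl0 : 0 <= log N := log_natCast_nonneg N
  have w1 : 2 * (B/(2*n+1)) * Ya wk N y <= ε/16 * log N := by
    refine mul_le_mul ?_ (wk_int N hN) (intervalIntegral.integral_nonneg Yn fun y _ => (wk_pos N hN1 y).le) Ye
    rw [div_lt_iff₀ hε] at hn
    rw [mul_div_assoc', zae Ye]
    nlinarith
  have h1' := (abs_le.1 h1).2
  have h2' := abs_le.1 h2
  have hl' := abs_le.1 hlog'
  have d' := abs_le.1 d
  rw [abs_le]
  constructor <;> linarith
end PartK7
section PartK8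
open Set MeasureTheory Filter Topology Real
lemma tel_le (M : NN) (c f : NN -> RR) (q A : RR) (hq : 0 < q) (h : ∀ i, q * c i <= f Yo - f i) (hA : f M - f 0 <= A) : ∑ i ∈ Finset.range M, c i <= A / q := by
  rw [le_div_iff₀ hq, mul_comm, zbe]
  exact ((zba fun i _ => h i).trans_eq (Finset.sum_range_sub f M)).trans hA
lemma cnt (L : RR) (hL : 0 < L) (a b : RR) (hab : a <= b) (M : NN) : ∑ i ∈ Finset.range M, (if a < L * Yo ∧ L * Yo <= b then Yr else 0) <= (b - a) / L + 1 := by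
  have := tel_le M (fun i : NN => if a < L * Yo ∧ L * Yo <= b then Yr else 0) (fun i => min (max (L * i) (a - L)) b) L (b - a + L) hL ?_ ?_
  · refine this.trans_eq ?_
    field_simp
  · intro i
    push_cast
    split_ifs with h
    · rw [max_eq_left Wk, min_eq_left h.2, max_eq_left Wk, min_eq_left Wk]; linarith
    · have : min (max (L * i) (a - L)) b <= min (max Yg (a - L)) b := min_le_min_right _ (max_le_max_right _ Wk)
      linarith
  · have h1 := min_le_right (max (L * M) (a - L)) b
    have h2 : a - L <= min (max (L * (0:NN)) (a - L)) b := le_min (le_max_right _ _) Wk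
    linarith
lemma geo1 (L : RR) (hL : 0 < L) (a : RR) (M : NN) : ∑ i ∈ Finset.range M, (if L * Yo <= a then exp Yg else 0) <= exp a / (1 - exp (-L)) := by
  have hq : 0 < 1 - exp (-L) := by simpa using hL
  refine tel_le M _ (fun i => exp (min (L * i) a)) _ _ hq ?_ ?_
  · intro i
    push_cast
    split_ifs with h
    · rw [min_eq_left h, min_eq_left Wk]
      have : exp (L * i) = exp (-L) * exp Yg := by rw [<- exp_add]; ring_nf
      rw [this]; linarith
    · have : exp (min (L * i) a) <= exp (min Yg a) := exp_le_exp.2 (min_le_min_right _ Wk)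
      linarith
  · have h1 := exp_le_exp.2 (min_le_right (L * M) a)
    have h2 := exp_pos (min (L * (0:NN)) a)
    linarith
lemma geo2 (L : RR) (hL : 0 < L) (a : RR) (M : NN) : ∑ i ∈ Finset.range M, (if a < L * Yo then exp (-Yg) else 0) <= exp (-a) / (1 - exp (-L)) := by
  have hq : 0 < 1 - exp (-L) := by simpa using hL
  refine tel_le M _ (fun i => -exp (-(max Yg a))) _ _ hq ?_ ?_
  · intro i
    push_cast
    split_ifs with h
    · rw [max_eq_left h.le, max_eq_left Wk]
      have : exp (-(L * (i+1+1))) = exp (-L) * exp (-Yg) := by rw [<- exp_add]; ring_nf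
      rw [this]; linarith
    · have : exp (-(max (L * (i+1+1)) a)) <= exp (-(max Yg a)) := exp_le_exp.2 (neg_le_neg (max_le_max_right _ Wk))
      linarith
  · have h1 := exp_le_exp.2 (neg_le_neg (le_max_right (L * ((0:NN)+1)) a))
    have h2 := exp_pos (-(max (L * (M+1)) a))
    linarith
lemma Dk_per (N m : NN) (y : RR) : Dk N (y + m) = Dk N y := by
  simp only [Dk]
  congr 2
  refine zah rfl fun n _ => ?_
  rw [show 2 * π * (Ws + 1) * (y + m) = 2 * π * (n+1) * y + ((n+1) * m : NN) * (2 * π) by push_cast; ring, cos_add_nat_mul_two_pi]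
lemma decompD (j : NN) (L : RR) (N M : NN) : ∫ y in Yh.. Yu, bz j (exp Yi) * Dk N y = (Ya bz j (exp Yi) * Dk N y)
    + ∑ i ∈ Finset.range M, Yb bz j (exp Yg * exp Yi) * Dk N y := by
  have ii : ∀ a b, IntervalIntegrable (fun y => bz j (exp Yi) * Dk N y) volume a b := fun a b => by
    simpa using (bzc_ii j 1 L a b).mul_continuousOn (Dk_cont N).continuousOn
  induction M with
  | zero => simp
  | succ M ih =>
    rw [Finset.sum_range_succ, <- add_assoc, <- ih, <- zcb (ii 0 Yu) (ii _ _)]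
    congr 1
    have := intervalIntegral.integral_comp_add_right (a := -Yf) (b := 1/2) (fun y => bz j (exp Yi) * Dk N y) ((M:RR)+1)
    rw [show -Yf + ((M:RR)+1) = M + 1/2 by ring, show 1/2 + ((M:RR)+1) = ((M+1 : NN):RR) + 1/2 by push_cast; ring] at this
    rw [<- this]
    refine zcf fun y _ => ?_
    have e := Dk_per N (M+1) y
    push_cast at e
    simp only [e, <- exp_add]
    ring_nf
lemma pow_nonint (u v : NN) (hcop : Nat.Coprime u v) (hv : 2 <= v) (h : NN) (hh : 1 <= h) (w : ZZ) : Wc^h ≠ w := by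
  intro e
  have hv0 : (v:RR)^h ≠ 0 := by positivity
  rw [div_pow, div_eq_iff hv0] at e
  have e' : (u:ZZ)^h = w * (v:ZZ)^h := by exact_mod_cast e
  have d : (v:ZZ)^h ∣ (u:ZZ)^h := ⟨w, by rw [e']; ring⟩
  have d' : v^h ∣ u^h := by exact_mod_cast d
  have := Nat.Coprime.eq_one_of_dvd (Nat.Coprime.pow h h hcop.symm) d'
  rw [Nat.pow_eq_one] at this
  omega
end PartK8
section PartK9
open Set MeasureTheory Filter Topology Real
lemma ptwise (u v : NN) (hcop : Nat.Coprime u v) (hv : 2 <= v) (hvu : v < u) (j : NN) (hj : 1 <= j) (L : RR) (hLd : L = log Wc) (hL : 0 < L) :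
    ∃ C, 0 < C ∧ ∀ K : RR, 1 < K -> ∀ ε0 : RR, 0 < ε0 -> ∃ h0 : NN, ∀ ε' : RR, 0 < ε' -> ∀ᶠ N : NN in atTop, ∀ i : NN,
      |(Yb bz j (exp Yg * exp Yi) * Dk N y) - (if L * Yo < log N then bz j (exp Yg) else 0)|
      <= C * (log N / N) * (if L * Yo <= log N - log K then exp Yg else 0)
        + C * (if (1 - 2 * ε0) * log N < L * Yo ∧ L * Yo <= log N then 1 else 0)
        + C * ε0 * (if 0 < L * Yo ∧ L * Yo <= log N then 1 else 0)
        + C * (if 0 < L * Yo ∧ L * Yo <= L * h0 then 1 else 0)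
        + (ε' * log N + C) * (if log N - log K < L * Yo ∧ L * Yo <= log N + log K then 1 else 0)
        + C * (N * log N) * (if log N + log K < L * Yo then exp (-Yg) else 0) := by
  obtain ⟨C1, hC1, b1⟩ := bulk j hj L hL
  obtain ⟨C2, hC2, b2⟩ := tail_est j hj L hL
  obtain ⟨B, hB, hb⟩ := bz_bdd j
  refine ⟨C1 + C2 + B, by positivity, fun K hK ε0 hε0 => ?_⟩
  obtain ⟨h0, hm⟩ := mahler_thm u v hcop hv hvu ε0 hε0
  refine ⟨h0, fun ε' hε' => ?_⟩
  set C := C1 + C2 + B with hC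
  have t0 : Tendsto (fun N : NN => exp (-(ε0 * log N))) atTop (𝓝 0) :=
    tendsto_exp_neg_atTop_nhds_zero.comp (log_top.const_mul_atTop hε0)
  have hlK : 0 < log K := log_pos hK
  have hu : 0 < (u:RR) / v := by
    have : 0 < u := by omega
    positivity
  have hexp : ∀ n : NN, exp (L * n) = Wc^n := fun n => by rw [mul_comm, exp_nat_mul, hLd, exp_log hu]
  filter_upwards [window j hj L K hL hK.le ε' hε', eventually_ge_atTop 2, t0.eventually_le_const hε0] with N hw hN hsm i
  have hl0 : 0 <= log N := log_natCast_nonneg N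
  have hNp : Yh < N := by positivity
  have hNe : exp (log N) = N := exp_log hNp
  have hKe : exp (log K) = K := exp_log Wk
  have hXp := exp_pos Yg
  have hx : 0 < L * Wn := by positivity
  have hc : ∀ P : Prop, ∀ [Decidable P], Yh <= if P then 1 else 0 := fun P _ => by split_ifs <;> norm_num
  have n1 : 0 <= C * (log N / N) * (if L * Yo <= log N - log K then exp Yg else 0) := by
    have : 0 <= (if L * Wn <= log N - log K then exp Yg else 0) := by split_ifs <;> positivity
    positivity
  have n2 := mul_nonneg (by positivity : 0 <= C) (hc ((1 - 2 * ε0) * log N < L * Yo ∧ L * Yo <= log N))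
  have n3 := mul_nonneg (by positivity : 0 <= C * ε0) (hc (0 < L * Wn ∧ L * Yo <= log N))
  have n4 := mul_nonneg (by positivity : 0 <= C) (hc (0 < L * Wn ∧ L * Yo <= L * h0))
  have n5 := mul_nonneg (by positivity : 0 <= ε' * log N + C) (hc (log N - log K < L * Yo ∧ L * Yo <= log N + log K))
  have n6 : 0 <= C * (N * log N) * (if log N + log K < L * Yo then exp (-Yg) else 0) := by
    have : 0 <= (if log N + log K < L * Wn then exp (-Yg) else 0) := by split_ifs <;> positivity
    positivity
  by_cases hbig : log N + log K < L * Yo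
  · have := b2 N hN _ hXp
    rw [if_neg (by linarith : ¬ L * Wn < log N), sub_zero]
    rw [if_pos hbig] at n6 ⊢
    have e : C2 * (N * log N / exp Yg) = C2 * (N * log N) * exp (-Yg) := by rw [exp_neg]; ring
    have : C2 * (N * log N) * exp (-Yg) <= C * (N * log N) * exp (-Yg) := by
      have : C2 <= C := by rw [hC]; linarith
      gcongr
    linarith
  push Not at hbig
  by_cases hmid : log N - log K < L * Yo
  · have := hw (exp Yg) (by rw [<- hNe, <- hKe, <- exp_sub, exp_le_exp]; exact hmid.le) (by rw [<- hNe, <- hKe, <- exp_add, exp_le_exp]; exact hbig)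
    rw [if_pos (And.intro hmid hbig)] at n5 ⊢
    have hg : |if L * Wn < log N then bz j (exp Yg) else 0| <= B := by
      split_ifs
      · exact hb _
      · simp [hB.le]
    have := abs_sub (Yb bz j (exp Yg * exp Yi) * Dk N y) (if L * Wn < log N then bz j (exp Yg) else 0)
    linarith
  push Not at hmid
  have hXN : exp Yg <= N := by rw [<- hNe, exp_le_exp]; linarith
  have hX1 : 1 <= exp Yg := one_le_exp hx.le
  rw [if_pos (by linarith : L * Wn < log N)]
  rw [if_pos hmid] at n1 ⊢
  have main : ∀ δ : RR, 0 < δ -> (∀ w : ZZ, δ <= |exp Yg - w|) -> |(Yb bz j (exp Yg * exp Yi) * Dk N y) - bz j (exp Yg)| <= C * (log N / N) * exp Yg + C * min 1 (exp Yg / (N * δ)) := fun δ hδ hd => by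
    refine (b1 N hN _ hX1 hXN δ hδ hd).trans ?_
    have hm0 : 0 <= min 1 (exp Yg / (N * δ)) := by positivity
    have hcc : C1 <= C := by rw [hC]; linarith
    calc _ <= C * (exp Yg / N * log N + min 1 (exp Yg / (N * δ))) := zab hcc Ye
      _ = _ := by ring
  have hpow : exp Yg = Wc^Yo := by rw [<- hexp]; push_cast; rfl
  by_cases hs : i + 1 <= h0
  · have hs' : L * Wn <= L * h0 := zaa (by exact_mod_cast hs) hL.le
    rw [if_pos (And.intro hx hs')] at n4 ⊢
    have := main |exp Yg - round (exp Yg)| (abs_pos.2 (sub_ne_zero.2 (by rw [hpow]; exact pow_nonint u v hcop hv _ Wg _))) (fun w => round_le _ w)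
    have := zaa (min_le_left 1 (exp Yg / (N * |exp Yg - round (exp Yg)|))) (by positivity : 0 <= C)
    linarith
  have hd := main (exp (-(ε0 * Yo * L))) (exp_pos _) (fun w => by
    have := hm Yo Wg w
    rw [hpow]; push_cast at this; rw [hLd]; exact this)
  by_cases hq : (1 - 2 * ε0) * log N < L * Yo
  · rw [if_pos (And.intro hq (by linarith : L * Wn <= log N))] at n2 ⊢
    have := zaa (min_le_left 1 (exp Yg / (N * exp (-(ε0 * Yo * L))))) (by positivity : 0 <= C)
    linarith
  · push Not at hq
    rw [if_pos (And.intro hx (by linarith : L * Wn <= log N))] at n3 ⊢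
    have e : exp Yg / (N * exp (-(ε0 * Yo * L))) <= ε0 := by
      refine le_trans ?_ hsm
      nth_rewrite 1 [<- hNe]
      rw [<- exp_add, <- exp_sub, exp_le_exp]
      nlinarith [zaa hq hε0.le, mul_nonneg hε0.le hl0, mul_nonneg (mul_nonneg hε0.le hε0.le) hl0]
    have := zaa ((min_le_right 1 _).trans e) (by positivity : 0 <= C)
    linarith
lemma combine (u v : NN) (hcop : Nat.Coprime u v) (hv : 2 <= v) (hvu : v < u) (j : NN) (hj : 1 <= j) (L : RR) (hLd : L = log Wc) (hL : 0 < L) (ε : RR) (hε : 0 < ε) :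
    ∀ᶠ N : NN in atTop, ∀ M : NN, |(∫ y in Yh.. Yu, bz j (exp Yi) * Dk N y) -
      ∑ i ∈ Finset.range M, (if L * Yo < log N then bz j (exp Yg) else 0)| <= ε * log N := by
  obtain ⟨C, hC, hp⟩ := ptwise u v hcop hv hvu j hj L hLd hL
  obtain ⟨C0, h00⟩ := half_bd j hj L hL
  set G := 1 / (1 - exp (-L)) with hG
  have hGp : 0 < G := by
    have : 0 < 1 - exp (-L) := by simpa using hL
    positivity
  set K := 1 + 16 * C * G / ε with hK
  have hK1 : 1 < K := by rw [hK]; have : 0 < 16 * C * G / ε := by positivity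
                         linarith
  set ε0 := ε * L / (24 * C) with hε0
  have hε0p : 0 < ε0 := by positivity
  obtain ⟨h0, hp⟩ := hp K hK1 ε0 hε0p
  have hlK : 0 < log K := log_pos hK1
  set R := 2 * log K / L + 1 with hR
  have hRp : 0 < R := by positivity
  set D := C0 + C + C * ε0 + C * (h0 + 1) + C * R with hD
  filter_upwards [hp (ε / (8 * R)) Ye, eventually_ge_atTop 2, log_top.eventually_ge_atTop (4 * D / ε)] with N hN hN2 hlog M
  have hl0 : 0 <= log N := log_natCast_nonneg N
  have hNp : Yh < N := by positivity
  have hNe : exp (log N) = N := exp_log hNp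
  have hKe : exp (log K) = K := exp_log Wk
  have hlog' : D <= ε / 4 * log N := by
    rw [zae hε] at hlog; linarith
  rw [decompD, add_sub_assoc, <- Finset.sum_sub_distrib]
  refine (abs_add_le _ _).trans ?_
  have s := (zbg _ _).trans (zba fun i (_ : i ∈ Finset.range M) => hN i)
  simp only [zde, <- zbe] at s
  have a0 := h00 N hN2
  have a1 := zaa (geo1 L hL (log N - log K) M) (by positivity : 0 <= C * (log N / N))
  have a2 := zaa (cnt L hL ((1 - 2 * ε0) * log N) (log N) (by nlinarith) M) hC.le
  have a3 := zaa (cnt L hL 0 (log N) hl0 M) (by positivity : 0 <= C * ε0)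
  have a4 := zaa (cnt L hL 0 (L * h0) Ye M) hC.le
  have a5 := zaa (cnt L hL (log N - log K) (log N + log K) Wk M) (by positivity : 0 <= ε / (8 * R) * log N + C)
  have a6 := zaa (geo2 L hL (log N + log K) M) (by positivity : 0 <= C * (N * log N))
  have hKG : C * G / K <= ε / 16 := by
    rw [zae Wk, hK]
    have : ε / 16 * (1 + 16 * C * G / ε) = ε / 16 + C * G := by field_simp
    linarith
  have e1 : C * (log N / N) * (exp (log N - log K) / (1 - exp (-L))) = C * G / K * log N := by
    rw [exp_sub, hNe, hKe, hG]; field_simp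
  have e6 : C * (N * log N) * (exp (-(log N + log K)) / (1 - exp (-L))) = C * G / K * log N := by
    rw [exp_neg, exp_add, hNe, hKe, hG]; field_simp
  have e2 : C * ((log N - (1 - 2 * ε0) * log N) / L + 1) = ε / 12 * log N + C := by
    rw [hε0]; field_simp; ring
  have e3 : C * ε0 * ((log N - 0) / L + 1) = ε / 24 * log N + C * ε0 := by
    rw [hε0]; field_simp; ring
  have e4 : C * ((L * h0 - 0) / L + 1) = C * (h0 + 1) := by field_simp; ring
  have e5 : (ε / (8 * R) * log N + C) * ((log N + log K - (log N - log K)) / L + 1) = ε / 8 * log N + C * R := by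
    have : (log N + log K - (log N - log K)) / L + 1 = R := by rw [hR]; ring
    rw [this]; field_simp
  have hKG' := zab hKG hl0
  have : 0 <= ε * log N := by positivity
  rw [e1] at a1; rw [e2] at a2; rw [e3] at a3; rw [e4] at a4; rw [e5] at a5; rw [e6] at a6
  linarith
end PartK9
section PartA1
open Set MeasureTheory Filter Topology Real
noncomputable def en (n : ZZ) (y : RR) : CC := Complex.exp (-(2 * π * Complex.I * n * y))
lemma en_cont (n : ZZ) : Continuous (en n) := by unfold en; fun_prop
lemma en_orth (T : NN) (n m : ZZ) : ∫ y in Yh..T, en n y * (starRingEnd CC) (en m y) = if n = m then (T:CC) else 0 := by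
  have e : ∀ y : RR, en n y * (starRingEnd CC) (en m y) = Complex.exp ((2 * π * Complex.I * (m - n : ZZ)) * y) := fun y => by
    unfold en
    rw [<- Complex.exp_conj, <- Complex.exp_add]
    congr 1
    simp [map_ofNat]
    ring
  simp only [e]
  split_ifs with h
  · simp [h]
  · have h1 : (2 * π * Complex.I * (m - n : ZZ) : CC) ≠ 0 := by
      have : ((m - n : ZZ) : CC) ≠ 0 := by exact_mod_cast sub_ne_zero.2 (Ne.symm h)
      simp only [ne_eq, mul_eq_zero, this, Complex.I_ne_zero, Complex.ofReal_eq_zero, pi_ne_zero]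
      norm_num
    rw [integral_exp_mul_complex h1]
    have : (2 * π * Complex.I * (m - n : ZZ) : CC) * ((T:NN):RR) = ((m - n) * T : ZZ) * (2 * π * Complex.I) := by push_cast; ring
    rw [this, Complex.exp_int_mul_two_pi_mul_I]
    simp
lemma kern_L2 (t : Finset ZZ) (β : ZZ -> CC) (T : NN) : ∫ y in Yh..T, ‖∑ n ∈ t, β n * en n y‖^2 = T * ∑ n ∈ t, ‖β n‖^2 := by
  apply Complex.ofReal_injective
  rw [<- zdc]
  have e : ∀ y : RR, ((‖∑ n ∈ t, β n * en n y‖^2 : RR) : CC) = ∑ n ∈ t, ∑ m ∈ t, (β n * (starRingEnd CC) (β m)) * (en n y * (starRingEnd CC) (en m y)) := fun y => by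
    rw [Complex.ofReal_pow, <- Complex.mul_conj', map_sum, Finset.sum_mul_sum]
    refine zah rfl fun n _ => zah rfl fun m _ => ?_
    rw [map_mul]; ring
  simp only [e]
  have c : ∀ n m : ZZ, Continuous fun y => (β n * (starRingEnd CC) (β m)) * (en n y * (starRingEnd CC) (en m y)) := fun n m => by
    have h1 := en_cont n
    have h2 := Complex.continuous_conj.comp (en_cont m)
    exact continuous_const.mul (h1.mul h2)
  rw [zdd fun n _ => (continuous_finsetSum _ fun m _ => c n m).intervalIntegrable _ _]
  push_cast
  rw [zbe]
  refine zah rfl fun n hn => ?_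
  rw [zdd fun m _ => (c n m).intervalIntegrable _ _]
  simp only [zad, en_orth]
  simp [hn, Complex.mul_conj']
  ring
lemma lower (j : NN) (hj : 1 <= j) (L : RR) (hL : 0 < L) (β : ZZ -> CC) (Cb : RR) (hβ : ∀ n : ZZ, n ≠ 0 -> ‖β n‖ <= Cb / |Ws|) (A : RR) (hA : 0 < A) (ε : RR) (hε : 0 < ε) :
    ∀ᶠ N : NN in atTop, ∀ M : NN, (M:RR) + 1 <= A * log N →
      ‖∑ n ∈ (Finset.Icc Vl N).erase 0, β n * ∫ y in Yh.. Yu, Yz * en n y‖ <= ε * log N := by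
  obtain ⟨B, hB, hb⟩ := bz_bdd j
  choose Cn hCn using small_n j hj L hL
  set γ : ZZ -> RR := fun n => if n = 0 then 0 else ‖β n‖^2 with hγ
  have hs : Summable γ := by
    have h1 : Summable fun n : ZZ => Cb^2 * (1 / Ws^2) := (Real.summable_one_div_int_pow.2 Yn).mul_left _
    refine Summable.of_nonneg_of_le (fun n => ?_) (fun n => ?_) h1
    · simp only [hγ]; split_ifs <;> positivity
    · simp only [hγ]; split_ifs with h
      · positivity
      · calc ‖β n‖^2 <= (Cb / |Ws|)^2 := by gcongr; exact hβ n h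
          _ = _ := by rw [div_pow, sq_abs]; ring
  set η := ε / (4 * B * A) with hη
  have hηp : 0 < η := by positivity
  obtain ⟨F0, hF⟩ := hs.vanishing (Metric.ball_mem_nhds 0 (by positivity : 0 < η^2))
  filter_upwards [log_top.eventually_ge_atTop ((∑ n ∈ F0, ‖β n‖ * |Cn n|) * (2 / ε))] with N hlog M hM
  set S := (Finset.Icc Vl N).erase 0 with hS
  set t := S \ F0 with ht
  have h0t : ∀ n ∈ t, n ≠ 0 := fun n hn => by
    rw [ht, Finset.mem_sdiff, hS] at hn; exact zdg hn.1
  have ht2 : ∑ n ∈ t, ‖β n‖^2 <= η^2 := by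
    have h1 := hF t Finset.sdiff_disjoint
    rw [mem_ball_zero_iff, zac] at h1
    have h2 := (le_abs_self _).trans h1.le
    refine le_trans (le_of_eq (zah rfl fun n hn => ?_)) h2
    simp [hγ, h0t n hn]
  have hM0 : Yh <= M := by positivity
  have p1 : ‖∑ n ∈ S ∩ F0, β n * ∫ y in Yh.. Yu, Yz * en n y‖ <= ∑ n ∈ F0, ‖β n‖ * |Cn n| := by
    refine (norm_sum_le _ _).trans ((zba fun n _ => ?_).trans (zch Finset.inter_subset_right fun n _ _ => by positivity))
    rw [norm_mul]
    exact zaa ((hCn n _ Ye).trans (le_abs_self _)) (norm_nonneg _)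
  have hgi : ∀ n, IntervalIntegrable (fun y => β n * (Yz * en n y)) volume 0 Yu := fun n => by
    have h' := bzc_ii j 1 L 0 Yu
    simp only [one_mul] at h'
    have h : IntervalIntegrable (fun y => Yz) volume 0 Yu := ⟨h'.1.ofReal, h'.2.ofReal⟩
    exact (h.mul_continuousOn (en_cont n).continuousOn).const_mul _
  have kc : Continuous fun y => ∑ n ∈ t, β n * en n y := continuous_finsetSum _ fun n _ => continuous_const.mul (en_cont n)
  have p2 : ‖∑ n ∈ t, β n * ∫ y in Yh.. Yu, Yz * en n y‖ <= ε / 2 * log N := by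
    simp only [<- zad]
    rw [<- zdd fun n _ => hgi n]
    have c2 : Continuous fun y => B * We := by fun_prop
    have c3 : Continuous fun y => ‖∑ n ∈ t, β n * en n y‖^2 / η := by fun_prop
    have q1 : ‖∫ y in Yh.. Yu, ∑ n ∈ t, β n * (Yz * en n y)‖ <= ∫ y in Yh.. Yu, B * We := by
      refine zag Ye (Eventually.of_forall fun y _ => ?_) (c2.intervalIntegrable _ _)
      have : ∑ n ∈ t, β n * (Yz * en n y) = Yz * ∑ n ∈ t, β n * en n y := by
        rw [zbe]; exact zah rfl fun n _ => by ring
      rw [this, norm_mul, zbd, zac]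
      refine mul_le_mul (hb _) ?_ (norm_nonneg _) hB.le
      set x := ‖∑ n ∈ t, β n * en n y‖
      rw [<- sub_nonneg, show η + x^2/η - x = ((x - η/2)^2 + 3/4*η^2)/η by field_simp; ring]
      positivity
    have q2 : ∫ y in Yh.. Yu, B * We <= ∫ y in Yh..((M+1 : NN) : RR), B * We := by
      refine intervalIntegral.integral_mono_interval le_rfl Ye (by push_cast; linarith) (Eventually.of_forall fun y => ?_) (c2.intervalIntegrable _ _)
      simp only [Pi.zero_apply]; positivity
    have q4 : ∫ y in Yh..((M+1 : NN) : RR), B * We = B * ((∫ y in Yh..((M+1 : NN) : RR), η) + ((M+1:NN):RR) * (∑ n ∈ t, ‖β n‖^2) / η) := by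
      rw [<- kern_L2, zad, zda intervalIntegrable_const (c3.intervalIntegrable _ _), intervalIntegral.integral_div (r := η)]
    rw [q4] at q2
    refine q1.trans (q2.trans ?_)
    simp only [intervalIntegral.integral_const, sub_zero, zee]
    push_cast
    have q3 : ((M:RR)+1) * (∑ n ∈ t, ‖β n‖^2) / η <= (M+1) * η := by
      rw [zae hηp]
      calc _ <= ((M:RR)+1) * η^2 := by gcongr
        _ = _ := by ring
    calc B * (((M:RR)+1) * η + (M+1) * (∑ n ∈ t, ‖β n‖^2) / η) <= B * ((M+1) * η + (M+1) * η) := by gcongr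
      _ = 2 * B * η * (M+1) := by ring
      _ <= 2 * B * η * (A * log N) := by gcongr
      _ = _ := by rw [hη]; field_simp; norm_num
  have hs : ∑ n ∈ F0, ‖β n‖ * |Cn n| <= ε / 2 * log N := by
    rw [mul_div_assoc', zae hε] at hlog; linarith
  rw [<- Finset.sum_inter_add_sum_sdiff S F0]
  refine (zeb _ _).trans ?_
  linarith
end PartA1
section PartA2
open Set MeasureTheory Filter Topology Real
lemma sum_sym {E : Type*} [AddCommMonoid E] (f : ZZ -> E) (N : NN) : ∑ n ∈ (Finset.Icc Vl N).erase 0, f n = ∑ i ∈ Finset.range N, (f Yo + f (-Yo)) := by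
  induction N with
  | zero => simp
  | succ N ih =>
    have e : (Finset.Icc (-((N+1:NN):ZZ)) ((N+1:NN):ZZ)).erase 0 = insert ((N:ZZ)+1) (insert (-((N:ZZ)+1)) ((Finset.Icc Vl N).erase 0)) := by
      ext x; simp only [Finset.mem_erase, Finset.mem_Icc, Finset.mem_insert]; push_cast; omega
    rw [e, Finset.sum_insert (by simp only [Finset.mem_erase, Finset.mem_Icc, Finset.mem_insert]; omega), Finset.sum_insert (by simp only [Finset.mem_erase, Finset.mem_Icc]; omega), ih, Finset.sum_range_succ]
    abel
lemma en_sum (N : NN) (y : RR) : ∑ n ∈ (Finset.Icc Vl N).erase 0, en n y = (Dk N y : CC) - 1 := by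
  rw [sum_sym, Dk]
  push_cast
  rw [add_sub_cancel_left, zbe]
  refine zah rfl fun i _ => ?_
  rw [Complex.cos, en, en]
  push_cast
  have e1 : -(2 * (π:CC) * Complex.I * Yo * y) = -(2 * π * Yo * y) * Complex.I := by ring
  have e2 : -(2 * (π:CC) * Complex.I * (-Yo) * y) = (2 * π * Yo * y) * Complex.I := by ring
  rw [e1, e2]; ring
lemma I_sum (j : NN) (L : RR) (N M : NN) : ∑ n ∈ (Finset.Icc Vl N).erase 0, ∫ y in Yh.. Yu, Yz * en n y
    = ((∫ y in Yh.. Yu, bz j (exp Yi) * Dk N y : RR) : CC) - ∫ y in Yh.. Yu, Yz * en 0 y := by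
  have h' := bzc_ii j 1 L 0 Yu
  simp only [one_mul] at h'
  have h : IntervalIntegrable (fun y => Yz) volume 0 Yu := ⟨h'.1.ofReal, h'.2.ofReal⟩
  have hc : ∀ f : RR -> CC, Continuous f -> IntervalIntegrable (fun y => Yz * f y) volume 0 Yu := fun f hf => h.mul_continuousOn hf.continuousOn
  rw [<- zdd fun n _ => hc _ (en_cont n), <- zdc]
  have hD := hc (fun y => (Dk N y : CC)) (Complex.continuous_ofReal.comp (Dk_cont N))
  simp only [Complex.ofReal_mul]
  rw [<- zdh hD (hc _ (en_cont 0))]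
  refine zcf fun y _ => ?_
  simp only [<- zbe, en_sum]
  have : en 0 y = 1 := by simp [en]
  rw [this]; ring
lemma zint (k : NN) (L : RR) (hL : 0 < L) (n : ZZ) (b : RR) (hb : 0 <= b) (s : CC) (hs : s = -(k:CC) + 2 * (π:CC) * Complex.I * Yv / Vd) :
    ∫ x in Yr..exp (L * b), (bz Yl x : CC) * (x:CC)^(-(s + (k+1:NN))) = L * ∫ y in Yh..b, (bz Yl (exp Yi) : CC) * en n y := by
  have := subst_exp 1 L 0 b one_pos hL hb (fun x : RR => (bz Yl x : CC) * (x:CC)^(-(s + (k+1:NN))))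
  simp only [one_mul, mul_zero, exp_zero] at this
  rw [this, <- zad]
  refine zcf fun y _ => ?_
  have hLc : Vd ≠ 0 := by exact_mod_cast hL.ne'
  have e : ((exp Yi : RR) : CC)^(-(s + (k+1:NN))) = Complex.exp (-Yi) * en n y := by
    rw [Complex.cpow_def_of_ne_zero (by exact_mod_cast (exp_pos _).ne'), <- Complex.ofReal_log (exp_pos _).le, log_exp, en, <- Complex.exp_add, hs]
    congr 1
    push_cast
    field_simp
    ring
  simp only [e, Complex.real_smul]
  push_cast
  have : Complex.exp Yi * Complex.exp (-Yi) = 1 := by rw [<- Complex.exp_add]; simp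
  linear_combination (L * bz Yl (exp Yi) * en n y : CC) * this
lemma beta_bd (Q : Polynomial CC) : ∃ C : RR, 0 <= C ∧ ∀ n : ZZ, n ≠ 0 -> ‖Q.eval (1 / Yv) - Q.eval 0‖ <= C / |Ws| := by
  obtain ⟨C, hC⟩ := (isCompact_closedBall (0:CC) 1).exists_bound_of_continuousOn (f := fun z => Q.divX.eval z) Q.divX.continuous.continuousOn
  refine ⟨C, (norm_nonneg _).trans (hC 0 (by simp)), fun n hn => ?_⟩
  have h1 : Yr <= |Ws| := by exact_mod_cast Int.one_le_abs hn
  have e : Q.eval (1 / Yv) - Q.eval 0 = Q.divX.eval (1 / Yv) * (1 / n) := by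
    conv_lhs => rw [<- Polynomial.divX_mul_X_add Q]
    simp
  rw [e, norm_mul, norm_div, norm_one, Complex.norm_intCast, div_eq_mul_one_div C]
  refine zab (hC _ ?_) Ye
  rw [mem_closedBall_zero_iff, norm_div, norm_one, Complex.norm_intCast]
  exact div_le_one_of_le₀ h1 (abs_nonneg _)
lemma poch_Q (k : NN) (τ : CC) : ∃ Q : Polynomial CC, Q.eval 0 = τ^Yl ∧ ∀ n : ZZ, n ≠ 0 -> (ascPochhammer CC Yl).eval (-(k:CC) + τ * n) / Yv^Yl = Q.eval (1 / Yv) := by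
  refine ⟨∏ i ∈ Finset.range Yl, (Polynomial.C τ + Polynomial.C ((i:CC) - k) * Polynomial.X), ?_, fun n hn => ?_⟩
  · rw [Polynomial.eval_prod]; simp
  · have hn' : Yv ≠ 0 := by exact_mod_cast hn
    have e : ∀ (m : NN) (x : CC), (ascPochhammer CC m).eval x = ∏ i ∈ Finset.range m, (x + i) := fun m x => by
      induction m with
      | zero => simp
      | succ m ih => rw [ascPochhammer_succ_eval, ih, Finset.prod_range_succ]
    have e2 : Yv^Yl = ∏ i ∈ Finset.range Yl, Yv := by simp
    rw [e, e2, <- Finset.prod_div_distrib, Polynomial.eval_prod]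
    refine Finset.prod_congr rfl fun i _ => ?_
    simp
    field_simp
    ring
lemma head_bd (k : NN) (τ : RR) (hτ : 0 < τ) (p : Polynomial CC) (hp : p.natDegree <= k) : ∃ C : RR, ∀ N : NN,
    ‖∑ n ∈ (Finset.Icc Vl N).erase 0, (1 / (Yw - 1) + p.eval Yw) / Yv^Yl‖ <= C := by
  set q := p.comp (Polynomial.C (-(k:CC)) + Polynomial.C (τ * Complex.I) * Polynomial.X) with hq
  have hqd : q.natDegree < k + 1 := by
    have h1 := Polynomial.natDegree_comp_le (p := p) (q := Polynomial.C (-(k:CC)) + Polynomial.C (τ * Complex.I) * Polynomial.X)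
    have h2 : (Polynomial.C (-(k:CC)) + Polynomial.C (τ * Complex.I) * Polynomial.X).natDegree <= 1 := by
      rw [add_comm]; exact Polynomial.natDegree_linear_le
    exact Nat.lt_succ_of_le (h1.trans ((Nat.mul_le_mul hp h2).trans_eq (mul_one k)))
  set D := 1 / τ + ∑ i ∈ Finset.range k, ‖q.coeff i‖ with hD
  have hD0 : 0 <= D := by positivity
  have hs : Summable fun n : ZZ => D * (1 / Ws^2) := (Real.summable_one_div_int_pow.2 Yn).mul_left _
  refine ⟨∑' n : ZZ, D * (1 / Ws^2), fun N => ?_⟩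
  have hc : ∑ n ∈ (Finset.Icc Vl N).erase 0, q.coeff k / Yv = 0 := by
    rw [sum_sym]
    refine Finset.sum_eq_zero fun i _ => ?_
    push_cast; rw [div_neg]; ring
  rw [<- sub_zero (∑ n ∈ _, _), <- hc, <- Finset.sum_sub_distrib]
  refine (norm_sum_le _ _).trans ((zba fun n hn => ?_).trans (hs.sum_le_tsum _ fun n _ => by positivity))
  have hn0 : n ≠ 0 := zdg hn
  have hn' : Yv ≠ 0 := by exact_mod_cast hn0
  have h1 : Yr <= |Ws| := by exact_mod_cast Int.one_le_abs hn0
  have hqe : p.eval Yw = ∑ i ∈ Finset.range k, q.coeff i * Yv^i + q.coeff k * Yv^k := by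
    rw [<- Finset.sum_range_succ (fun i => q.coeff i * Yv^i), <- Polynomial.eval_eq_sum_range' hqd, hq, Polynomial.eval_comp]; simp
  have e : (1 / (Yw - 1) + p.eval Yw) / Yv^Yl - q.coeff k / n
      = 1 / (Yw - 1) / Yv^Yl + ∑ i ∈ Finset.range k, q.coeff i * (Yv^i / Yv^Yl) := by
    rw [hqe]
    simp only [<- mul_div_assoc, <- Finset.sum_div]
    have : q.coeff k / Yv = q.coeff k * Yv^k / Yv^Yl := by rw [pow_succ]; field_simp
    rw [this]; ring
  rw [e]
  have sq : 1 / Ws^2 = 1 / |Ws|^2 := by rw [sq_abs]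
  rw [hD, sq, add_mul, Finset.sum_mul]
  refine (zeb _ _).trans (zec ?_ ((norm_sum_le _ _).trans (zba fun i hi => ?_)))
  · rw [norm_div, norm_div, norm_one, norm_pow, Complex.norm_intCast, div_mul_div_comm, div_div, one_mul]
    refine one_div_le_one_div_of_le Ye ?_
    have him : τ * |Ws| <= ‖Yw - 1‖ := by
      refine le_trans (le_of_eq ?_) (Complex.abs_im_le_norm _)
      simp [abs_mul, zea hτ]
    calc τ * |Ws|^2 = τ * |Ws| * |Ws|^1 := by ring
      _ <= _ := mul_le_mul him (pow_le_pow_right₀ h1 Wg) Ye (norm_nonneg _)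
  · rw [norm_mul, norm_div, norm_pow, norm_pow, Complex.norm_intCast]
    refine zaa ?_ (norm_nonneg _)
    rw [zce Ye Ye, <- pow_add, one_mul]
    exact pow_le_pow_right₀ h1 (by have := zbb.1 hi; omega)
lemma psi_sum (u v : NN) (hcop : Nat.Coprime u v) (hv : 2 <= v) (hvu : v < u) (j : NN) (L : RR) (hLd : L = log Wc) (hL : 0 < L) (N M : NN) (hM : log N <= L * M) :
    ∑ h ∈ Finset.Ioo (0:ZZ) ⌈log N / L⌉, psiB j (Wc^h) = ∑ i ∈ Finset.range M, (if L * Yo < log N then bz j (exp Yg) else 0) := by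
  have hu : 0 < (u:RR) / v := by
    have : 0 < u := by omega
    positivity
  rw [<- Finset.sum_filter]
  symm
  refine Finset.sum_bij (fun i _ => (i:ZZ)+1) (fun i hi => ?_) (fun a _ b _ h => by simpa using h) (fun h hh => ?_) (fun i hi => ?_)
  · rw [Finset.mem_filter] at hi
    rw [Finset.mem_Ioo, Int.lt_ceil, lt_div_iff₀ hL]
    exact ⟨by omega, by push_cast; linarith [hi.2]⟩
  · rw [Finset.mem_Ioo, Int.lt_ceil, lt_div_iff₀ hL] at hh
    obtain ⟨m, rfl⟩ : ∃ m : NN, h = (m:ZZ)+1 := ⟨(h-1).toNat, by omega⟩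
    have h2 := hh.2
    push_cast at h2
    refine ⟨m, ?_, rfl⟩
    rw [Finset.mem_filter, zbb]
    refine ⟨?_, by linarith⟩
    have : ((m:RR)+1) * L < M * L := by linarith
    have := lt_of_mul_lt_mul_right this hL.le
    exact_mod_cast (by linarith : (m:RR) < M)
  · have e : exp Yg = Wc^Yo := by
      have := exp_nat_mul L Yo
      rw [mul_comm] at this; push_cast at this; rw [this, hLd, exp_log hu]
    have e2 : Wc^((i:ZZ)+1) = Wc^Yo := by exact_mod_cast zpow_natCast Wc Yo
    rw [e, e2, psiB_eq]
    right
    rw [Ne, Int.fract_eq_iff]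
    rintro ⟨_, _, z, hz⟩
    exact pow_nonint u v hcop hv Yo Wg z Wk
end PartA2
section PartA3
open Set MeasureTheory Filter Topology Real
lemma part_one (u v : NN) (hcop : Nat.Coprime u v) (hv : 2 <= v) (hvu : v < u) (k : NN) (L : RR) (hLd : L = log Wc) (hL : 0 < L) (ε : RR) (hε : 0 < ε) :
    ∀ᶠ N : NN in atTop, ‖((Nat.factorial Wt : CC) / (2 * (π : CC) * Complex.I) ^ Wt) *
            ∑ n ∈ (Finset.Icc (-(N : ZZ)) (N : ZZ)).erase 0,
              riemannZeta (-(k : CC) + 2 * (π : CC) * Complex.I * (n : CC) / (L : CC)) / (n : CC) ^ Wt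
          - (-(1 / (L : CC) ^ k) * ∑ h ∈ Finset.Ioo (0 : ZZ) ⌈log N / L⌉, (psiB Wt (Va ^ h) : CC))‖ <= ε * log N := by
  obtain ⟨p, hp, Cz, hCz, hz⟩ := zeta_final k
  set τ : RR := 2 * π / L with hτ
  have hτp : 0 < τ := by positivity
  obtain ⟨Q, hQ0, hQ⟩ := poch_Q k (τ * Complex.I)
  obtain ⟨Cb, hCb0, hCb⟩ := beta_bd Q
  obtain ⟨CH, hCH⟩ := head_bd k τ hτp p hp
  obtain ⟨C0, hC0⟩ := small_n Yl Wg L hL 0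
  have hLc : Vd ≠ 0 := by exact_mod_cast hL.ne'
  have hpi : (π:CC) ≠ 0 := by exact_mod_cast pi_ne_zero
  have hs : ∀ n : ZZ, -(k : CC) + 2 * (π : CC) * Complex.I * (n : CC) / (L : CC) = -(k:CC) + (τ * Complex.I) * n := fun n => by
    rw [hτ]; push_cast; ring
  set c : CC := (Nat.factorial Wt : CC) / (2 * (π : CC) * Complex.I) ^ Wt with hc
  have hcc : c * (L / Wu * Q.eval 0) = 1 / Vd^k := by
    have : Wu ≠ 0 := by exact_mod_cast Nat.factorial_ne_zero _
    rw [hQ0, hc, hτ]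
    push_cast
    have h2 : (2 * (π : CC) * Complex.I) ≠ 0 := by simp [hpi]
    have e : (2 * (π:CC) / L * Complex.I) = (2 * π * Complex.I) / L := by ring
    rw [e, div_pow]
    have := pow_ne_zero Yl h2
    field_simp
    ring
  set a := ‖c * (L / Wu)‖ with ha
  set D := ‖c‖ * CH + 1 / L^k * C0 + ‖c‖ * (2 * (Wz * (Cz * (2 + τ)))) with hD
  set A := 2 / L + 2 with hA
  filter_upwards [combine u v hcop hv hvu Yl Wg L hLd hL (ε * L^k / 4) Ye,
    lower Yl Wg L hL (fun n => Q.eval (1 / Yv) - Q.eval 0) Cb hCb A Ye (ε / (4 * (a + 1))) Ye,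
    eventually_ge_atTop 2, log_top.eventually_ge_atTop 1, log_top.eventually_ge_atTop (D * (2 / ε))] with N h1 h2 hN hlog1 hlogD
  have hNp : Yh < N := by positivity
  have hl0 : 0 <= log N := by linarith
  have hDl : D <= ε / 2 * log N := by
    rw [mul_div_assoc', zae hε] at hlogD; linarith
  set M := ⌈2 * log N / L⌉₊ with hM
  have hM1 : 2 * log N <= L * M := by
    have := Nat.le_ceil (2 * log N / L)
    rw [zae hL] at this; linarith
  have hM2 : (M:RR) + 1 <= A * log N := by
    have := (Nat.ceil_lt_add_one (by positivity : 0 <= 2 * log N / L)).le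
    rw [hA, add_mul, show 2 / L * log N = 2 * log N / L by ring]; linarith
  have h1 := h1 M
  have h2 := h2 M hM2
  rw [<- psi_sum u v hcop hv hvu Yl L hLd hL N M Wk] at h1
  set S := (Finset.Icc (-(N : ZZ)) (N : ZZ)).erase 0 with hS
  set In : ZZ -> CC := fun n => ∫ y in Yh.. Yu, (bz Yl (exp Yi) : CC) * en n y with hIn
  set P : ZZ -> CC := fun n => (ascPochhammer CC Yl).eval Yw with hP
  set s : ZZ -> CC := fun n => -(k:CC) + (τ * Complex.I) * n with hsd
  set Y := exp (L * Yu) with hY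
  have hYN : (N:RR)^2 <= Y := by
    have : (N:RR)^2 = exp (2 * log N) := by
      have := exp_nat_mul (log N) 2
      rw [exp_log hNp] at this; rw [<- this]; norm_num
    rw [this, hY, exp_le_exp]; linarith
  have hY1 : 1 <= Y := one_le_exp Ye
  set er : ZZ -> CC := fun n => riemannZeta (s n) - (1/(s n - 1) + p.eval (s n) - P n / Wu * (L * In n)) with her
  have hn0 : ∀ n ∈ S, n ≠ 0 := fun n hn => zdg hn
  have hnN : ∀ n ∈ S, |Ws| <= N := fun n hn => by
    have := Finset.mem_Icc.1 (Finset.mem_of_mem_erase hn)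
    rw [abs_le]; exact_mod_cast this
  have hPQ : ∀ n ∈ S, P n / Yv^Yl = Q.eval (1 / Yv) := fun n hn => hQ n (hn0 n hn)
  have her_bd : ∀ n ∈ S, ‖er n / Yv^Yl‖ <= Wz * (Cz * (2 + τ)) * (1 / N) := fun n hn => by
    have hh := hz (s n) (by simp [hsd, hτp.ne', hn0 n hn]) (by simp [hsd]) Y hY1
    rw [zint k L hL n Yu Ye (s n) (hs n).symm] at hh
    have n1 : Yr <= |Ws| := by exact_mod_cast Int.one_le_abs (hn0 n hn)
    have q1 : ‖P n‖ / ‖Yv^Yl‖ <= ‖Q.eval 0‖ + Cb := by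
      rw [<- norm_div, hPQ n hn]
      have e := hCb n (hn0 n hn)
      have e2 : Cb / |Ws| <= Cb := div_le_self hCb0 n1
      have := zeb (Q.eval 0) (Q.eval (1 / Yv) - Q.eval 0)
      rw [add_sub_cancel] at this
      linarith
    have q2 : 1 + ‖s n + Yl‖ <= (2 + τ) * N := by
      have : s n + Yl = 1 + (τ * Complex.I) * n := by simp only [hsd]; ring
      rw [this]
      have := zeb (1:CC) ((τ * Complex.I) * n)
      rw [norm_one, norm_mul, norm_mul, Complex.norm_I, zbd, Complex.norm_intCast, zac, zea hτp, mul_one] at this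
      have := zaa (hnN n hn) hτp.le
      have : Yr <= N := by exact_mod_cast (by omega : 1 <= N)
      linarith
    rw [norm_div]
    have hnn : 0 < ‖Yv^Yl‖ := by rw [norm_pow, Complex.norm_intCast]; positivity
    calc ‖er n‖ / ‖Yv^Yl‖ <= ‖P n‖ * (Cz * (1 + ‖s n + Yl‖)) / Y / ‖Yv^Yl‖ := div_le_div_of_nonneg_right hh hnn.le
      _ = (‖P n‖ / ‖Yv^Yl‖) * (Cz * (1 + ‖s n + Yl‖)) / Y := by ring
      _ <= Wz * (Cz * ((2 + τ) * N)) / (N:RR)^2 := by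
        refine div_le_div₀ Ye ?_ Ye hYN
        exact mul_le_mul q1 (zaa q2 hCz) Ye Ye
      _ = _ := by field_simp
  have hER : ‖∑ n ∈ S, er n / Yv^Yl‖ <= 2 * (Wz * (Cz * (2 + τ))) := by
    rw [hS, sum_sym]
    refine (norm_sum_le _ _).trans ?_
    have : ∀ i ∈ Finset.range N, ‖er Yo / (((i:ZZ)+1 : ZZ):CC)^Yl + er (-Yo) / ((-((i:ZZ)+1) : ZZ):CC)^Yl‖ <= 2 * (Wz * (Cz * (2 + τ)) * (1 / N)) := fun i hi => by
      rw [zbb] at hi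
      have a1 := her_bd Yo (by rw [hS, Finset.mem_erase, Finset.mem_Icc]; omega)
      have a2 := her_bd (-Yo) (by rw [hS, Finset.mem_erase, Finset.mem_Icc]; omega)
      refine (zeb _ _).trans ?_
      linarith
    refine (zba this).trans (le_of_eq ?_)
    rw [Finset.sum_const, Finset.card_range, nsmul_eq_mul]; field_simp
  have hterm : ∀ n ∈ S, riemannZeta (-(k : CC) + 2 * (π : CC) * Complex.I * (n : CC) / (L : CC)) / (n : CC) ^ Wt
      = (1/(s n - 1) + p.eval (s n)) / Yv^Yl - L / Wu * (Q.eval 0 * In n + (Q.eval (1 / Yv) - Q.eval 0) * In n) + er n / Yv^Yl := fun n hn => by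
    rw [hs n, <- hPQ n hn]
    simp only [her]
    ring
  rw [zah rfl hterm, zde, Finset.sum_sub_distrib, <- zbe, zde, <- zbe, hS, I_sum Yl L N M, <- hS]
  have hH := hCH N
  have hI0 : ‖∫ y in Yh.. Yu, (bz Yl (exp Yi) : CC) * en 0 y‖ <= C0 := hC0 _ Ye
  set I0 := ∫ y in Yh.. Yu, (bz Yl (exp Yi) : CC) * en 0 y
  set HA := ∑ n ∈ S, (1/(s n - 1) + p.eval (s n)) / Yv^Yl
  set BI := ∑ n ∈ S, (Q.eval (1 / Yv) - Q.eval 0) * In n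
  set ER := ∑ n ∈ S, er n / Yv^Yl
  rw [<- Complex.ofReal_sum]
  set Ψ := ∑ h ∈ Finset.Ioo (0:ZZ) ⌈log N / L⌉, psiB Yl (Wc^h)
  set G := ∫ y in Yh.. Yu, bz Yl (exp Yi) * Dk N y
  have e : c * (HA - L / Wu * (Q.eval 0 * ((G:CC) - I0) + BI) + ER) - (-(1 / (L : CC) ^ k) * (Ψ:CC))
      = c * HA - 1 / Vd^k * Vf + 1 / Vd^k * I0 - c * (L / Wu) * BI + c * ER := by
    push_cast
    linear_combination (-((G:CC) - I0)) * hcc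
  rw [e]
  have nL : ‖1 / Vd^k‖ = 1 / L^k := by rw [norm_div, norm_one, norm_pow, zbd, zac, zea hL]
  have b1 : ‖c * HA‖ <= ‖c‖ * CH := by rw [norm_mul]; exact zaa hH (norm_nonneg _)
  have b2 : ‖1 / Vd^k * Vf‖ <= ε / 4 * log N := by
    rw [norm_mul, nL, zbd, zac]
    calc _ <= 1 / L^k * (ε * L^k / 4 * log N) := zaa h1 Ye
      _ = _ := by field_simp
  have b3 : ‖1 / Vd^k * I0‖ <= 1 / L^k * C0 := by rw [norm_mul, nL]; exact zaa hI0 Ye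
  have b4 : ‖c * (L / Wu) * BI‖ <= ε / 4 * log N := by
    rw [norm_mul, <- ha]
    have ha0 : 0 <= a := norm_nonneg _
    calc _ <= a * (ε / (4 * (a + 1)) * log N) := zaa h2 ha0
      _ <= (a + 1) * (ε / (4 * (a + 1)) * log N) := zab Wk Ye
      _ = _ := by field_simp
  have b5 : ‖c * ER‖ <= ‖c‖ * (2 * (Wz * (Cz * (2 + τ)))) := by rw [norm_mul]; exact zaa hER (norm_nonneg _)
  have n1 := zeb (c * HA - 1 / Vd^k * Vf + 1 / Vd^k * I0 - c * (L / Wu) * BI) (c * ER)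
  have n2 := norm_sub_le (c * HA - 1 / Vd^k * Vf + 1 / Vd^k * I0) (c * (L / Wu) * BI)
  have n3 := zeb (c * HA - 1 / Vd^k * Vf) (1 / Vd^k * I0)
  have n4 := norm_sub_le (c * HA) (1 / Vd^k * Vf)
  linarith
end PartA3
section PartF1
open Set MeasureTheory Filter Topology Real
lemma ud_iff (x : NN -> RR) : UnifDistModOne x ↔ ∀ k : NN, Tendsto (fun H : NN => (1 / (H:RR)) * ∑ h ∈ Finset.Icc 1 H, bernoulliFun Yl (Int.fract (x h))) atTop (𝓝 0) := by
  constructor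
  · intro h k
    have := h (bernoulliFun Yl) (bf_cont Yl).continuousOn
    rwa [integral_bernoulliFun_eq_zero Wg] at this
  · intro hk f hf
    set av : (RR -> RR) -> NN -> RR := fun f H => (1 / (H:RR)) * ∑ h ∈ Finset.Icc 1 H, f (Int.fract (x h)) with hav
    have one_av : ∀ (c : RR) (H : NN), 1 <= H -> av (fun _ => c) H = c := fun c H hH => by
      have : (H:RR) ≠ 0 := by positivity
      simp only [hav, Finset.sum_const, Nat.card_Icc, nsmul_eq_mul]
      simp; field_simp
    have gb : ∀ k, Tendsto (av (bernoulliFun k)) atTop (𝓝 (Yc bernoulliFun k t)) := fun k => by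
      rcases k with _ | k
      · have e : bernoulliFun 0 = fun _ => Yr := by funext t; simp
        rw [e]
        refine tendsto_const_nhds.congr' ?_
        filter_upwards [eventually_ge_atTop 1] with H hH
        rw [one_av 1 H hH]; simp
      · rw [integral_bernoulliFun_eq_zero Wg]; exact hk k
    have gs : ∀ (s : Finset NN) (c : NN -> RR) (F : NN -> RR -> RR), (∀ i, Continuous (F i)) -> (∀ i, Tendsto (av (F i)) atTop (𝓝 (Yc F i t))) →
        Tendsto (av (fun t => ∑ i ∈ s, c i * F i t)) atTop (𝓝 (Yc ∑ i ∈ s, c i * F i t)) := fun s c F hF h => by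
      rw [zdd fun i _ => ((hF i).const_mul (c i)).intervalIntegrable _ _]
      simp only [zad]
      refine (tendsto_finsetSum s fun i _ => (h i).const_mul (c i)).congr fun H => ?_
      simp only [hav]
      rw [Finset.sum_comm, zbe]
      refine zah rfl fun i _ => ?_
      rw [<- zbe]; ring
    have gm : ∀ n : NN, Tendsto (av (fun t => t^n)) atTop (𝓝 (Yc t^n)) := fun n => by
      have e : (fun t : RR => t^n) = fun t => ∑ i ∈ Finset.range (n+1), ((n+1).choose i / (n+1) : RR) * bernoulliFun i t := by
        funext t
        have := congrArg (fun p : Polynomial QQ => (p.map (algebraMap QQ RR)).eval t) (Polynomial.sum_bernoulli n)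
        simp only [Polynomial.map_sum, Polynomial.eval_finsetSum, Polynomial.map_smul, Polynomial.eval_smul, Polynomial.map_monomial, Polynomial.eval_monomial] at this
        have hn : Ws + 1 ≠ 0 := by positivity
        simp only [div_mul_eq_mul_div, <- Finset.sum_div]
        rw [eq_div_iff hn]
        simp at this
        simp only [bernoulliFun]
        rw [mul_comm, <- this]
        refine zah rfl fun i _ => ?_
        rw [Polynomial.eval_map_algebraMap]
      rw [e]
      exact gs _ _ _ bf_cont gb
    have gp : ∀ p : Polynomial RR, Tendsto (av Ww) atTop (𝓝 (Yc p.eval t)) := fun p => by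
      have e : (fun t : RR => p.eval t) = fun t => ∑ i ∈ Finset.range (p.natDegree+1), p.coeff i * t^i := by
        funext t; exact Polynomial.eval_eq_sum_range t
      rw [e]
      exact gs _ _ (fun i t => t^i) (fun i => by fun_prop) gm
    rw [Metric.tendsto_atTop]
    intro ε hε
    obtain ⟨p, hp⟩ := exists_polynomial_near_of_continuousOn 0 1 f hf (ε/3) Ye
    obtain ⟨H0, hH0⟩ := Metric.tendsto_atTop.1 (gp p) (ε/3) Ye
    refine ⟨max H0 1, fun H hH => ?_⟩
    have h1 := hH0 H (le_of_max_le_left hH)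
    have hH1 : 1 <= H := le_of_max_le_right hH
    have hHp : Yh < H := by positivity
    rw [Real.dist_eq] at h1 ⊢
    have h2 : |av f H - av Ww H| <= ε/3 := by
      rw [<- one_av (ε/3) H hH1]
      simp only [hav]
      rw [<- mul_sub, <- Finset.sum_sub_distrib, abs_mul, zbc (by positivity : 0 <= 1/(H:RR))]
      refine zaa ((zbg _ _).trans (zba fun h _ => ?_)) Ye
      rw [abs_sub_comm]
      exact (hp _ ⟨Int.fract_nonneg _, (Int.fract_lt_one _).le⟩).le
    have h3 : |(Yc p.eval t) - Yc f t| <= ε/3 := by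
      have fi : IntervalIntegrable f volume 0 1 := ContinuousOn.intervalIntegrable (by rwa [uIcc_of_le zero_le_one])
      rw [<- zdh (p.continuous.intervalIntegrable _ _) fi, <- zac]
      have := zbh (a := 0) (b := 1) (C := ε/3) (f := fun t => p.eval t - f t) fun t ht => by
        rw [uIoc_of_le zero_le_one] at ht
        exact (hp t ⟨ht.1.le, ht.2⟩).le
      simpa using this
    have := abs_add_le (av f H - av Ww H) (av Ww H - Yc p.eval t)
    have := abs_add_le ((av f H - av Ww H) + (av Ww H - Yc p.eval t)) ((Yc p.eval t) - Yc f t)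
    have e : (av f H - av Ww H) + (av Ww H - Yc p.eval t) + ((Yc p.eval t) - Yc f t) = av f H - Yc f t := by ring
    rw [e] at this
    show |av f H - _| < ε
    linarith
end PartF1
section PartF2
open Set MeasureTheory Filter Topology Real
lemma psi_av (u v : NN) (hcop : Nat.Coprime u v) (hv : 2 <= v) (j : NN) (m : ZZ) (H : NN) (hm : m = H + 1) :
    ∑ h ∈ Finset.Ioo (0:ZZ) m, psiB j (Wc^h) = ∑ h ∈ Finset.Icc 1 H, bernoulliFun j (Int.fract (Wc^h)) := by
  symm
  refine Finset.sum_bij (fun i _ => (i:ZZ)) (fun i hi => ?_) (fun a _ b _ h => by simpa using h) (fun h hh => ?_) (fun i hi => ?_)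
  · rw [Finset.mem_Icc] at hi; rw [Finset.mem_Ioo]; omega
  · rw [Finset.mem_Ioo] at hh
    exact ⟨h.toNat, by rw [Finset.mem_Icc]; omega, by omega⟩
  · rw [Finset.mem_Icc] at hi
    rw [zpow_natCast, psiB_eq, bz]
    right
    rw [Ne, Int.fract_eq_iff]
    rintro ⟨_, _, z, hz⟩
    exact pow_nonint u v hcop hv i hi.1 z Wk
lemma av_iff (L : RR) (hL : 0 < L) (g : NN -> RR) (T : ZZ -> RR) (hT : ∀ (m : ZZ) (H : NN), m = H + 1 -> T m = ∑ h ∈ Finset.Icc 1 H, g h) :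
    Tendsto (fun N : NN => 1 / log N * T ⌈log N / L⌉) atTop (𝓝 0) ↔ Tendsto (fun H : NN => (1 / (H:RR)) * ∑ h ∈ Finset.Icc 1 H, g h) atTop (𝓝 0) := by
  constructor
  · intro h
    have te : Tendsto (fun H : NN => exp (L * H)) atTop atTop := tendsto_exp_atTop.comp (tendsto_natCast_atTop_atTop.const_mul_atTop hL)
    have tN : Tendsto (fun H : NN => ⌊exp Wy⌋₊) atTop atTop := tendsto_nat_floor_atTop.comp (te.comp (tendsto_add_atTop_nat 1))
    have h' := (h.comp tN).abs.const_mul (2 * L)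
    rw [abs_zero, mul_zero] at h'
    refine squeeze_zero_norm' ?_ h'
    have q : 0 < exp L - 1 := by have := add_one_lt_exp hL.ne'; linarith
    filter_upwards [eventually_ge_atTop 1, te.eventually_gt_atTop (1 / (exp L - 1))] with H hH hbig
    rw [div_lt_iff₀ q] at hbig
    have hH' : Yr <= H := by exact_mod_cast hH
    set N := ⌊exp Wy⌋₊ with hN
    have e1 : exp Wy = exp (L * H) * exp L := by rw [<- exp_add]; push_cast; ring_nf
    have n1 : exp (L * H) < N := by
      have := Nat.lt_floor_add_one (exp Wy)
      rw [<- hN, e1] at this; linarith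
    have n2 : (N:RR) <= exp Wy := Nat.floor_le (exp_pos _).le
    have hNp : Yh < N := (exp_pos _).trans n1
    have l1 : L * H < log N := by rwa [lt_log_iff_exp_lt hNp]
    have l2 : log N <= L * (H + 1) := by have := (log_le_iff_le_exp hNp).2 n2; push_cast at this; exact this
    have lp : 0 < log N := lt_of_le_of_lt Ye l1
    have hc : ⌈log N / L⌉ = (H:ZZ) + 1 := by
      rw [Int.ceil_eq_iff]
      push_cast
      exact ⟨by rw [lt_div_iff₀ hL]; linarith, by rw [zae hL]; linarith⟩
    simp only [Function.comp]
    rw [<- hN, hT _ H hc, norm_mul, abs_mul, zac, zac, <- mul_assoc]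
    refine zab ?_ (abs_nonneg _)
    rw [zea Ye, zea Ye, mul_one_div, zce Ye lp]
    nlinarith
  · intro h
    have tl : Tendsto (fun N : NN => log N / L) atTop atTop := log_top.atTop_div_const hL
    have tH : Tendsto (fun N : NN => ⌈log N / L⌉₊ - 1) atTop atTop := (tendsto_sub_atTop_nat 1).comp (tendsto_nat_ceil_atTop.comp tl)
    have h' := (h.comp tH).abs.const_mul (1 / L)
    rw [abs_zero, mul_zero] at h'
    refine squeeze_zero_norm' ?_ h'
    filter_upwards [tH.eventually_ge_atTop 1, log_top.eventually_ge_atTop 1] with N hH hl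
    set H := ⌈log N / L⌉₊ - 1 with hHd
    have hlp : 0 < log N := by linarith
    have h1 : ⌈log N / L⌉₊ = H + 1 := by omega
    have hc : ⌈log N / L⌉ = (H:ZZ) + 1 := by
      rw [<- Int.natCast_ceil_eq_ceil Ye, h1]; push_cast; rfl
    have hH' : Yr <= H := by exact_mod_cast hH
    have hlt : (H:RR) < log N / L := by
      have := Nat.ceil_lt_add_one (by positivity : 0 <= log N / L)
      rw [h1] at this; push_cast at this; linarith
    rw [lt_div_iff₀ hL] at hlt
    simp only [Function.comp]
    rw [<- hHd, hT _ H hc, norm_mul, abs_mul, zac, zac, <- mul_assoc]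
    refine zab ?_ (abs_nonneg _)
    rw [zea Ye, zea Ye, div_mul_div_comm, one_mul, zce hlp Ye]
    linarith
lemma little_iff (a b : CC) (ha : a ≠ 0) (hb : b ≠ 0) (Z : NN -> CC) (P : NN -> RR) (h : (fun N => a * Z N - b * (P N : CC)) =o[atTop] (fun N : NN => log N)) :
    Tendsto (fun N : NN => (1 / (log N : CC)) * Z N) atTop (𝓝 0) ↔ Tendsto (fun N : NN => 1 / log N * P N) atTop (𝓝 0) := by
  have h0 : Tendsto (fun N : NN => (1 / (log N : CC)) * (a * Z N - b * (P N : CC))) atTop (𝓝 0) := by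
    have := (Asymptotics.isLittleO_iff_tendsto' (g := fun N : NN => ((log N : RR) : CC)) (l := atTop) (f := fun N => a * Z N - b * (P N : CC)) ?_).1 ?_
    · refine this.congr fun N => by ring
    · filter_upwards [log_top.eventually_gt_atTop 0] with N hN h'
      exact absurd (by exact_mod_cast h') hN.ne'
    · refine h.trans_isBigO (Asymptotics.isBigO_of_le _ fun N => ?_)
      rw [zbd]
  rw [<- Filter.tendsto_ofReal_iff (f := fun N : NN => 1 / log N * P N)]
  simp only [Complex.ofReal_mul, Complex.ofReal_div, Complex.ofReal_one, Complex.ofReal_zero]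
  constructor
  · intro hz
    have := ((hz.const_mul a).sub h0).const_mul b⁻¹
    simp only [mul_zero, sub_zero] at this
    refine this.congr fun N => ?_
    field_simp; ring
  · intro hp
    have := ((hp.const_mul b).add h0).const_mul a⁻¹
    simp only [mul_zero, add_zero] at this
    refine this.congr fun N => ?_
    field_simp; ring
end PartF2
theorem statement5 (u v : ℕ) (hcop : Nat.Coprime u v) (hv : 2 ≤ v) (hvu : v < u) (k : ℕ) :
    ((fun N : ℕ =>
        ((Nat.factorial (k + 1) : ℂ) / (2 * (Real.pi : ℂ) * Complex.I) ^ (k + 1)) *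
            ∑ n ∈ (Finset.Icc (-(N : ℤ)) (N : ℤ)).erase 0,
              riemannZeta (-(k : ℂ) + 2 * (Real.pi : ℂ) * Complex.I * (n : ℂ) /
                  (Real.log ((u : ℝ) / v) : ℂ)) / (n : ℂ) ^ (k + 1)
          - (-(1 / (Real.log ((u : ℝ) / v) : ℂ) ^ k) *
              ∑ h ∈ Finset.Ioo (0 : ℤ) ⌈Real.log N / Real.log ((u : ℝ) / v)⌉,
                (psiB (k + 1) (((u : ℝ) / v) ^ h) : ℂ)))
      =o[Filter.atTop] (fun N : ℕ => Real.log N))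
    ∧ (UnifDistModOne (fun h : ℕ => ((u : ℝ) / v) ^ h) ↔
        ∀ k' : ℕ,
          Filter.Tendsto
            (fun N : ℕ =>
              (1 / (Real.log N : ℂ)) *
                ∑ n ∈ (Finset.Icc (-(N : ℤ)) (N : ℤ)).erase 0,
                  riemannZeta (-(k' : ℂ) + 2 * (Real.pi : ℂ) * Complex.I * (n : ℂ) /
                      (Real.log ((u : ℝ) / v) : ℂ)) / (n : ℂ) ^ (k' + 1))
            Filter.atTop (nhds 0)) := by
  have hL : 0 < Real.log ((u:ℝ)/v) := by
    apply Real.log_pos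
    have : (0:ℝ) < v := by positivity
    rw [one_lt_div this]
    exact_mod_cast hvu
  have p1 : ∀ k : ℕ, ((fun N : ℕ =>
        ((Nat.factorial (k + 1) : ℂ) / (2 * (Real.pi : ℂ) * Complex.I) ^ (k + 1)) *
            ∑ n ∈ (Finset.Icc (-(N : ℤ)) (N : ℤ)).erase 0,
              riemannZeta (-(k : ℂ) + 2 * (Real.pi : ℂ) * Complex.I * (n : ℂ) /
                  (Real.log ((u : ℝ) / v) : ℂ)) / (n : ℂ) ^ (k + 1)
          - (-(1 / (Real.log ((u : ℝ) / v) : ℂ) ^ k) *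
              ∑ h ∈ Finset.Ioo (0 : ℤ) ⌈Real.log N / Real.log ((u : ℝ) / v)⌉,
                (psiB (k + 1) (((u : ℝ) / v) ^ h) : ℂ)))
      =o[Filter.atTop] (fun N : ℕ => Real.log N)) := fun k => by
    rw [Asymptotics.isLittleO_iff]
    intro ε hε
    filter_upwards [part_one u v hcop hv hvu k _ rfl hL ε hε] with N hN
    rwa [Real.norm_eq_abs, abs_of_nonneg (Real.log_natCast_nonneg N)]
  refine ⟨p1 k, ?_⟩
  rw [ud_iff]
  refine forall_congr' fun k' => ?_
  have hLc : (Real.log ((u:ℝ)/v) : ℂ) ≠ 0 := by exact_mod_cast hL.ne'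
  have hpi : (Real.pi : ℂ) ≠ 0 := by exact_mod_cast Real.pi_ne_zero
  have ha : ((Nat.factorial (k' + 1) : ℂ) / (2 * (Real.pi : ℂ) * Complex.I) ^ (k' + 1)) ≠ 0 := by
    refine div_ne_zero (by exact_mod_cast Nat.factorial_ne_zero _) (pow_ne_zero _ ?_)
    simp [hpi]
  have hb : (-(1 / (Real.log ((u : ℝ) / v) : ℂ) ^ k')) ≠ 0 := neg_ne_zero.2 (one_div_ne_zero (pow_ne_zero _ hLc))
  have h1 := p1 k'
  simp only [← Complex.ofReal_sum] at h1
  rw [little_iff _ _ ha hb _ _ h1]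
  exact (av_iff _ hL _ (fun m => ∑ h ∈ Finset.Ioo (0:ℤ) m, psiB (k'+1) (((u:ℝ)/v)^h)) (fun m H hm => psi_av u v hcop hv (k'+1) m H hm)).symm
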